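/- arXiv:1307.8383 — 6 statements merged into one kernel-verified Lean document; each statement's English description precedes it below -/
import Mathlib

section
/- Let α ∈ ℝ and A, B, D ∈ ℂ with 0 < Re(e^{iα}D) < ½·Re(e^{iα}(B−A)). Then for every measurable function φ on e^{iα}ℝ one has ‖φ‖_α^{A+D, B−D} ≤ (4 / Re(e^{iα}D)) · |φ|_α^{A,B}. -/
open Complex MeasureTheory

/-- The weight `|e^{−A e^{iα}s}| + |e^{−B e^{iα}s}|`. -/
noncomputable def BLweight (α : ℝ) (A B : ℂ) (s : ℝ) : ℝ :=
  ‖Complex.exp (-A * (Complex.exp (α * Complex.I) * s))‖ +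
    ‖Complex.exp (-B * (Complex.exp (α * Complex.I) * s))‖

/-- The sup-norm `|φ|_α^{A,B}`, valued in `ℝ≥0∞`. -/
noncomputable def BLsupNorm (α : ℝ) (A B : ℂ) (φ : ℂ → ℂ) : ENNReal :=
  ⨆ s : ℝ, ENNReal.ofReal
    (‖φ (Complex.exp (α * Complex.I) * s)‖ * BLweight α A B s)

/-- The integral norm `‖φ‖_α^{A,B}`, valued in `ℝ≥0∞`. -/
noncomputable def BLintNorm (α : ℝ) (A B : ℂ) (φ : ℂ → ℂ) : ENNReal :=
  ∫⁻ s : ℝ, ENNReal.ofReal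
    (‖φ (Complex.exp (α * Complex.I) * s)‖ * BLweight α A B s)

lemma BLweight_eq (α : ℝ) (A B : ℂ) (s : ℝ) : BLweight α A B s =
    Real.exp (-(Complex.exp (α * Complex.I) * A).re * s) +
    Real.exp (-(Complex.exp (α * Complex.I) * B).re * s) := by
  have key : ∀ C : ℂ, (-C * (Complex.exp (α * Complex.I) * s)).re =
      -(Complex.exp (α * Complex.I) * C).re * s := by
    intro C
    have : -C * (Complex.exp (α * Complex.I) * s) =
        (-(Complex.exp (α * Complex.I) * C)) * (s : ℂ) := by ring
    rw [this, Complex.re_mul_ofReal, Complex.neg_re]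
  unfold BLweight
  rw [Complex.norm_exp, Complex.norm_exp, key, key]

lemma weight_bound (a b d s : ℝ) (hd : d < (1 / 2) * (b - a)) :
    Real.exp (-(a + d) * s) + Real.exp (-(b - d) * s) ≤
      2 * Real.exp (-d * |s|) * (Real.exp (-a * s) + Real.exp (-b * s)) := by
  rcases le_total 0 s with hs | hs
  · have h1 : Real.exp (-(b - d) * s) ≤ Real.exp (-(a + d) * s) :=
      Real.exp_le_exp.2 (by nlinarith)
    have h2 : Real.exp (-(a + d) * s) = Real.exp (-d * |s|) * Real.exp (-a * s) := by
      rw [← Real.exp_add, abs_of_nonneg hs]; ring_nf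
    have h3 : 0 < Real.exp (-d * |s|) * Real.exp (-b * s) := by positivity
    nlinarith
  · have h1 : Real.exp (-(a + d) * s) ≤ Real.exp (-(b - d) * s) :=
      Real.exp_le_exp.2 (by nlinarith)
    have h2 : Real.exp (-(b - d) * s) = Real.exp (-d * |s|) * Real.exp (-b * s) := by
      rw [← Real.exp_add, abs_of_nonpos hs]; ring_nf
    have h3 : 0 < Real.exp (-d * |s|) * Real.exp (-a * s) := by positivity
    nlinarith

lemma lintegral_kernel (d : ℝ) (hd : 0 < d) :
    ∫⁻ s : ℝ, ENNReal.ofReal (2 * Real.exp (-d * |s|)) = ENNReal.ofReal (4 / d) := by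
  have hval : ∫ s : ℝ, 2 * Real.exp (-d * |s|) = 4 / d := by
    rw [integral_comp_abs (f := fun x => 2 * Real.exp (-d * x)), integral_const_mul,
      integral_exp_mul_Ioi (by linarith)]
    simp
    field_simp
    norm_num
  have hint : Integrable (fun s : ℝ => 2 * Real.exp (-d * |s|)) := by
    by_contra h
    rw [integral_undef h] at hval
    have : 0 < 4 / d := by positivity
    linarith
  rw [← ofReal_integral_eq_lintegral_ofReal hint
    (Filter.Eventually.of_forall fun s => by positivity), hval]

/-- Lemma 2.3 of the paper. If
`0 < Re(e^{iα}D) < ½ Re(e^{iα}(B−A))`, then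
`‖φ‖_α^{A+D,B−D} ≤ (4 / Re(e^{iα}D)) · |φ|_α^{A,B}` for every `φ`. -/
theorem intNorm_le_supNorm_of_shrink
    (α : ℝ) (A B D : ℂ)
    (hD0 : 0 < (Complex.exp (α * Complex.I) * D).re)
    (hD : (Complex.exp (α * Complex.I) * D).re <
      (1 / 2) * (Complex.exp (α * Complex.I) * (B - A)).re)
    (φ : ℂ → ℂ)
    (hmeas : Measurable fun s : ℝ => φ (Complex.exp (α * Complex.I) * s)) :
    BLintNorm α (A + D) (B - D) φ ≤
      ENNReal.ofReal (4 / (Complex.exp (α * Complex.I) * D).re) *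
        BLsupNorm α A B φ := by
  have hw : ∀ s : ℝ, BLweight α (A + D) (B - D) s ≤
      2 * Real.exp (-(Complex.exp (α * Complex.I) * D).re * |s|) * BLweight α A B s := by
    intro s
    rw [BLweight_eq, BLweight_eq, mul_add, mul_sub, Complex.add_re, Complex.sub_re]
    apply weight_bound
    rwa [mul_sub, Complex.sub_re] at hD
  rw [← lintegral_kernel _ hD0, ← lintegral_mul_const _ (by fun_prop)]
  unfold BLintNorm
  apply lintegral_mono
  intro s
  calc ENNReal.ofReal (‖φ (Complex.exp (α * Complex.I) * s)‖ * BLweight α (A + D) (B - D) s)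
      ≤ ENNReal.ofReal (2 * Real.exp (-(Complex.exp (α * Complex.I) * D).re * |s|) *
          (‖φ (Complex.exp (α * Complex.I) * s)‖ * BLweight α A B s)) := by
        apply ENNReal.ofReal_le_ofReal
        have := mul_le_mul_of_nonneg_left (hw s)
          (norm_nonneg (φ (Complex.exp (α * Complex.I) * s)))
        linarith
    _ = ENNReal.ofReal (2 * Real.exp (-(Complex.exp (α * Complex.I) * D).re * |s|)) *
          ENNReal.ofReal (‖φ (Complex.exp (α * Complex.I) * s)‖ * BLweight α A B s) :=
        ENNReal.ofReal_mul (by positivity)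
    _ ≤ _ := by
        apply mul_le_mul_right
        exact le_iSup (fun s : ℝ => ENNReal.ofReal
          (‖φ (Complex.exp (α * Complex.I) * s)‖ * BLweight α A B s)) s
end

section
/- Let A ∈ ℂ, let H_α^A := {t ∈ ℂ : Re(e^{iα}t) > Re(e^{iα}A)}, and let f be holomorphic on H_α^A, absolutely integrable on each line C + ie^{−iα}ℝ ⊆ H_α^A, with f(t) → 0 as |t| → ∞ uniformly on each closed half-plane {t : Re(e^{iα}t) ≥ Re(e^{iα}A₁)} with Re(e^{iα}A₁) > Re(e^{iα}A). Then the Borel transform f̃(ξ) := (1/2πi)·i e^{−iα} ∫_ℝ f(C + ie^{−iα}u)·e^{(C+ie^{−iα}u)ξ} du converges absolutely for every ξ ∈ e^{iα}ℝ and is independent of the choice of C ∈ H_α^A; f̃ is continuous on e^{iα}ℝ; f̃(e^{iα}s) = 0 for every s < 0; for every A₁ with Re(e^{iα}A₁) > Re(e^{iα}A), sup_{s>0} |f̃(e^{iα}s)|·e^{−Re(A₁ e^{iα})·s} ≤ (1/2π)·sup_{C : Re(e^{iα}C) ≥ Re(e^{iα}A₁)} ∫_ℝ |f(C + ie^{−iα}u)|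 du; and for every t ∈ H_α^A one has f(t) = e^{iα} ∫₀^{+∞} f̃(e^{iα}s)·e^{−t e^{iα}s} ds, the one-sided Laplace transform of f̃ in direction α. -/
open Complex MeasureTheory Real

/-- The open half-plane `H_α^A = {t : Re(e^{iα}t) > Re(e^{iα}A)}`. -/
def openHalfPlane (α : ℝ) (A : ℂ) : Set ℂ :=
  {t : ℂ | (Complex.exp (α * Complex.I) * A).re < (Complex.exp (α * Complex.I) * t).re}

/-- The point on the line `C + i e^{−iα}ℝ` with parameter `u`. -/
noncomputable def linePt (α : ℝ) (C : ℂ) (u : ℝ) : ℂ :=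
  C + Complex.I * Complex.exp (-α * Complex.I) * u

/-- The Borel transform of `f` in direction `α` along the line through `C`. -/
noncomputable def BorelLine (α : ℝ) (f : ℂ → ℂ) (C ξ : ℂ) : ℂ :=
  (1 / (2 * Real.pi * Complex.I)) * (Complex.I * Complex.exp (-α * Complex.I)) *
    ∫ u : ℝ, f (linePt α C u) * Complex.exp (linePt α C u * ξ)

lemma aux_integrable (g : ℂ → ℂ) (c s : ℝ)
    (hg : Integrable fun u : ℝ => g (c + u * I)) :
    Integrable fun u : ℝ => g (c + u * I) * Complex.exp ((c + u * I) * s) := by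
  refine hg.mul_bdd (c := Real.exp (c * s)) (by fun_prop) ?_
  refine Filter.Eventually.of_forall fun u => ?_
  rw [Complex.norm_exp]
  simp

lemma aux_rect (F : ℂ → ℂ) (a : ℝ) (hF : DifferentiableOn ℂ F {w | a < w.re})
    (c X R : ℝ) (hc : a < c) (hX : a < X) :
    I * (∫ y in (-R)..R, F (c + y * I)) =
      (∫ x in c..X, F (x + (-R : ℝ) * I)) - (∫ x in c..X, F (x + R * I))
        + I * ∫ y in (-R)..R, F (X + y * I) := by
  have h := Complex.integral_boundary_rect_eq_zero_of_differentiableOn F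
    (⟨c, -R⟩ : ℂ) (⟨X, R⟩ : ℂ) (hF.mono ?_)
  · simp only [smul_eq_mul] at h
    linear_combination -h
  · intro z hz
    have := hz.1
    simp only [Set.mem_preimage, Set.mem_uIcc] at this
    simp only [Set.mem_ofPred_eq]
    rcases this with h | h <;> linarith [h.1]

lemma aux_vert (F : ℂ → ℂ) (c : ℝ) (h : Integrable fun u : ℝ => F (c + u * I)) :
    Filter.Tendsto (fun R : ℝ => ∫ y in (-R)..R, F (c + y * I)) Filter.atTop
      (nhds (∫ u : ℝ, F (c + u * I))) :=
  intervalIntegral_tendsto_integral h Filter.tendsto_neg_atTop_atBot Filter.tendsto_id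

lemma aux_indep_le (g : ℂ → ℂ) (a : ℝ) (hg : DifferentiableOn ℂ g {w | a < w.re})
    (hint : ∀ c : ℝ, a < c → Integrable fun u : ℝ => g (c + u * I))
    (hdecay : ∀ c : ℝ, a < c → ∀ δ > 0, ∃ ρ : ℝ, ∀ w : ℂ, c ≤ w.re → ρ ≤ ‖w‖ → ‖g w‖ ≤ δ)
    (s c X : ℝ) (hc : a < c) (hX : c ≤ X) :
    (∫ u : ℝ, g (c + u * I) * Complex.exp ((c + u * I) * s)) =
    (∫ u : ℝ, g (X + u * I) * Complex.exp ((X + u * I) * s)) := by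
  have hX' : a < X := lt_of_lt_of_le hc hX
  let F : ℂ → ℂ := fun w => g w * Complex.exp (w * s)
  have hF : DifferentiableOn ℂ F {w | a < w.re} := hg.mul (by fun_prop)
  have h1 := aux_vert F c (aux_integrable g c s (hint c hc))
  have h2 := aux_vert F X (aux_integrable g X s (hint X hX'))
  set E := Real.exp ((|c| + |X|) * |s|) with hE
  have hEpos : 0 < E := Real.exp_pos _
  have h3 : Filter.Tendsto (fun R : ℝ => (∫ y in (-R)..R, F (c + y * I)) -
      ∫ y in (-R)..R, F (X + y * I)) Filter.atTop (nhds 0) := by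
    rw [Metric.tendsto_atTop]
    intro ε hε
    set δ := ε / (4 * E * (|X - c| + 1)) with hδ
    have hδpos : 0 < δ := by positivity
    obtain ⟨ρ, hρ⟩ := hdecay c hc δ hδpos
    refine ⟨max ρ 0, fun R hR => ?_⟩
    have hR0 : 0 ≤ R := le_trans (le_max_right _ _) hR
    have hRρ : ρ ≤ R := le_trans (le_max_left _ _) hR
    have hH : ∀ r : ℝ, |r| = R → ‖∫ x in c..X, F (x + r * I)‖ ≤ δ * E * |X - c| := by
      intro r hr
      refine intervalIntegral.norm_integral_le_of_norm_le_const fun x hx => ?_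
      rw [Set.uIoc_of_le hX] at hx
      simp only [F, norm_mul]
      refine mul_le_mul (hρ _ (by simpa using hx.1.le) ?_) ?_ (norm_nonneg _) hδpos.le
      · calc ρ ≤ |r| := by rw [hr]; exact hRρ
          _ = |(x + r * I : ℂ).im| := by simp
          _ ≤ _ := Complex.abs_im_le_norm _
      · rw [Complex.norm_exp, hE]
        apply Real.exp_le_exp.2
        simp only [mul_re, add_re, ofReal_re, ofReal_im, I_re, I_im, mul_zero, mul_one, sub_self, add_zero, sub_zero]
        calc x * s ≤ |x * s| := le_abs_self _
          _ = |x| * |s| := abs_mul _ _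
          _ ≤ _ := by
            gcongr
            rw [abs_le]
            constructor
            · linarith [neg_abs_le c, abs_nonneg X, hx.1]
            · linarith [le_abs_self X, abs_nonneg c, hx.2]
    have key := aux_rect F a hF c X R hc hX'
    have : I * ((∫ y in (-R)..R, F (c + y * I)) - ∫ y in (-R)..R, F (X + y * I)) =
      (∫ x in c..X, F (x + (-R : ℝ) * I)) - (∫ x in c..X, F (x + R * I)) := by
      linear_combination key
    rw [dist_zero_right]
    have hn := congrArg norm this
    rw [norm_mul, norm_I, one_mul] at hn
    rw [hn]
    calc _ ≤ _ := norm_sub_le _ _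
      _ ≤ δ * E * |X - c| + δ * E * |X - c| :=
        add_le_add (hH _ (by rw [abs_neg, abs_of_nonneg hR0])) (hH _ (abs_of_nonneg hR0))
      _ ≤ 2 * (δ * E * (|X - c| + 1)) := by nlinarith [mul_pos hδpos hEpos]
      _ = ε / 2 := by rw [hδ]; field_simp; norm_num
      _ < ε := by linarith
  exact sub_eq_zero.1 (tendsto_nhds_unique (h1.sub h2) h3)

lemma aux_vanish (g : ℂ → ℂ) (a : ℝ) (hg : DifferentiableOn ℂ g {w | a < w.re})
    (hint : ∀ c : ℝ, a < c → Integrable fun u : ℝ => g (c + u * I))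
    (hdecay : ∀ c : ℝ, a < c → ∀ δ > 0, ∃ ρ : ℝ, ∀ w : ℂ, c ≤ w.re → ρ ≤ ‖w‖ → ‖g w‖ ≤ δ)
    (s c : ℝ) (hc : a < c) (hs : s < 0) :
    (∫ u : ℝ, g (c + u * I) * Complex.exp ((c + u * I) * s)) = 0 := by
  let F : ℂ → ℂ := fun w => g w * Complex.exp (w * s)
  have hF : DifferentiableOn ℂ F {w | a < w.re} := hg.mul (by fun_prop)
  have h1 := aux_vert F c (aux_integrable g c s (hint c hc))
  set K := Real.exp (c * s) / (-s) with hK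
  have hKpos : 0 < K := div_pos (Real.exp_pos _) (by linarith)
  have hFn : ∀ (x y δ : ℝ), ‖g (x + y * I)‖ ≤ δ → ‖F (x + y * I)‖ ≤ δ * Real.exp (s * x) := by
    intro x y δ h
    simp only [F, norm_mul]
    have hδ : 0 ≤ δ := (norm_nonneg _).trans h
    gcongr
    rw [Complex.norm_exp]
    simp [mul_comm]
  have main : ∀ δ > 0, ‖∫ u : ℝ, F (c + u * I)‖ ≤ 4 * δ * K := by
    intro δ hδ
    obtain ⟨ρ, hρ⟩ := hdecay c hc δ hδ
    refine le_of_tendsto h1.norm ?_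
    filter_upwards [Filter.eventually_ge_atTop 0, Filter.eventually_ge_atTop ρ,
      Filter.eventually_ge_atTop (ρ - c)] with R hR0 hRρ hRc
    have hH : ∀ r : ℝ, |r| = R → ‖∫ x in c..(c + R), F (x + r * I)‖ ≤ δ * K := by
      intro r hr
      have : ‖∫ x in c..(c + R), F (x + r * I)‖ ≤ ∫ x in c..(c + R), δ * Real.exp (s * x) := by
        refine intervalIntegral.norm_integral_le_of_norm_le (by linarith) ?_
          (Continuous.intervalIntegrable (by fun_prop) _ _)
        refine Filter.Eventually.of_forall fun x hx => ?_
        refine hFn _ _ _ (hρ _ (by simpa using hx.1.le) ?_)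
        calc ρ ≤ |r| := by rw [hr]; exact hRρ
          _ = |(x + r * I : ℂ).im| := by simp
          _ ≤ _ := Complex.abs_im_le_norm _
      refine this.trans ?_
      rw [intervalIntegral.integral_const_mul]
      gcongr
      rw [intervalIntegral.integral_comp_mul_left (fun x => Real.exp x) hs.ne, integral_exp, hK,
        smul_eq_mul, div_eq_inv_mul, inv_neg, mul_comm c s]
      have := Real.exp_pos (s * (c + R))
      have h' : s⁻¹ < 0 := inv_lt_zero.2 hs
      nlinarith
    have hV : ‖∫ y in (-R)..R, F ((c + R : ℝ) + y * I)‖ ≤ 2 * δ * K := by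
      have : ‖∫ y in (-R)..R, F ((c + R : ℝ) + y * I)‖ ≤
          δ * Real.exp (s * (c + R)) * |R - -R| := by
        refine intervalIntegral.norm_integral_le_of_norm_le_const fun y _ => ?_
        refine hFn _ _ _ (hρ _ (by simpa using hR0) ?_)
        calc ρ ≤ c + R := by linarith
          _ = ((c + R : ℝ) + y * I : ℂ).re := by simp
          _ ≤ _ := Complex.re_le_norm _
      refine this.trans ?_
      rw [show R - -R = 2 * R by ring, abs_of_nonneg (by linarith)]
      have hb : R * Real.exp (s * (c + R)) ≤ K := by
        rw [hK, le_div_iff₀ (by linarith), mul_add, Real.exp_add, mul_comm c s]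
        have h2 : (-s * R) * Real.exp (s * R) ≤ 1 := by
          have := Real.add_one_le_exp (-s * R)
          calc (-s * R) * Real.exp (s * R) ≤ Real.exp (-s * R) * Real.exp (s * R) := by
                gcongr; linarith
            _ = 1 := by rw [← Real.exp_add]; simp
        nlinarith [Real.exp_pos (s * c)]
      nlinarith
    have key := aux_rect F a hF c (c + R) R hc (by linarith)
    have hn := congrArg norm key
    rw [norm_mul, norm_I, one_mul] at hn
    rw [hn]
    refine (norm_add_le _ _).trans ?_
    rw [norm_mul, norm_I, one_mul]
    have e1 := hH (-R) (by rw [abs_neg, abs_of_nonneg hR0])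
    have e2 := hH R (abs_of_nonneg hR0)
    have e3 := norm_sub_le (∫ x in c..(c + R), F (x + (-R : ℝ) * I)) (∫ x in c..(c + R), F (x + R * I))
    linarith
  rw [← norm_le_zero_iff]
  refine le_of_forall_pos_le_add fun ε hε => ?_
  have := main (ε / (4 * K)) (by positivity)
  rw [zero_add]
  have e : 4 * (ε / (4 * K)) * K = ε := by field_simp
  rwa [e] at this

lemma aux_main (g : ℂ → ℂ) (a : ℝ) (hg : DifferentiableOn ℂ g {w | a < w.re})
    (hint : ∀ c : ℝ, a < c → Integrable fun u : ℝ => g (c + u * I))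
    (hdecay : ∀ c : ℝ, a < c → ∀ δ > 0, ∃ ρ : ℝ, ∀ w : ℂ, c ≤ w.re → ρ ≤ ‖w‖ → ‖g w‖ ≤ δ) :
    ∃ G : ℝ → ℂ,
      (∀ c : ℝ, a < c → ∀ s : ℝ,
        (∫ u : ℝ, g (c + u * I) * Complex.exp ((c + u * I) * s)) = G s) ∧
      Continuous G ∧ (∀ s < 0, G s = 0) ∧
      (∀ c : ℝ, a < c → ∀ s : ℝ, ‖G s‖ ≤ Real.exp (c * s) * ∫ u : ℝ, ‖g (c + u * I)‖) ∧
      (∀ w : ℂ, a < w.re → IntegrableOn (fun s : ℝ => G s * Complex.exp (-w * s)) (Set.Ioi 0) ∧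
        (∫ s : ℝ in Set.Ioi 0, G s * Complex.exp (-w * s)) = 2 * π * g w) := by
  have hexp : ∀ c s u : ℝ, ‖Complex.exp ((c + u * I) * s)‖ = Real.exp (c * s) := by
    intro c s u
    rw [Complex.norm_exp]; simp
  let G : ℝ → ℂ := fun s =>
    ∫ u : ℝ, g ((a + 1 : ℝ) + u * I) * Complex.exp (((a + 1 : ℝ) + u * I) * s)
  have h1 : ∀ c : ℝ, a < c → ∀ s : ℝ,
        (∫ u : ℝ, g (c + u * I) * Complex.exp ((c + u * I) * s)) = G s := by
    intro c hc s
    rcases le_total c (a + 1) with h | h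
    · exact aux_indep_le g a hg hint hdecay s c (a + 1) hc h
    · exact (aux_indep_le g a hg hint hdecay s (a + 1) c (by linarith) h).symm
  have h2 : Continuous G := by
    rw [continuous_iff_continuousAt]
    intro s0
    refine continuousAt_of_dominated (bound := fun u : ℝ =>
      ‖g ((a + 1 : ℝ) + u * I)‖ * Real.exp (|a + 1| * (|s0| + 1))) ?_ ?_ ?_ ?_
    · exact Filter.Eventually.of_forall fun s =>
        (aux_integrable g (a + 1) s (hint _ (by linarith))).aestronglyMeasurable
    · filter_upwards [Metric.ball_mem_nhds s0 one_pos] with s hs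
      refine Filter.Eventually.of_forall fun u => ?_
      rw [norm_mul, hexp]
      refine mul_le_mul_of_nonneg_left (Real.exp_le_exp.2 ?_) (norm_nonneg _)
      rw [Metric.mem_ball, Real.dist_eq] at hs
      calc (a + 1) * s ≤ |(a + 1) * s| := le_abs_self _
        _ = |a + 1| * |s| := abs_mul _ _
        _ ≤ _ := by
          gcongr
          have := abs_sub_abs_le_abs_sub s s0
          linarith
    · exact (hint (a + 1) (by linarith)).norm.mul_const _
    · exact Filter.Eventually.of_forall fun u => by fun_prop
  have h3 : ∀ s < 0, G s = 0 := fun s hs =>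
    aux_vanish g a hg hint hdecay s (a + 1) (by linarith) hs
  have h4 : ∀ c : ℝ, a < c → ∀ s : ℝ,
      ‖G s‖ ≤ Real.exp (c * s) * ∫ u : ℝ, ‖g (c + u * I)‖ := by
    intro c hc s
    rw [← h1 c hc s, ← integral_const_mul]
    refine (norm_integral_le_integral_norm _).trans (le_of_eq ?_)
    congr 1
    ext u
    rw [norm_mul, hexp, mul_comm]
  have h5 : ∀ w : ℂ, a < w.re → Integrable (fun s : ℝ => G s * Complex.exp (-w * s)) := by
    intro w hw
    have hz : ∀ s < 0, G s * Complex.exp (-w * s) = 0 := fun s hs => by rw [h3 s hs, zero_mul]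
    have hi : IntegrableOn (fun s : ℝ => G s * Complex.exp (-w * s)) (Set.Ioi 0) := by
      obtain ⟨c, hac, hcw⟩ := exists_between hw
      have hb := (integrableOn_exp_mul_Ioi (a := c - w.re) (by linarith) 0).mul_const
        (∫ u : ℝ, ‖g (c + u * I)‖)
      refine Integrable.mono' hb (by fun_prop) ?_
      refine Filter.Eventually.of_forall fun s => ?_
      rw [norm_mul, Complex.norm_exp]
      calc _ ≤ (Real.exp (c * s) * ∫ u : ℝ, ‖g (c + u * I)‖) * Real.exp (-w * s).re := by
            gcongr; exact h4 c hac s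
        _ = _ := by
            rw [sub_mul, sub_eq_add_neg, Real.exp_add]
            simp only [mul_re, neg_re, ofReal_re, ofReal_im, mul_zero, sub_zero, neg_mul]
            ring
    rw [← integrableOn_Ici_iff_integrableOn_Ioi] at hi
    refine hi.integrable_of_forall_notMem_eq_zero fun s hs => hz s (by simpa using hs)
  refine ⟨G, h1, h2, h3, h4, fun w hw => ⟨(h5 w hw).integrableOn, ?_⟩⟩
  have hset : (∫ s : ℝ in Set.Ioi 0, G s * Complex.exp (-w * s)) =
      ∫ s : ℝ, G s * Complex.exp (-w * s) := by
    rw [← integral_Ici_eq_integral_Ioi]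
    refine setIntegral_eq_integral_of_forall_compl_eq_zero fun s hs => ?_
    rw [h3 s (by simpa using hs), zero_mul]
  rw [hset]
  let φ : ℝ → ℂ := fun u => g (w.re + u * I)
  let P : ℝ → ℂ := fun s => G s * Complex.exp (-(w.re : ℂ) * s)
  have hP : Integrable P := h5 (w.re : ℂ) (by simpa using hw)
  have hφc : Continuous φ := by
    refine hg.continuousOn.comp_continuous (by fun_prop) fun u => ?_
    simpa using hw
  have hF : ∀ v : ℝ, FourierTransform.fourier φ v = P ((-2 * π) * v) := by
    intro v
    rw [Real.fourier_real_eq_integral_exp_smul]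
    simp only [P, ← h1 w.re hw, ← integral_mul_const]
    congr 1
    ext u
    simp only [φ, smul_eq_mul]
    rw [mul_assoc (g _), ← Complex.exp_add, mul_comm]
    congr 2
    push_cast
    ring
  have hFi : Integrable (FourierTransform.fourier φ) := by
    have : FourierTransform.fourier φ = fun v => P ((-2 * π) * v) := funext hF
    rw [this]
    exact hP.comp_mul_left' (by simp [Real.pi_ne_zero])
  have hinv := congrFun (hφc.fourierInv_fourier_eq (hint w.re hw) hFi) w.im
  rw [Real.fourierInv_eq'] at hinv
  have hcv := Measure.integral_comp_mul_left (fun s : ℝ => G s * Complex.exp (-w * s)) (-2 * π)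
  have e : (∫ v : ℝ, Complex.exp ((↑(2 * π * inner ℝ v w.im) * Complex.I)) •
      FourierTransform.fourier φ v) =
      ∫ v : ℝ, G ((-2 * π) * v) * Complex.exp (-w * ((-2 * π) * v : ℝ)) := by
    congr 1
    ext v
    rw [hF]
    simp only [P, smul_eq_mul]
    rw [mul_left_comm, ← Complex.exp_add]
    congr 2
    have hw' := Complex.re_add_im w
    simp
    linear_combination (2 * π * v) * hw'
  rw [e, hcv] at hinv
  have hφw : φ w.im = g w := by simp only [φ, Complex.re_add_im]
  rw [hφw] at hinv
  rw [← hinv, abs_inv, abs_mul, abs_neg, abs_two, abs_of_pos Real.pi_pos, Complex.real_smul]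
  push_cast
  have : (π : ℂ) ≠ 0 := by simp [Real.pi_ne_zero]
  field_simp

/-- Theorem 2.6, part 2, of the paper. For `f` holomorphic on a
half-plane `H_α^A`, absolutely integrable on each line `C + i e^{−iα}ℝ ⊆ H_α^A` and
vanishing at infinity uniformly on closed sub-half-planes, the Borel transform `f̃` is
well defined (independently of the line), continuous, vanishes on the negative ray,
satisfies the weighted sup-norm bound, and `f` is the one-sided Laplace transform of
`f̃` in direction `α`. -/
theorem borel_inversion_halfplane
    (α : ℝ) (A : ℂ) (f : ℂ → ℂ)
    (hf : DifferentiableOn ℂ f (openHalfPlane α A))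
    (hint : ∀ C ∈ openHalfPlane α A, Integrable fun u : ℝ => f (linePt α C u))
    (hdecay : ∀ A₁ : ℂ,
      (Complex.exp (α * Complex.I) * A).re < (Complex.exp (α * Complex.I) * A₁).re →
      ∀ δ > 0, ∃ ρ : ℝ, ∀ t : ℂ,
        (Complex.exp (α * Complex.I) * A₁).re ≤ (Complex.exp (α * Complex.I) * t).re →
        ρ ≤ ‖t‖ → ‖f t‖ ≤ δ) :
    ∃ ft : ℝ → ℂ,
      -- absolute convergence and independence of the choice of line
      (∀ s : ℝ, ∀ C ∈ openHalfPlane α A,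
        Integrable (fun u : ℝ => f (linePt α C u) *
          Complex.exp (linePt α C u * (Complex.exp (α * Complex.I) * s))) ∧
        BorelLine α f C (Complex.exp (α * Complex.I) * s) = ft s) ∧
      -- continuity on the line e^{iα}ℝ
      Continuous ft ∧
      -- vanishing on the ray (−∞ e^{iα}, 0)
      (∀ s : ℝ, s < 0 → ft s = 0) ∧
      -- the weighted sup-norm bound on closed sub-half-planes
      (∀ A₁ : ℂ,
        (Complex.exp (α * Complex.I) * A).re < (Complex.exp (α * Complex.I) * A₁).re →
        ∀ M : ℝ,
        (∀ C : ℂ,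
          (Complex.exp (α * Complex.I) * A₁).re ≤ (Complex.exp (α * Complex.I) * C).re →
          (∫ u : ℝ, ‖f (linePt α C u)‖) ≤ M) →
        ∀ s : ℝ, 0 < s →
          ‖ft s‖ * Real.exp (-(A₁ * Complex.exp (α * Complex.I)).re * s) ≤
            (1 / (2 * Real.pi)) * M) ∧
      -- one-sided Laplace inversion
      (∀ t ∈ openHalfPlane α A,
        IntegrableOn (fun s : ℝ => ft s *
          Complex.exp (-t * (Complex.exp (α * Complex.I) * s))) (Set.Ioi 0) ∧
        Complex.exp (α * Complex.I) *
          (∫ s : ℝ in Set.Ioi 0, ft s *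
            Complex.exp (-t * (Complex.exp (α * Complex.I) * s))) = f t) := by
  set E : ℂ := Complex.exp (α * Complex.I) with hE
  set E' : ℂ := Complex.exp (-α * Complex.I) with hE'
  have hEE : E' * E = 1 := by
    rw [hE, hE', ← Complex.exp_add]; simp
  let g : ℂ → ℂ := fun w => f (E' * w)
  have hmem : ∀ C : ℂ, C ∈ openHalfPlane α A ↔ (E * A).re < (E * C).re := fun C => Iff.rfl
  have hEE2 : ∀ w : ℂ, E * (E' * w) = w := fun w => by linear_combination w * hEE
  have hEE3 : ∀ w : ℂ, E' * (E * w) = w := fun w => by linear_combination w * hEE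
  have hline : ∀ (C : ℂ) (u : ℝ),
      linePt α C u = E' * (((E * C).re : ℂ) + ((u + (E * C).im : ℝ) : ℂ) * I) := by
    intro C u
    have h := Complex.re_add_im (E * C)
    simp only [linePt, ← hE']
    push_cast
    linear_combination (-C) * hEE - E' * h
  have hlineE : ∀ (C : ℂ) (u s : ℝ), linePt α C u * (E * s) =
      (((E * C).re : ℂ) + ((u + (E * C).im : ℝ) : ℂ) * I) * s := by
    intro C u s
    rw [hline]
    linear_combination ((((E * C).re : ℂ) + ((u + (E * C).im : ℝ) : ℂ) * I) * s) * hEE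
  have hg : DifferentiableOn ℂ g {w | (E * A).re < w.re} := by
    refine hf.comp (by fun_prop) fun w hw => ?_
    rw [hmem, hEE2]
    exact hw
  have hgint : ∀ c : ℝ, (E * A).re < c → Integrable fun u : ℝ => g (c + u * I) := by
    intro c hc
    have h := hint (E' * c) (by rw [hmem, hEE2]; simpa using hc)
    refine h.congr (Filter.Eventually.of_forall fun u => ?_)
    simp only [hline, hEE2, g, ofReal_re, ofReal_im, add_zero]
  have hgdec : ∀ c : ℝ, (E * A).re < c → ∀ δ > 0, ∃ ρ : ℝ, ∀ w : ℂ, c ≤ w.re → ρ ≤ ‖w‖ →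
      ‖g w‖ ≤ δ := by
    intro c hc δ hδ
    obtain ⟨ρ, hρ⟩ := hdecay (E' * c) (by rw [hEE2]; simpa using hc) δ hδ
    refine ⟨ρ, fun w hw hw2 => hρ _ (by rw [hEE2, hEE2]; simpa using hw) ?_⟩
    have : ‖E'‖ = 1 := by rw [hE', Complex.norm_exp]; simp
    rwa [norm_mul, this, one_mul]
  obtain ⟨G, h1, h2, h3, h4, h5⟩ := aux_main g (E * A).re hg hgint hgdec
  have hE'n : ‖E'‖ = 1 := by rw [hE', Complex.norm_exp]; simp
  refine ⟨fun s => (1 / (2 * π)) * E' * G s, ?_, by fun_prop, ?_, ?_, ?_⟩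
  · intro s C hC
    rw [hmem] at hC
    have hfun : (fun u : ℝ => f (linePt α C u) * Complex.exp (linePt α C u * (E * s))) =
        fun u : ℝ => (fun v : ℝ => g ((E * C).re + v * I) *
          Complex.exp (((E * C).re + v * I) * s)) (u + (E * C).im) := by
      ext u
      simp only [hlineE]
      rw [hline]
    constructor
    · rw [hfun]
      exact (aux_integrable g _ s (hgint _ hC)).comp_add_right _
    · rw [BorelLine, hfun, integral_add_right_eq_self (fun v : ℝ => g ((E * C).re + v * I) *
          Complex.exp (((E * C).re + v * I) * s)), h1 _ hC, ← hE']
      have : (π : ℂ) ≠ 0 := by simp [Real.pi_ne_zero]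
      field_simp
  · intro s hs
    simp only [h3 s hs, mul_zero]
  · intro A₁ hA₁ M hM s hs
    have hb := h4 _ hA₁ s
    have hm := hM A₁ le_rfl
    have hshift : (∫ u : ℝ, ‖f (linePt α A₁ u)‖) = ∫ u : ℝ, ‖g ((E * A₁).re + u * I)‖ := by
      rw [← integral_add_right_eq_self (fun u : ℝ => ‖g ((E * A₁).re + u * I)‖) (E * A₁).im]
      congr 1
      ext u
      rw [hline]
    rw [hshift] at hm
    have hn : ‖(1 / (2 * π) : ℂ)‖ = 1 / (2 * π) := by
      rw [norm_div, norm_mul]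
      simp [abs_of_pos Real.pi_pos]
    rw [norm_mul, norm_mul, hn, hE'n, mul_one, mul_assoc, mul_comm A₁ E]
    gcongr
    calc ‖G s‖ * Real.exp (-(E * A₁).re * s)
        ≤ (Real.exp ((E * A₁).re * s) * M) * Real.exp (-(E * A₁).re * s) := by
          gcongr
          exact hb.trans (by gcongr)
      _ = M * (Real.exp ((E * A₁).re * s) * Real.exp (-(E * A₁).re * s)) := by ring
      _ = M := by rw [← Real.exp_add, neg_mul, add_neg_cancel, Real.exp_zero, mul_one]
  · intro t ht
    rw [hmem] at ht
    obtain ⟨hi, he⟩ := h5 (E * t) ht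
    have hfun : (fun s : ℝ => (1 / (2 * π)) * E' * G s * Complex.exp (-t * (E * s))) =
        fun s : ℝ => ((1 / (2 * π)) * E') * (G s * Complex.exp (-(E * t) * s)) := by
      ext s
      rw [mul_assoc, show -t * (E * s) = -(E * t) * s by ring]
    constructor
    · rw [hfun]
      exact hi.const_mul _
    · rw [hfun, integral_const_mul, he]
      simp only [g, hEE3]
      have : (π : ℂ) ≠ 0 := by simp [Real.pi_ne_zero]
      field_simp
      linear_combination f t * hEE
end

section
/- Let f₁ and f₂ both be holomorphic on the open strip T_α^{A,B}, absolutely integrable on each line C + ie^{−iα}ℝ ⊆ T_α^{A,B}, and tending to 0 as |t| → ∞ uniformly on every closed substrip of T_α^{A,B}; assume moreover that ‖B_α[f₁]‖_α^{A₁,B₁} < +∞ for all A₁, B₁ with T̄_α^{A₁,B₁} ⊆ T_α^{A,B}. Then the product f₁·f₂ satisfies the same hypotheses, for every ξ ∈ e^{iα}ℝ the convolution (B_α[f₁] * B_α[f₂])(ξ) converges absolutely, and B_α[f₁·f₂](ξ) = (B_α[f₁] * B_α[f₂])(ξ) for all ξ ∈ e^{iα}ℝ; i.e. the Borel transformation converts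 the product into the convolution. -/
open Complex MeasureTheory Real

/-- The open strip `T_α^{A,B}`. -/
def openStrip (α : ℝ) (A B : ℂ) : Set ℂ :=
  {t : ℂ | (Complex.exp (α * Complex.I) * A).re < (Complex.exp (α * Complex.I) * t).re ∧
    (Complex.exp (α * Complex.I) * t).re < (Complex.exp (α * Complex.I) * B).re}

/-- Uniform vanishing at infinity on every closed substrip of `T_α^{A,B}`. -/
def DecaysOnStrip (α : ℝ) (A B : ℂ) (f : ℂ → ℂ) : Prop :=
  ∀ A₁ B₁ : ℂ,
    (Complex.exp (α * Complex.I) * A).re < (Complex.exp (α * Complex.I) * A₁).re →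
    (Complex.exp (α * Complex.I) * A₁).re ≤ (Complex.exp (α * Complex.I) * B₁).re →
    (Complex.exp (α * Complex.I) * B₁).re < (Complex.exp (α * Complex.I) * B).re →
    ∀ δ > 0, ∃ ρ : ℝ, ∀ t : ℂ,
      (Complex.exp (α * Complex.I) * A₁).re ≤ (Complex.exp (α * Complex.I) * t).re →
      (Complex.exp (α * Complex.I) * t).re ≤ (Complex.exp (α * Complex.I) * B₁).re →
      ρ ≤ ‖t‖ → ‖f t‖ ≤ δ

open scoped FourierTransform Topology
open Filter

lemma fourier_cont' {h : ℝ → ℂ} (hh : Integrable h) : Continuous (𝓕 h) :=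
  VectorFourier.fourierIntegral_continuous Real.continuous_fourierChar
    (by exact continuous_inner) hh

lemma fourier_flip' {f g : ℝ → ℂ} (hf : Integrable f) (hg : Integrable g) :
    ∫ x, 𝓕 f x * g x = ∫ x, f x * 𝓕 g x := by
  simpa using! (VectorFourier.integral_fourierIntegral_smul_eq_flip (L := innerₗ ℝ)
    Real.continuous_fourierChar continuous_inner hf hg)

lemma fourier_mul' {g h : ℝ → ℂ} (hgc : Continuous g) (hg : Integrable g)
    (hFg : Integrable (𝓕 g)) (hh : Integrable h) (s : ℝ) :
    𝓕 (fun u => g u * h u) s = ∫ v, 𝓕 g v * 𝓕 h (s - v) := by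
  have h1 : 𝓕 (fun v => 𝓕 g (-v)) = g := by
    rw [← Real.fourierInv_eq_fourier_comp_neg]
    exact hgc.fourierInv_fourier_eq hg hFg
  set k : ℝ → ℂ := fun u => Complex.exp (((-2 * Real.pi * u * s : ℝ) : ℂ) * Complex.I) * h u with hk
  have hkint : Integrable k := by
    refine hh.bdd_mul (c := 1) (by fun_prop) (ae_of_all _ fun u => ?_)
    rw [Complex.norm_exp_ofReal_mul_I]
  have hG : Integrable (fun v => 𝓕 g (-v)) := hFg.comp_neg
  have h2 := fourier_flip' hG hkint
  rw [h1] at h2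
  rw [Real.fourier_real_eq_integral_exp_smul]
  have h3 : ∀ v, 𝓕 k v = 𝓕 h (s - -v) := by
    intro v
    rw [Real.fourier_real_eq_integral_exp_smul, Real.fourier_real_eq_integral_exp_smul]
    congr 1
    ext u
    simp only [hk, smul_eq_mul]
    rw [← mul_assoc, ← Complex.exp_add]
    congr 2
    push_cast
    ring
  calc _ = ∫ u, g u * k u := by
        congr 1
        ext u
        simp only [hk, smul_eq_mul]
        ring
    _ = ∫ v, 𝓕 g (-v) * 𝓕 k v := h2
    _ = ∫ v, 𝓕 g (-v) * 𝓕 h (s - -v) := by simp_rw [h3]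
    _ = _ := integral_neg_eq_self (fun v => 𝓕 g v * 𝓕 h (s - v)) volume

lemma exp_pos_neg (α : ℝ) : Complex.exp (α * Complex.I) * Complex.exp (-α * Complex.I) = 1 := by
  rw [← Complex.exp_add]; simp

lemma linePt_re (α : ℝ) (C : ℂ) (u : ℝ) :
    Complex.exp (α * Complex.I) * linePt α C u
      = Complex.exp (α * Complex.I) * C + Complex.I * u := by
  unfold linePt
  linear_combination (Complex.I * u) * exp_pos_neg α

lemma linePt_mem {α : ℝ} {A B C : ℂ} (hC : C ∈ openStrip α A B) (u : ℝ) :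
    linePt α C u ∈ openStrip α A B := by
  unfold openStrip at *
  simp only [Set.mem_ofPred_eq, linePt_re] at *
  simpa using hC

lemma borel_fourier (α : ℝ) (f : ℂ → ℂ) (C : ℂ) (s : ℝ) :
    BorelLine α f C (Complex.exp (α * Complex.I) * s) =
      Complex.exp (-α * Complex.I) / (2 * Real.pi) *
        Complex.exp (C * (Complex.exp (α * Complex.I) * s)) *
        𝓕 (fun u => f (linePt α C u)) (-(2 * Real.pi)⁻¹ * s) := by
  have hpi : (Real.pi : ℂ) ≠ 0 := by exact_mod_cast Real.pi_ne_zero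
  unfold BorelLine
  rw [Real.fourier_real_eq_integral_exp_smul, mul_assoc (Complex.exp (-α * Complex.I) / _), ← integral_const_mul (Complex.exp _)]
  have : ∀ u : ℝ, f (linePt α C u) * Complex.exp (linePt α C u * (Complex.exp (α * Complex.I) * s))
      = Complex.exp (C * (Complex.exp (α * Complex.I) * s)) *
        (Complex.exp (((-2 * Real.pi * u * (-(2 * Real.pi)⁻¹ * s) : ℝ) : ℂ) * Complex.I)
          • f (linePt α C u)) := by
    intro u
    have e : linePt α C u * (Complex.exp (α * Complex.I) * s) =
      C * (Complex.exp (α * Complex.I) * s) +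
        ((-2 * Real.pi * u * (-(2 * Real.pi)⁻¹ * s) : ℝ) : ℂ) * Complex.I := by
      have e1 : (-2 * Real.pi * u * (-(2 * Real.pi)⁻¹ * s) : ℝ) = u * s := by
        field_simp
      rw [e1]
      push_cast
      linear_combination (s : ℂ) * linePt_re α C u
    rw [e, Complex.exp_add, smul_eq_mul]
    ring
  simp_rw [this]
  congr 1
  field_simp

lemma linePt_continuous (α : ℝ) (C : ℂ) : Continuous (linePt α C) := by
  unfold linePt; fun_prop

lemma line_continuous {α : ℝ} {A B C : ℂ} {f : ℂ → ℂ} (hC : C ∈ openStrip α A B)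
    (hf : DifferentiableOn ℂ f (openStrip α A B)) : Continuous fun u => f (linePt α C u) :=
  hf.continuousOn.comp_continuous (linePt_continuous α C) (linePt_mem hC)

lemma norm_linePt_ge (α : ℝ) (C : ℂ) (u : ℝ) : |u| - ‖C‖ ≤ ‖linePt α C u‖ := by
  have h : ‖Complex.I * Complex.exp (-α * Complex.I) * u‖ = |u| := by
    rw [norm_mul, norm_mul, ← Complex.ofReal_neg, Complex.norm_exp_ofReal_mul_I]
    simp
  have := norm_sub_le (linePt α C u) C
  have e : linePt α C u - C = Complex.I * Complex.exp (-α * Complex.I) * u := by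
    unfold linePt; ring
  rw [e, h] at this
  linarith

lemma line_bounded {α : ℝ} {A B C : ℂ} {f : ℂ → ℂ} (hC : C ∈ openStrip α A B)
    (hf : DifferentiableOn ℂ f (openStrip α A B)) (hd : DecaysOnStrip α A B f) :
    ∃ M, ∀ u, ‖f (linePt α C u)‖ ≤ M := by
  obtain ⟨ρ, hρ⟩ := hd C C hC.1 le_rfl hC.2 1 one_pos
  obtain ⟨M, hM⟩ := (isCompact_Icc (a := -(ρ + ‖C‖)) (b := ρ + ‖C‖)).exists_bound_of_continuousOn
    (line_continuous hC hf).continuousOn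
  refine ⟨max M 1, fun u => ?_⟩
  by_cases hu : |u| ≤ ρ + ‖C‖
  · exact (hM u (abs_le.mp hu)).trans (le_max_left _ _)
  · refine (hρ _ ?_ ?_ ?_).trans (le_max_right _ _)
    · rw [linePt_re]; simp
    · rw [linePt_re]; simp
    · have := norm_linePt_ge α C u
      linarith

/-- Shifting the line of integration. -/
lemma shift_vertical {G : ℂ → ℂ} {c d : ℝ}
    (hG : DifferentiableOn ℂ G (Complex.re ⁻¹' (Set.uIcc c d)))
    (hc : Integrable fun y : ℝ => G (c + y * Complex.I))
    (hd : Integrable fun y : ℝ => G (d + y * Complex.I))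
    (hdec : ∀ δ > 0, ∃ ρ : ℝ, ∀ x ∈ Set.uIcc c d, ∀ y : ℝ, ρ ≤ |y| → ‖G (x + y * Complex.I)‖ ≤ δ) :
    ∫ y : ℝ, G (c + y * Complex.I) = ∫ y : ℝ, G (d + y * Complex.I) := by
  have hrect : ∀ R : ℝ, (∫ y : ℝ in (-R)..R, G (d + y * Complex.I)) -
      (∫ y : ℝ in (-R)..R, G (c + y * Complex.I)) =
      Complex.I * ((∫ x : ℝ in c..d, G (x + (-R : ℝ) * Complex.I)) -
        ∫ x : ℝ in c..d, G (x + R * Complex.I)) := by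
    intro R
    have := Complex.integral_boundary_rect_eq_zero_of_differentiableOn G ⟨c, -R⟩ ⟨d, R⟩
      (hG.mono (by
        intro z hz
        exact hz.1))
    simp only [smul_eq_mul] at this
    linear_combination (-Complex.I) * this + ((∫ y : ℝ in (-R)..R, G (d + y * Complex.I)) -
      (∫ y : ℝ in (-R)..R, G (c + y * Complex.I))) * Complex.I_sq
  have hz : ∀ σ : ℝ, |σ| = 1 →
      Tendsto (fun R : ℝ => ∫ x : ℝ in c..d, G (x + (σ * R : ℝ) * Complex.I)) atTop (𝓝 0) := by
    intro σ hσ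
    rw [Metric.tendsto_atTop]
    intro ε hε
    obtain ⟨ρ, hρ⟩ := hdec (ε / (2 * (|d - c| + 1))) (by positivity)
    refine ⟨ρ, fun R hR => ?_⟩
    rw [dist_zero_right]
    have := intervalIntegral.norm_integral_le_of_norm_le_const (a := c) (b := d)
      (f := fun x : ℝ => G (x + (σ * R : ℝ) * Complex.I)) (C := ε / (2 * (|d - c| + 1)))
      (fun x hx => hρ x (Set.uIoc_subset_uIcc hx) _ (by
        rw [abs_mul, hσ, one_mul]; exact hR.trans (le_abs_self R)))
    refine this.trans_lt ?_
    rw [div_mul_eq_mul_div, div_lt_iff₀ (by positivity)]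
    nlinarith [abs_nonneg (d - c)]
  have t1 := intervalIntegral_tendsto_integral hd tendsto_neg_atTop_atBot tendsto_id
  have t2 := intervalIntegral_tendsto_integral hc tendsto_neg_atTop_atBot tendsto_id
  have t3 := ((hz (-1) (by simp)).sub (hz 1 (by simp))).const_mul Complex.I
  have t4 := t1.sub t2
  simp only [id] at t4
  simp_rw [hrect] at t4
  simp only [neg_mul, one_mul, sub_zero, mul_zero] at t3
  exact (sub_eq_zero.mp (tendsto_nhds_unique t4 t3)).symm

lemma borel_indep {α : ℝ} {A B C D : ℂ} {f : ℂ → ℂ}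
    (hC : C ∈ openStrip α A B) (hD : D ∈ openStrip α A B)
    (hf : DifferentiableOn ℂ f (openStrip α A B))
    (hint : ∀ C ∈ openStrip α A B, Integrable fun u : ℝ => f (linePt α C u))
    (hd : DecaysOnStrip α A B f) (s : ℝ) :
    BorelLine α f C (Complex.exp (α * Complex.I) * s) =
      BorelLine α f D (Complex.exp (α * Complex.I) * s) := by
  set G : ℂ → ℂ := fun w => f (Complex.exp (-α * Complex.I) * w) * Complex.exp (w * s) with hGdef
  have hee : ∀ w, Complex.exp (α * Complex.I) * (Complex.exp (-α * Complex.I) * w) = w := by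
    intro w
    rw [← mul_assoc, exp_pos_neg, one_mul]
  have hline : ∀ (E : ℂ) (u : ℝ), linePt α E u = Complex.exp (-α * Complex.I) *
      (((Complex.exp (α * Complex.I) * E).re : ℂ) +
        ((u + (Complex.exp (α * Complex.I) * E).im : ℝ) : ℂ) * Complex.I) := by
    intro E u
    have h := Complex.re_add_im (Complex.exp (α * Complex.I) * E)
    have h2 : ((Complex.exp (α * Complex.I) * E).re : ℂ) +
        ((u + (Complex.exp (α * Complex.I) * E).im : ℝ) : ℂ) * Complex.I
        = Complex.exp (α * Complex.I) * linePt α E u := by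
      rw [linePt_re]
      push_cast
      linear_combination h
    rw [h2, ← mul_assoc, mul_comm (Complex.exp (-α * Complex.I)), exp_pos_neg, one_mul]
  have hGline : ∀ (E : ℂ) (u : ℝ),
      f (linePt α E u) * Complex.exp (linePt α E u * (Complex.exp (α * Complex.I) * s)) =
      G ((Complex.exp (α * Complex.I) * E).re +
        ((u + (Complex.exp (α * Complex.I) * E).im : ℝ) : ℂ) * Complex.I) := by
    intro E u
    simp only [hGdef]
    rw [← hline]
    congr 2
    rw [hline]
    linear_combination (s : ℂ) * hee (((Complex.exp (α * Complex.I) * E).re : ℂ) +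
        ((u + (Complex.exp (α * Complex.I) * E).im : ℝ) : ℂ) * Complex.I)
  have hInt : ∀ E : ℂ,
      ∫ u : ℝ, f (linePt α E u) * Complex.exp (linePt α E u * (Complex.exp (α * Complex.I) * s)) =
      ∫ u : ℝ, G ((Complex.exp (α * Complex.I) * E).re + u * Complex.I) := by
    intro E
    simp_rw [hGline]
    exact integral_add_right_eq_self
      (fun u : ℝ => G ((Complex.exp (α * Complex.I) * E).re + u * Complex.I)) _
  have hGint : ∀ E ∈ openStrip α A B,
      Integrable fun u : ℝ => G ((Complex.exp (α * Complex.I) * E).re + u * Complex.I) := by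
    intro E hE
    have h1 := (hint E hE).comp_sub_right ((Complex.exp (α * Complex.I) * E).im)
    simp only [hGdef]
    refine Integrable.mul_bdd (c := Real.exp ((Complex.exp (α * Complex.I) * E).re * s)) ?_
      (by fun_prop) (ae_of_all _ fun u => ?_)
    · refine h1.congr (ae_of_all _ fun u => ?_)
      simp only [hline, sub_add_cancel]
    · rw [Complex.norm_exp]
      generalize (Complex.exp (α * Complex.I) * E).re = x
      simp
  unfold BorelLine
  rw [hInt, hInt]
  congr 1
  have hmem : ∀ x ∈ Set.uIcc (Complex.exp (α * Complex.I) * C).re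
      (Complex.exp (α * Complex.I) * D).re,
      (Complex.exp (α * Complex.I) * A).re < x ∧ x < (Complex.exp (α * Complex.I) * B).re := by
    intro x hx
    rw [Set.mem_uIcc] at hx
    have h1 := hC.1
    have h2 := hC.2
    have h3 := hD.1
    have h4 := hD.2
    rcases hx with hx | hx <;> constructor <;> linarith [hx.1, hx.2]
  refine shift_vertical ?_ (hGint C hC) (hGint D hD) ?_
  · simp only [hGdef]
    refine DifferentiableOn.mul (hf.comp (by fun_prop) ?_) (by fun_prop)
    intro w hw
    have := hmem _ hw
    simpa only [openStrip, Set.mem_ofPred_eq, hee] using this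
  · intro δ hδ
    have key : ∀ P Q : ℂ, P ∈ openStrip α A B → Q ∈ openStrip α A B →
        (Complex.exp (α * Complex.I) * P).re ≤ (Complex.exp (α * Complex.I) * Q).re →
        ∃ ρ : ℝ, ∀ x ∈ Set.Icc (Complex.exp (α * Complex.I) * P).re
          (Complex.exp (α * Complex.I) * Q).re, ∀ y : ℝ, ρ ≤ |y| →
          ‖G (x + y * Complex.I)‖ ≤ δ := by
      intro P Q hP hQ hPQ
      set M : ℝ := Real.exp ((|(Complex.exp (α * Complex.I) * P).re| +
        |(Complex.exp (α * Complex.I) * Q).re|) * |s|) with hM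
      have hMpos : 0 < M := Real.exp_pos _
      obtain ⟨ρ, hρ⟩ := hd P Q hP.1 hPQ hQ.2 (δ / M) (by positivity)
      refine ⟨ρ, fun x hx y hy => ?_⟩
      simp only [hGdef]
      rw [norm_mul]
      have b1 : ‖f (Complex.exp (-α * Complex.I) * (x + y * Complex.I))‖ ≤ δ / M := by
        refine hρ _ ?_ ?_ ?_
        · rw [hee]; simpa using hx.1
        · rw [hee]; simpa using hx.2
        · rw [norm_mul, ← Complex.ofReal_neg, Complex.norm_exp_ofReal_mul_I, one_mul]
          refine hy.trans ?_
          simpa using Complex.abs_im_le_norm (x + y * Complex.I)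
      have b2 : ‖Complex.exp ((x + y * Complex.I) * s)‖ ≤ M := by
        rw [Complex.norm_exp, hM]
        apply Real.exp_le_exp.mpr
        have : ((x + y * Complex.I) * s : ℂ).re = x * s := by simp
        rw [this]
        calc x * s ≤ |x * s| := le_abs_self _
          _ = |x| * |s| := abs_mul _ _
          _ ≤ _ := by
            gcongr
            rw [abs_le]
            constructor
            · linarith [hx.1, neg_abs_le (Complex.exp (α * Complex.I) * P).re,
                abs_nonneg (Complex.exp (α * Complex.I) * Q).re]
            · linarith [hx.2, le_abs_self (Complex.exp (α * Complex.I) * Q).re,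
                abs_nonneg (Complex.exp (α * Complex.I) * P).re]
      calc _ ≤ δ / M * M := by gcongr
        _ = δ := by field_simp
    rcases le_total (Complex.exp (α * Complex.I) * C).re (Complex.exp (α * Complex.I) * D).re
      with h | h
    · rw [Set.uIcc_of_le h]; exact key C D hC hD h
    · rw [Set.uIcc_of_ge h]; exact key D C hD hC h

/-- The Borel transformation converts products into convolutions:
if `f₁, f₂` are holomorphic on `T_α^{A,B}`, integrable on each vertical line of the
strip and vanish at infinity uniformly on closed substrips, and the Borel transform of
`f₁` has finite `‖·‖_α^{A₁,B₁}`-norm for every closed substrip, then `f₁·f₂` satisfies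
the same hypotheses, the convolution of the Borel transforms converges absolutely, and
`B_α[f₁·f₂] = B_α[f₁] * B_α[f₂]`. -/
theorem borel_mul_eq_convolution
    (α : ℝ) (A B : ℂ)
    (hAB : (Complex.exp (α * Complex.I) * A).re < (Complex.exp (α * Complex.I) * B).re)
    (f₁ f₂ : ℂ → ℂ) (C₀ : ℂ) (hC₀ : C₀ ∈ openStrip α A B)
    (hf₁ : DifferentiableOn ℂ f₁ (openStrip α A B))
    (hf₂ : DifferentiableOn ℂ f₂ (openStrip α A B))
    (hint₁ : ∀ C ∈ openStrip α A B, Integrable fun u : ℝ => f₁ (linePt α C u))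
    (hint₂ : ∀ C ∈ openStrip α A B, Integrable fun u : ℝ => f₂ (linePt α C u))
    (hdecay₁ : DecaysOnStrip α A B f₁)
    (hdecay₂ : DecaysOnStrip α A B f₂)
    -- ‖B_α[f₁]‖_α^{A₁,B₁} < ∞ for every closed substrip T̄_α^{A₁,B₁} ⊆ T_α^{A,B}
    (hnorm₁ : ∀ A₁ B₁ : ℂ,
      (Complex.exp (α * Complex.I) * A).re < (Complex.exp (α * Complex.I) * A₁).re →
      (Complex.exp (α * Complex.I) * A₁).re ≤ (Complex.exp (α * Complex.I) * B₁).re →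
      (Complex.exp (α * Complex.I) * B₁).re < (Complex.exp (α * Complex.I) * B).re →
      Integrable fun s : ℝ =>
        ‖BorelLine α f₁ C₀ (Complex.exp (α * Complex.I) * s)‖ *
          (‖Complex.exp (-A₁ * (Complex.exp (α * Complex.I) * s))‖ +
            ‖Complex.exp (-B₁ * (Complex.exp (α * Complex.I) * s))‖)) :
    -- the product satisfies the same hypotheses
    DifferentiableOn ℂ (fun t => f₁ t * f₂ t) (openStrip α A B) ∧
    (∀ C ∈ openStrip α A B, Integrable fun u : ℝ => f₁ (linePt α C u) * f₂ (linePt α C u)) ∧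
    DecaysOnStrip α A B (fun t => f₁ t * f₂ t) ∧
    -- the convolution converges absolutely and equals the Borel transform of the product
    (∀ s : ℝ,
      Integrable (fun u : ℝ =>
        BorelLine α f₁ C₀ (Complex.exp (α * Complex.I) * u) *
          BorelLine α f₂ C₀ (Complex.exp (α * Complex.I) * (s - u)))) ∧
    (∀ C ∈ openStrip α A B, ∀ s : ℝ,
      BorelLine α (fun t => f₁ t * f₂ t) C (Complex.exp (α * Complex.I) * s) =
        Complex.exp (α * Complex.I) *
          ∫ u : ℝ, BorelLine α f₁ C₀ (Complex.exp (α * Complex.I) * u) *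
            BorelLine α f₂ C₀ (Complex.exp (α * Complex.I) * (s - u))) := by
  have hprod : DifferentiableOn ℂ (fun t => f₁ t * f₂ t) (openStrip α A B) := hf₁.mul hf₂
  have hpint : ∀ C ∈ openStrip α A B,
      Integrable fun u : ℝ => f₁ (linePt α C u) * f₂ (linePt α C u) := by
    intro C hC
    obtain ⟨M, hM⟩ := line_bounded hC hf₂ hdecay₂
    exact (hint₁ C hC).mul_bdd (c := M) (line_continuous hC hf₂).aestronglyMeasurable
      (ae_of_all _ hM)
  have hpdec : DecaysOnStrip α A B (fun t => f₁ t * f₂ t) := by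
    intro A₁ B₁ h1 h2 h3 δ hδ
    obtain ⟨ρ₁, hρ₁⟩ := hdecay₁ A₁ B₁ h1 h2 h3 δ hδ
    obtain ⟨ρ₂, hρ₂⟩ := hdecay₂ A₁ B₁ h1 h2 h3 1 one_pos
    refine ⟨max ρ₁ ρ₂, fun t ht1 ht2 ht => ?_⟩
    have b1 := hρ₁ t ht1 ht2 ((le_max_left _ _).trans ht)
    have b2 := hρ₂ t ht1 ht2 ((le_max_right _ _).trans ht)
    rw [norm_mul]
    calc _ ≤ δ * 1 := by gcongr
      _ = δ := mul_one _
  have hpi : (2 * Real.pi : ℝ) ≠ 0 := by positivity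
  have hr : (-(2 * Real.pi)⁻¹ : ℝ) ≠ 0 := by
    rw [neg_ne_zero]; exact inv_ne_zero hpi
  have hpic : (Real.pi : ℂ) ≠ 0 := by exact_mod_cast Real.pi_ne_zero
  set g : ℝ → ℂ := fun u => f₁ (linePt α C₀ u) with hg
  set h : ℝ → ℂ := fun u => f₂ (linePt α C₀ u) with hh
  have hgi : Integrable g := hint₁ C₀ hC₀
  have hhi : Integrable h := hint₂ C₀ hC₀
  have hFgi : Integrable (𝓕 g) := by
    rw [← integrable_comp_mul_left_iff _ hr]
    have h0 := hnorm₁ C₀ C₀ hC₀.1 le_rfl hC₀.2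
    have hn : Integrable fun s : ℝ => ‖𝓕 g (-(2 * Real.pi)⁻¹ * s)‖ := by
      refine (h0.const_mul Real.pi).congr (ae_of_all _ fun s => ?_)
      simp only [borel_fourier]
      rw [norm_mul, norm_mul, norm_div, ← Complex.ofReal_neg, Complex.norm_exp_ofReal_mul_I,
        neg_mul C₀, Complex.exp_neg, norm_inv]
      have e : ‖(2 * Real.pi : ℂ)‖ = 2 * Real.pi := by
        simp [abs_of_pos Real.pi_pos]
      rw [e]
      have : ‖Complex.exp (C₀ * (Complex.exp (α * Complex.I) * s))‖ ≠ 0 := by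
        simp [Complex.exp_ne_zero]
      field_simp
      ring
    exact (integrable_norm_iff
      ((fourier_cont' hgi).comp (continuous_const_mul _)).aestronglyMeasurable).mp hn
  have hconvF : ∀ x : ℝ, Integrable fun v => 𝓕 g v * 𝓕 h (x - v) := by
    intro x
    refine hFgi.mul_bdd (c := ∫ u, ‖h u‖)
      ((fourier_cont' hhi).comp (by fun_prop)).aestronglyMeasurable (ae_of_all _ fun v => ?_)
    exact VectorFourier.norm_fourierIntegral_le_integral_norm _ _ _ _ _
  have hrew : ∀ s u : ℝ, BorelLine α f₁ C₀ (Complex.exp (α * Complex.I) * u) *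
          BorelLine α f₂ C₀ (Complex.exp (α * Complex.I) * (s - u)) =
        ((Complex.exp (-α * Complex.I) / (2 * Real.pi)) ^ 2 *
          Complex.exp (C₀ * (Complex.exp (α * Complex.I) * s))) *
        (fun v => 𝓕 g v * 𝓕 h (-(2 * Real.pi)⁻¹ * s - v)) (-(2 * Real.pi)⁻¹ * u) := by
    intro s u
    rw [← Complex.ofReal_sub, borel_fourier, borel_fourier]
    have e1 : Complex.exp (C₀ * (Complex.exp (α * Complex.I) * s)) =
        Complex.exp (C₀ * (Complex.exp (α * Complex.I) * u)) *
          Complex.exp (C₀ * (Complex.exp (α * Complex.I) * (s - u : ℝ))) := by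
      rw [← Complex.exp_add]
      congr 1
      push_cast
      ring
    have e2 : -(2 * Real.pi)⁻¹ * s - -(2 * Real.pi)⁻¹ * u = -(2 * Real.pi)⁻¹ * (s - u) := by ring
    simp only [e1, e2]
    ring
  refine ⟨hprod, hpint, hpdec, fun s => ?_, fun C hC s => ?_⟩
  · simp_rw [hrew s]
    exact ((integrable_comp_mul_left_iff _ hr).mpr (hconvF _)).const_mul _
  · rw [borel_indep hC hC₀ hprod hpint hpdec s, borel_fourier]
    simp_rw [hrew s]
    rw [integral_const_mul, Measure.integral_comp_mul_left
        (fun v => 𝓕 g v * 𝓕 h (-(2 * Real.pi)⁻¹ * s - v)) (-(2 * Real.pi)⁻¹),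
      fourier_mul' (line_continuous hC₀ hf₁) hgi hFgi hhi]
    have e3 : |(-(2 * Real.pi)⁻¹ : ℝ)⁻¹| = 2 * Real.pi := by
      rw [inv_neg, inv_inv, abs_neg, abs_of_pos (by positivity)]
    rw [e3, Complex.real_smul]
    push_cast
    have e4 := exp_pos_neg α
    generalize (∫ v, 𝓕 g v * 𝓕 h (-(2 * Real.pi)⁻¹ * s - v)) = E
    generalize Complex.exp (C₀ * (Complex.exp (α * Complex.I) * s)) = K
    generalize Complex.exp (-α * Complex.I) = a at *
    generalize Complex.exp (α * Complex.I) = b at *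
    have e5 : (2 * Real.pi : ℂ) * (2 * Real.pi : ℂ)⁻¹ = 1 :=
      mul_inv_cancel₀ (mul_ne_zero two_ne_zero hpic)
    rw [div_eq_mul_inv]
    generalize (2 * Real.pi : ℂ)⁻¹ = q at *
    linear_combination (-(a * q * K * E)) * e4 - b * a ^ 2 * q * K * E * e5
end

section
/- Let α ∈ ℝ and A, B ∈ ℂ with Re(e^{iα}A) < Re(e^{iα}B). For j = 1, 2 let J_j ⊂ ℝ be a nonempty open interval, Ω_j := {ξ ∈ ℂ : Im(e^{−iα}ξ) ∈ J_j} an open strip of direction α, and φ_j holomorphic on Ω_j with ‖φ_j‖_{Ω_j}^{A,B} < ∞. Then for every ξ with Im(e^{−iα}ξ) ∈ J₁+J₂ and every c₁ ∈ Ω₁ with ξ−c₁ ∈ Ω₂, the integral (φ₁*φ₂)(ξ) := e^{iα} ∫_ℝ φ₁(c₁ + e^{iα}u)·φ₂(ξ − c₁ − e^{iα}u) du converges absolutely and is independent of the choice of such c₁; the resulting function φ₁*φ₂ is holomorphic on the strip Ω₁+Ω₂ = {ξ : Im(e^{−iα}ξ) ∈ J₁+J₂}; and it satisfies ‖φ₁*φ₂‖_{Ω₁+Ω₂}^{A,B}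 ≤ ‖φ₁‖_{Ω₁}^{A,B}·‖φ₂‖_{Ω₂}^{A,B} and |φ₁*φ₂|_{Ω₁+Ω₂}^{A,B} ≤ min( |φ₁|_{Ω₁}^{A,B}·‖φ₂‖_{Ω₂}^{A,B}, ‖φ₁‖_{Ω₁}^{A,B}·|φ₂|_{Ω₂}^{A,B} ). -/
open Complex MeasureTheory Pointwise

/-- The weight `|e^{−Az}| + |e^{−Bz}|` at a point `z` of the Borel plane. -/
noncomputable def BLwt (A B z : ℂ) : ℝ :=
  ‖Complex.exp (-A * z)‖ + ‖Complex.exp (-B * z)‖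

/-- The open strip of direction `α` over a set `J` of imaginary parts:
`{ξ : Im(e^{−iα}ξ) ∈ J}`. -/
noncomputable def stripOver (α : ℝ) (J : Set ℝ) : Set ℂ :=
  {ξ : ℂ | (Complex.exp (-α * Complex.I) * ξ).im ∈ J}

open Filter Topology Metric Set in
theorem strip0_isOpen {J : Set ℝ} (hJ : IsOpen J) : IsOpen {z : ℂ | z.im ∈ J} :=
  hJ.preimage Complex.continuous_im

theorem strip0_line_continuous {J : Set ℝ} {f : ℂ → ℂ}
    (hf : ContinuousOn f {z : ℂ | z.im ∈ J}) {c : ℂ} (hc : c.im ∈ J) :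
    Continuous (fun u : ℝ => f (c + u)) := by
  refine hf.comp_continuous (by fun_prop) ?_
  intro u
  simpa using hc

theorem strip0_line_continuous' {J : Set ℝ} {f : ℂ → ℂ}
    (hf : ContinuousOn f {z : ℂ | z.im ∈ J}) {c : ℂ} (hc : c.im ∈ J) :
    Continuous (fun u : ℝ => f (c - u)) := by
  refine hf.comp_continuous (by fun_prop) ?_
  intro u
  simpa using hc

theorem strip0_ball {J : Set ℝ} (hJ : IsOpen J) {y : ℝ} (hy : y ∈ J) :
    ∃ r > 0, ∀ y', |y' - y| ≤ r → y' ∈ J := by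
  obtain ⟨r, hr, h⟩ := Metric.isOpen_iff.1 hJ y hy
  refine ⟨r / 2, by positivity, fun y' h' => h ?_⟩
  rw [Metric.mem_ball, Real.dist_eq]
  linarith

open Filter Topology Metric Set in
theorem strip0_primitive {J : Set ℝ} (hJ : IsOpen J) {f : ℂ → ℂ}
    (hf : DifferentiableOn ℂ f {z : ℂ | z.im ∈ J}) {z : ℂ} (hz : z.im ∈ J) (t : ℝ) :
    HasDerivAt (fun c : ℂ => ∫ s in (0 : ℝ)..t, f (c + s)) (f (z + t) - f z) z := by
  have hO := strip0_isOpen hJ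
  have hd : DifferentiableOn ℂ (deriv f) {z : ℂ | z.im ∈ J} := hf.deriv hO
  obtain ⟨r, hr, hrJ⟩ := strip0_ball hJ hz
  have hbJ : ∀ c ∈ closedBall z r, c.im ∈ J := by
    intro c hc
    apply hrJ
    rw [mem_closedBall, dist_eq_norm] at hc
    rw [← Complex.sub_im]
    exact (Complex.abs_im_le_norm _).trans hc
  have hK : IsCompact ((fun p : ℂ × ℝ => p.1 + (p.2 : ℂ)) '' (closedBall z r ×ˢ uIcc 0 t)) :=
    ((isCompact_closedBall z r).prod isCompact_uIcc).image (by fun_prop)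
  have hKs : ((fun p : ℂ × ℝ => p.1 + (p.2 : ℂ)) '' (closedBall z r ×ˢ uIcc 0 t))
      ⊆ {z : ℂ | z.im ∈ J} := by
    rintro _ ⟨p, hp, rfl⟩
    simpa using hbJ _ hp.1
  obtain ⟨C, hC⟩ := hK.exists_bound_of_continuousOn (hd.continuousOn.mono hKs)
  have hder : ∀ c : ℂ, c.im ∈ J → ∀ s : ℝ,
      HasDerivAt (fun x : ℂ => f (x + s)) (deriv f (c + s)) c := by
    intro c hc s
    have h1 : DifferentiableAt ℂ f (c + s) :=
      (hf (c + s) (by simpa using hc)).differentiableAt (hO.mem_nhds (by simpa using hc))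
    exact h1.hasDerivAt.comp_add_const c (s : ℂ)
  have hder' : ∀ s : ℝ, HasDerivAt (fun x : ℝ => f (z + x)) (deriv f (z + s)) s := by
    intro s
    have h1 : DifferentiableAt ℂ f (z + s) :=
      (hf (z + s) (by simpa using hz)).differentiableAt (hO.mem_nhds (by simpa using hz))
    have h2 : HasDerivAt (fun x : ℂ => f (z + x)) (deriv f (z + s)) (s : ℂ) :=
      h1.hasDerivAt.comp_const_add z (s : ℂ)
    exact h2.comp_ofReal
  have key := (intervalIntegral.hasDerivAt_integral_of_dominated_loc_of_deriv_le
    (μ := volume) (a := 0) (b := t)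
    (F := fun (c : ℂ) (s : ℝ) => f (c + s)) (F' := fun (c : ℂ) (s : ℝ) => deriv f (c + s))
    (x₀ := z) (s := closedBall z r) (bound := fun _ => C) (closedBall_mem_nhds z hr)
    ?_ ?_ ?_ ?_ ?_ ?_).2
  · have e : (∫ s in (0 : ℝ)..t, deriv f (z + s)) = f (z + t) - f z := by
      have := intervalIntegral.integral_eq_sub_of_hasDerivAt (a := 0) (b := t)
        (fun s _ => hder' s)
        ((strip0_line_continuous hd.continuousOn hz).intervalIntegrable _ _)
      simpa using this
    rw [← e]
    exact key
  · filter_upwards [closedBall_mem_nhds z hr] with c hc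
    exact (strip0_line_continuous hf.continuousOn (hbJ c hc)).aestronglyMeasurable
  · exact (strip0_line_continuous hf.continuousOn hz).intervalIntegrable _ _
  · exact (strip0_line_continuous hd.continuousOn hz).aestronglyMeasurable
  · refine Eventually.of_forall fun s hs c hc => hC _ ⟨(c, s), ⟨hc, uIoc_subset_uIcc hs⟩, rfl⟩
  · exact intervalIntegrable_const
  · exact Eventually.of_forall fun s hs c hc => hder c (hbJ c hc) s

open Filter Topology Metric Set in
theorem strip0_bounded {J : Set ℝ} (hJ : IsOpen J) {f : ℂ → ℂ}
    (hf : DifferentiableOn ℂ f {z : ℂ | z.im ∈ J}) {N : ℝ}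
    (hN : ∀ c : ℂ, c.im ∈ J → Integrable (fun u : ℝ => ‖f (c + u)‖) ∧
      (∫ u : ℝ, ‖f (c + u)‖) ≤ N) {y : ℝ} (hy : y ∈ J) :
    ∃ r > 0, ∃ C : ℝ, ∀ z : ℂ, |z.im - y| ≤ r → z.im ∈ J ∧ ‖f z‖ ≤ C := by
  obtain ⟨r, hr, hrJ⟩ := strip0_ball hJ hy
  have hO := strip0_isOpen hJ
  refine ⟨r / 2, by positivity, 1 + N / (r / 2), fun z hz => ⟨hrJ _ (by linarith), ?_⟩⟩
  have hzJ : z.im ∈ J := hrJ _ (by linarith)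
  have hbJ : ∀ c ∈ closedBall z (r / 2), c.im ∈ J := by
    intro c hc
    apply hrJ
    rw [mem_closedBall, dist_eq_norm] at hc
    have h1 := (Complex.abs_im_le_norm _).trans hc
    rw [Complex.sub_im] at h1
    have := abs_sub_le c.im z.im y
    linarith
  obtain ⟨t, ht⟩ : ∃ t : ℝ, ‖f (z + t)‖ ≤ 1 := by
    by_contra! hcon
    have h1 : Integrable (fun _ : ℝ => (1 : ℝ)) := by
      refine (hN z hzJ).1.mono' aestronglyMeasurable_const (Eventually.of_forall fun u => ?_)
      simpa using (hcon u).le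
    rw [integrable_const_iff] at h1
    rcases h1 with h1 | h1
    · norm_num at h1
    · exact absurd h1.measure_univ_lt_top (by simp)
  have hF := fun c (hc : c ∈ closedBall z (r / 2)) => strip0_primitive hJ hf (hbJ c hc) t
  have hFb : ∀ c ∈ closedBall z (r / 2), ‖∫ s in (0 : ℝ)..t, f (c + s)‖ ≤ N := by
    intro c hc
    refine le_trans ?_ (hN c (hbJ c hc)).2
    refine intervalIntegral.norm_integral_le_integral_norm_uIoc.trans ?_
    exact setIntegral_le_integral (hN c (hbJ c hc)).1
      (Eventually.of_forall fun _ => norm_nonneg _)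
  have hcau := Complex.norm_deriv_le_of_forall_mem_sphere_norm_le (c := z) (R := r / 2) (C := N)
    (f := fun c : ℂ => ∫ s in (0 : ℝ)..t, f (c + s)) (by positivity) ?_
    (fun c hc => hFb c (sphere_subset_closedBall hc))
  · rw [(hF z (mem_closedBall_self (by positivity))).deriv] at hcau
    have : f z = f (z + t) - (f (z + t) - f z) := by ring
    rw [this]
    exact (norm_sub_le _ _).trans (add_le_add ht hcau)
  · apply DifferentiableOn.diffContOnCl
    rw [closure_ball z (by positivity)]
    exact fun c hc => (hF c hc).differentiableAt.differentiableWithinAt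

/-- Convolution of an integrable function with a holomorphic function that is bounded
on substrips. -/
def StripLocBdd (J : Set ℝ) (f : ℂ → ℂ) : Prop :=
  ∀ y ∈ J, ∃ r > 0, ∃ C : ℝ, ∀ z : ℂ, |z.im - y| ≤ r → z.im ∈ J ∧ ‖f z‖ ≤ C

open Filter Topology Metric Set in
theorem strip0_integrable {J : Set ℝ} {f : ℂ → ℂ}
    (hf : DifferentiableOn ℂ f {z : ℂ | z.im ∈ J}) (hb : StripLocBdd J f)
    {ψ : ℝ → ℂ} (hψ : Integrable ψ) {c : ℂ} (hc : c.im ∈ J) :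
    Integrable (fun u : ℝ => ψ u * f (c - u)) := by
  obtain ⟨r, hr, C, hC⟩ := hb _ hc
  refine hψ.mul_bdd (c := C) (strip0_line_continuous' hf.continuousOn hc).aestronglyMeasurable ?_
  exact Eventually.of_forall fun u => (hC _ (by simpa using hr.le)).2

open Filter Topology Metric Set in
theorem strip0_diff {J : Set ℝ} (hJ : IsOpen J) {f : ℂ → ℂ}
    (hf : DifferentiableOn ℂ f {z : ℂ | z.im ∈ J}) (hb : StripLocBdd J f)
    {ψ : ℝ → ℂ} (hψ : Integrable ψ) :
    DifferentiableOn ℂ (fun c : ℂ => ∫ u : ℝ, ψ u * f (c - u)) {z : ℂ | z.im ∈ J} := by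
  intro z hz
  have hO := strip0_isOpen hJ
  have hd : DifferentiableOn ℂ (deriv f) {z : ℂ | z.im ∈ J} := hf.deriv hO
  obtain ⟨r, hr, C, hC⟩ := hb _ hz
  have hbound : ∀ c : ℂ, |c.im - z.im| ≤ r / 2 → ‖deriv f c‖ ≤ C / (r / 2) := by
    intro c hc
    have hbJ : ∀ w ∈ closedBall c (r / 2), |w.im - z.im| ≤ r := by
      intro w hw
      rw [mem_closedBall, dist_eq_norm] at hw
      have h1 := (Complex.abs_im_le_norm _).trans hw
      rw [Complex.sub_im] at h1
      have := abs_sub_le w.im c.im z.im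
      linarith
    apply Complex.norm_deriv_le_of_forall_mem_sphere_norm_le (by positivity)
    · apply DifferentiableOn.diffContOnCl
      rw [closure_ball c (by positivity)]
      exact hf.mono fun w hw => (hC w (hbJ w hw)).1
    · exact fun w hw => (hC w (hbJ w (sphere_subset_closedBall hw))).2
  have hball : ∀ c ∈ closedBall z (r / 2), |c.im - z.im| ≤ r / 2 := by
    intro c hc
    rw [mem_closedBall, dist_eq_norm] at hc
    rw [← Complex.sub_im]
    exact (Complex.abs_im_le_norm _).trans hc
  have hballJ : ∀ c ∈ closedBall z (r / 2), c.im ∈ J := fun c hc =>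
    (hC c ((hball c hc).trans (by linarith))).1
  have hder : ∀ c : ℂ, c.im ∈ J → ∀ s : ℝ,
      HasDerivAt (fun x : ℂ => f (x - s)) (deriv f (c - s)) c := by
    intro c hc s
    have h1 : DifferentiableAt ℂ f (c - s) :=
      (hf (c - s) (by simpa using hc)).differentiableAt (hO.mem_nhds (by simpa using hc))
    exact h1.hasDerivAt.comp_sub_const c (s : ℂ)
  have key := (hasDerivAt_integral_of_dominated_loc_of_deriv_le
    (μ := (volume : Measure ℝ))
    (F := fun (c : ℂ) (s : ℝ) => ψ s * f (c - s))
    (F' := fun (c : ℂ) (s : ℝ) => ψ s * deriv f (c - s))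
    (x₀ := z) (s := closedBall z (r / 2)) (bound := fun s => ‖ψ s‖ * (C / (r / 2)))
    (closedBall_mem_nhds z (by positivity))
    ?_ ?_ ?_ ?_ ?_ ?_).2
  · exact key.differentiableAt.differentiableWithinAt
  · filter_upwards [closedBall_mem_nhds z (show 0 < r / 2 by positivity)] with c hc
    exact (strip0_integrable hf hb hψ (hballJ c hc)).aestronglyMeasurable
  · exact strip0_integrable hf hb hψ hz
  · exact hψ.aestronglyMeasurable.mul
      (strip0_line_continuous' hd.continuousOn hz).aestronglyMeasurable
  · refine Eventually.of_forall fun s c hc => ?_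
    rw [norm_mul]
    gcongr
    exact hbound _ (by simpa using hball c hc)
  · exact hψ.norm.mul_const _
  · exact Eventually.of_forall fun s c hc => (hder c (hballJ c hc) s).const_mul _

theorem BLwt_pos (A B z : ℂ) : 0 < BLwt A B z := by
  unfold BLwt
  exact add_pos (norm_pos_iff.2 (Complex.exp_ne_zero _)) (norm_pos_iff.2 (Complex.exp_ne_zero _))

theorem BLwt_add_le (A B z w : ℂ) : BLwt A B (z + w) ≤ BLwt A B z * BLwt A B w := by
  unfold BLwt
  rw [mul_add, mul_add, Complex.exp_add, Complex.exp_add, norm_mul, norm_mul]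
  have h1 := norm_nonneg (Complex.exp (-A * z))
  have h2 := norm_nonneg (Complex.exp (-B * z))
  have h3 := norm_nonneg (Complex.exp (-A * w))
  have h4 := norm_nonneg (Complex.exp (-B * w))
  nlinarith [mul_nonneg h1 h4, mul_nonneg h2 h3]

theorem BLwt_continuous (A B : ℂ) : Continuous (BLwt A B) := by
  unfold BLwt
  fun_prop

/-- The hypotheses on a function on a horizontal strip. -/
structure StripHyp (A B : ℂ) (J : Set ℝ) (φ : ℂ → ℂ) (N : ℝ) : Prop where
  op : IsOpen J
  diff : DifferentiableOn ℂ φ {z : ℂ | z.im ∈ J}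
  nrm : ∀ c : ℂ, c.im ∈ J →
    Integrable (fun u : ℝ => ‖φ (c + u)‖ * BLwt A B (c + u)) ∧
      (∫ u : ℝ, ‖φ (c + u)‖ * BLwt A B (c + u)) ≤ N

theorem StripHyp.symm {A B : ℂ} {J : Set ℝ} {φ : ℂ → ℂ} {N : ℝ} (h : StripHyp A B J φ N) :
    StripHyp B A J φ N := by
  have e : BLwt B A = BLwt A B := by
    funext z
    unfold BLwt
    ring
  exact ⟨h.op, h.diff, by rw [e]; exact h.nrm⟩

theorem StripHyp.diffA {A B : ℂ} {J : Set ℝ} {φ : ℂ → ℂ} {N : ℝ} (h : StripHyp A B J φ N) :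
    DifferentiableOn ℂ (fun z => φ z * Complex.exp (-A * z)) {z : ℂ | z.im ∈ J} :=
  h.diff.mul (by fun_prop)

theorem StripHyp.intA {A B : ℂ} {J : Set ℝ} {φ : ℂ → ℂ} {N : ℝ} (h : StripHyp A B J φ N)
    {c : ℂ} (hc : c.im ∈ J) :
    Integrable (fun u : ℝ => φ (c + u) * Complex.exp (-A * (c + u))) := by
  refine (h.nrm c hc).1.mono'
    (strip0_line_continuous h.diffA.continuousOn hc).aestronglyMeasurable
    (Filter.Eventually.of_forall fun u => ?_)
  rw [norm_mul]
  gcongr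
  unfold BLwt
  linarith [norm_nonneg (Complex.exp (-B * (c + u)))]

theorem StripHyp.bddA {A B : ℂ} {J : Set ℝ} {φ : ℂ → ℂ} {N : ℝ} (h : StripHyp A B J φ N) :
    StripLocBdd J (fun z => φ z * Complex.exp (-A * z)) := by
  intro y hy
  refine strip0_bounded (N := N) h.op h.diffA (fun c hc => ⟨(h.intA hc).norm, ?_⟩) hy
  refine le_trans (integral_mono (h.intA hc).norm (h.nrm c hc).1 fun u => ?_) (h.nrm c hc).2
  simp only [norm_mul]
  gcongr
  unfold BLwt
  linarith [norm_nonneg (Complex.exp (-B * (c + u)))]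

theorem StripHyp.line_bdd {A B : ℂ} {J : Set ℝ} {φ : ℂ → ℂ} {N : ℝ} (h : StripHyp A B J φ N)
    {c : ℂ} (hc : c.im ∈ J) : ∃ C : ℝ, ∀ u : ℝ, ‖φ (c + u)‖ * BLwt A B (c + u) ≤ C := by
  obtain ⟨r, hr, C, hC⟩ := h.bddA _ hc
  obtain ⟨r', hr', C', hC'⟩ := h.symm.bddA _ hc
  refine ⟨C + C', fun u => ?_⟩
  have h1 := (hC (c + u) (by simpa using hr.le)).2
  have h2 := (hC' (c + u) (by simpa using hr'.le)).2
  rw [norm_mul] at h1 h2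
  unfold BLwt
  rw [mul_add]
  linarith

theorem StripHyp.nonneg {A B : ℂ} {J : Set ℝ} {φ : ℂ → ℂ} {N : ℝ} (h : StripHyp A B J φ N)
    {c : ℂ} (hc : c.im ∈ J) : 0 ≤ N :=
  le_trans (integral_nonneg fun u => mul_nonneg (norm_nonneg _) (BLwt_pos _ _ _).le)
    (h.nrm c hc).2

/-- The rotated integral as a function of two base points. -/
noncomputable def stripH (φ₁ φ₂ : ℂ → ℂ) (c₁ c₂ : ℂ) : ℂ :=
  ∫ u : ℝ, φ₁ (c₁ + u) * φ₂ (c₂ - u)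

theorem stripH_aux (A c₁ c₂ : ℂ) (φ₁ φ₂ : ℂ → ℂ) (u : ℝ) :
    φ₁ (c₁ + u) * φ₂ (c₂ - u) = Complex.exp (A * (c₁ + c₂)) *
      ((φ₁ (c₁ + u) * Complex.exp (-A * (c₁ + u))) *
        (φ₂ (c₂ - u) * Complex.exp (-A * (c₂ - u)))) := by
  have : Complex.exp (A * (c₁ + c₂)) * Complex.exp (-A * (c₁ + u)) *
      Complex.exp (-A * (c₂ - u)) = 1 := by
    rw [← Complex.exp_add, ← Complex.exp_add, ← Complex.exp_zero]
    congr 1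
    ring
  linear_combination (- φ₁ (c₁ + u) * φ₂ (c₂ - u)) * this

section core

variable {A B : ℂ} {J₁ J₂ : Set ℝ} {φ₁ φ₂ : ℂ → ℂ} {N₁ N₂ : ℝ}

theorem stripH_integrable (h₁ : StripHyp A B J₁ φ₁ N₁) (h₂ : StripHyp A B J₂ φ₂ N₂)
    {c₁ c₂ : ℂ} (hc₁ : c₁.im ∈ J₁) (hc₂ : c₂.im ∈ J₂) :
    Integrable (fun u : ℝ => φ₁ (c₁ + u) * φ₂ (c₂ - u)) := by
  simp_rw [stripH_aux A c₁ c₂ φ₁ φ₂]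
  exact (strip0_integrable h₂.diffA h₂.bddA (h₁.intA hc₁) hc₂).const_mul _

theorem stripH_diff (h₁ : StripHyp A B J₁ φ₁ N₁) (h₂ : StripHyp A B J₂ φ₂ N₂)
    {c₁ : ℂ} (hc₁ : c₁.im ∈ J₁) :
    DifferentiableOn ℂ (fun c₂ => stripH φ₁ φ₂ c₁ c₂) {z : ℂ | z.im ∈ J₂} := by
  unfold stripH
  simp_rw [stripH_aux A c₁ _ φ₁ φ₂, integral_const_mul]
  refine DifferentiableOn.mul (by fun_prop) ?_
  exact strip0_diff h₂.op h₂.diffA h₂.bddA (h₁.intA hc₁)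

theorem stripH_swap (φ₁ φ₂ : ℂ → ℂ) (c₁ c₂ : ℂ) : stripH φ₁ φ₂ c₁ c₂ = stripH φ₂ φ₁ c₂ c₁ := by
  unfold stripH
  rw [← integral_neg_eq_self]
  congr 1
  funext u
  push_cast
  rw [mul_comm]
  congr 2
  ring

theorem stripH_shift_real (φ₁ φ₂ : ℂ → ℂ) (c₁ c₂ : ℂ) (s : ℝ) :
    stripH φ₁ φ₂ (c₁ + s) c₂ = stripH φ₁ φ₂ c₁ (c₂ + s) := by
  unfold stripH
  rw [← integral_add_right_eq_self (fun u : ℝ => φ₁ (c₁ + u) * φ₂ (c₂ + s - u)) s]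
  congr 1
  funext u
  push_cast
  congr 2 <;> ring

open Filter Topology in
theorem stripH_shift (h₁ : StripHyp A B J₁ φ₁ N₁) (h₂ : StripHyp A B J₂ φ₂ N₂)
    (hJ₁c : J₁.OrdConnected) (hJ₂c : J₂.OrdConnected)
    {c₁ c₂ s : ℂ} (hc₁ : c₁.im ∈ J₁) (hc₂ : c₂.im ∈ J₂)
    (hs₁ : (c₁ + s).im ∈ J₁) (hs₂ : (c₂ + s).im ∈ J₂) :
    stripH φ₁ φ₂ (c₁ + s) c₂ = stripH φ₁ φ₂ c₁ (c₂ + s) := by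
  let U : Set ℂ := {s : ℂ | (c₁ + s).im ∈ J₁} ∩ {s : ℂ | (c₂ + s).im ∈ J₂}
  have hUo : IsOpen U := by
    refine (h₁.op.preimage ?_).inter (h₂.op.preimage ?_)
    · exact Complex.continuous_im.comp (continuous_const.add continuous_id)
    · exact Complex.continuous_im.comp (continuous_const.add continuous_id)
  have hconv : ∀ (c : ℂ) (J : Set ℝ), J.OrdConnected → Convex ℝ {s : ℂ | (c + s).im ∈ J} := by
    intro c J hJ x hx y hy a b ha hb hab
    have h := hJ.convex hx hy ha hb hab
    simp only [Set.mem_ofPred_eq] at h ⊢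
    convert h using 1
    simp only [Complex.add_im, Complex.real_smul, Complex.mul_im, Complex.ofReal_re,
      Complex.ofReal_im, smul_eq_mul]
    linear_combination (-c.im) * hab
  have hUc : IsPreconnected U := ((hconv c₁ J₁ hJ₁c).inter (hconv c₂ J₂ hJ₂c)).isPreconnected
  have hg : AnalyticOnNhd ℂ (fun s => stripH φ₁ φ₂ (c₁ + s) c₂) U := by
    refine DifferentiableOn.analyticOnNhd ?_ hUo
    simp_rw [stripH_swap φ₁ φ₂]
    exact (stripH_diff h₂ h₁ hc₂).comp (f := fun s : ℂ => c₁ + s) (by fun_prop)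
      (fun s hs => hs.1)
  have hk : AnalyticOnNhd ℂ (fun s => stripH φ₁ φ₂ c₁ (c₂ + s)) U := by
    refine DifferentiableOn.analyticOnNhd ?_ hUo
    exact (stripH_diff h₁ h₂ hc₁).comp (f := fun s : ℂ => c₂ + s) (by fun_prop)
      (fun s hs => hs.2)
  have h0 : (0 : ℂ) ∈ U := by
    constructor
    · simpa using hc₁
    · simpa using hc₂
  refine hg.eqOn_of_preconnected_of_frequently_eq hk hUc h0 ?_ (x := s) ⟨hs₁, hs₂⟩
  have ht : Tendsto (fun t : ℝ => (t : ℂ)) (𝓝[≠] 0) (𝓝[≠] 0) := by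
    refine tendsto_nhdsWithin_iff.2 ⟨?_, ?_⟩
    · have : Tendsto (fun t : ℝ => (t : ℂ)) (𝓝 0) (𝓝 ((0 : ℝ) : ℂ)) :=
        Complex.continuous_ofReal.tendsto 0
      simpa using this.mono_left nhdsWithin_le_nhds
    · filter_upwards [self_mem_nhdsWithin] with t ht
      simpa using ht
  refine ht.frequently (Eventually.frequently (Eventually.of_forall fun t => ?_))
  exact stripH_shift_real φ₁ φ₂ c₁ c₂ t

theorem stripH_indep (h₁ : StripHyp A B J₁ φ₁ N₁) (h₂ : StripHyp A B J₂ φ₂ N₂)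
    (hJ₁c : J₁.OrdConnected) (hJ₂c : J₂.OrdConnected)
    {c₁ c₁' ξ : ℂ} (hc₁ : c₁.im ∈ J₁) (hc₂ : (ξ - c₁).im ∈ J₂)
    (hc₁' : c₁'.im ∈ J₁) (hc₂' : (ξ - c₁').im ∈ J₂) :
    stripH φ₁ φ₂ c₁' (ξ - c₁') = stripH φ₁ φ₂ c₁ (ξ - c₁) := by
  have := stripH_shift h₁ h₂ hJ₁c hJ₂c (c₁ := c₁) (c₂ := ξ - c₁') (s := c₁' - c₁) hc₁ hc₂'
    (by simpa using hc₁') (by simpa using hc₂)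
  simpa using this

open Classical in
/-- The convolution on the sum of two horizontal strips. -/
noncomputable def stripConv (J₁ J₂ : Set ℝ) (φ₁ φ₂ : ℂ → ℂ) (ξ : ℂ) : ℂ :=
  if h : ∃ c₁ : ℂ, c₁.im ∈ J₁ ∧ (ξ - c₁).im ∈ J₂ then stripH φ₁ φ₂ h.choose (ξ - h.choose) else 0

theorem stripConv_eq (h₁ : StripHyp A B J₁ φ₁ N₁) (h₂ : StripHyp A B J₂ φ₂ N₂)
    (hJ₁c : J₁.OrdConnected) (hJ₂c : J₂.OrdConnected)
    {c₁ ξ : ℂ} (hc₁ : c₁.im ∈ J₁) (hc₂ : (ξ - c₁).im ∈ J₂) :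
    stripConv J₁ J₂ φ₁ φ₂ ξ = stripH φ₁ φ₂ c₁ (ξ - c₁) := by
  have h : ∃ c₁ : ℂ, c₁.im ∈ J₁ ∧ (ξ - c₁).im ∈ J₂ := ⟨c₁, hc₁, hc₂⟩
  unfold stripConv
  rw [dif_pos h]
  exact stripH_indep h₁ h₂ hJ₁c hJ₂c hc₁ hc₂ h.choose_spec.1 h.choose_spec.2

theorem strip_exists {ξ : ℂ} (hξ : ξ.im ∈ J₁ + J₂) :
    ∃ c₁ : ℂ, c₁.im ∈ J₁ ∧ (ξ - c₁).im ∈ J₂ := by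
  obtain ⟨a, ha, b, hb, hab⟩ := Set.mem_add.1 hξ
  refine ⟨⟨0, a⟩, ha, ?_⟩
  rw [Complex.sub_im, ← hab]
  simpa using hb

theorem stripConv_diff (h₁ : StripHyp A B J₁ φ₁ N₁) (h₂ : StripHyp A B J₂ φ₂ N₂)
    (hJ₁c : J₁.OrdConnected) (hJ₂c : J₂.OrdConnected) :
    DifferentiableOn ℂ (stripConv J₁ J₂ φ₁ φ₂) {z : ℂ | z.im ∈ J₁ + J₂} := by
  intro ξ hξ
  obtain ⟨c₁, hc₁, hc₂⟩ := strip_exists hξ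
  have hO : IsOpen {x : ℂ | (x - c₁).im ∈ J₂} :=
    h₂.op.preimage (Complex.continuous_im.comp (continuous_id.sub continuous_const))
  have hd : DifferentiableOn ℂ (fun x => stripH φ₁ φ₂ c₁ (x - c₁)) {x : ℂ | (x - c₁).im ∈ J₂} :=
    (stripH_diff h₁ h₂ hc₁).comp (f := fun x : ℂ => x - c₁) (by fun_prop) (fun x hx => hx)
  have hd2 : DifferentiableOn ℂ (stripConv J₁ J₂ φ₁ φ₂) {x : ℂ | (x - c₁).im ∈ J₂} :=
    hd.congr fun x hx => stripConv_eq h₁ h₂ hJ₁c hJ₂c hc₁ hx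
  exact (hd2.differentiableAt (hO.mem_nhds hc₂)).differentiableWithinAt

/-- Weighted modulus along a line. -/
noncomputable def lineF (A B : ℂ) (φ : ℂ → ℂ) (c : ℂ) (u : ℝ) : ℝ :=
  ‖φ (c + u)‖ * BLwt A B (c + u)

theorem lineF_nonneg (A B : ℂ) (φ : ℂ → ℂ) (c : ℂ) (u : ℝ) : 0 ≤ lineF A B φ c u :=
  mul_nonneg (norm_nonneg _) (BLwt_pos _ _ _).le

theorem lineF_mul_integrable (h₁ : StripHyp A B J₁ φ₁ N₁) (h₂ : StripHyp A B J₂ φ₂ N₂)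
    {c₁ c₂ : ℂ} (hc₁ : c₁.im ∈ J₁) (hc₂ : c₂.im ∈ J₂) (u : ℝ) :
    Integrable (fun v : ℝ => lineF A B φ₁ c₁ v * lineF A B φ₂ c₂ (u - v)) := by
  obtain ⟨C, hC⟩ := h₂.line_bdd hc₂
  refine (h₁.nrm c₁ hc₁).1.mul_bdd (c := C) ?_ (Filter.Eventually.of_forall fun v => ?_)
  · have h1 := strip0_line_continuous h₂.diff.continuousOn hc₂
    have h2 : Continuous (lineF A B φ₂ c₂) := by
      unfold lineF
      exact h1.norm.mul ((BLwt_continuous A B).comp (by fun_prop))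
    exact (h2.comp (continuous_const.sub continuous_id)).aestronglyMeasurable
  · rw [Real.norm_of_nonneg (lineF_nonneg _ _ _ _ _)]
    exact hC _

theorem stripConv_le (h₁ : StripHyp A B J₁ φ₁ N₁) (h₂ : StripHyp A B J₂ φ₂ N₂)
    (hJ₁c : J₁.OrdConnected) (hJ₂c : J₂.OrdConnected)
    {c₁ c₂ : ℂ} (hc₁ : c₁.im ∈ J₁) (hc₂ : c₂.im ∈ J₂) (u : ℝ) :
    ‖stripConv J₁ J₂ φ₁ φ₂ (c₁ + c₂ + u)‖ * BLwt A B (c₁ + c₂ + u) ≤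
      ∫ v : ℝ, lineF A B φ₁ c₁ v * lineF A B φ₂ c₂ (u - v) := by
  have e : c₁ + c₂ + u - c₁ = c₂ + u := by ring
  have hc₂' : (c₂ + u).im ∈ J₂ := by simpa using hc₂
  rw [stripConv_eq h₁ h₂ hJ₁c hJ₂c hc₁ (by rw [e]; exact hc₂'), e]
  unfold stripH
  calc _ ≤ (∫ v : ℝ, ‖φ₁ (c₁ + v) * φ₂ (c₂ + u - v)‖) * BLwt A B (c₁ + c₂ + u) :=
        mul_le_mul_of_nonneg_right (norm_integral_le_integral_norm _) (BLwt_pos _ _ _).le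
    _ = ∫ v : ℝ, ‖φ₁ (c₁ + v) * φ₂ (c₂ + u - v)‖ * BLwt A B (c₁ + c₂ + u) :=
        (integral_mul_const _ _).symm
    _ ≤ _ := by
        refine integral_mono ((stripH_integrable h₁ h₂ hc₁ hc₂').norm.mul_const _)
          (lineF_mul_integrable h₁ h₂ hc₁ hc₂ u) fun v => ?_
        have h := BLwt_add_le A B (c₁ + v) (c₂ + (u - v : ℝ))
        have e1 : c₁ + v + (c₂ + (u - v : ℝ)) = c₁ + c₂ + u := by push_cast; ring
        have e2 : c₂ + u - v = c₂ + (u - v : ℝ) := by push_cast; ring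
        rw [e1] at h
        simp only [lineF, norm_mul, e2]
        calc _ ≤ ‖φ₁ (c₁ + v)‖ * ‖φ₂ (c₂ + (u - v : ℝ))‖ *
              (BLwt A B (c₁ + v) * BLwt A B (c₂ + (u - v : ℝ))) := by gcongr
          _ = _ := by ring

theorem stripConv_L1 (h₁ : StripHyp A B J₁ φ₁ N₁) (h₂ : StripHyp A B J₂ φ₂ N₂)
    (hJ₁c : J₁.OrdConnected) (hJ₂c : J₂.OrdConnected)
    {c : ℂ} (hc : c.im ∈ J₁ + J₂) :
    Integrable (fun u : ℝ => ‖stripConv J₁ J₂ φ₁ φ₂ (c + u)‖ * BLwt A B (c + u)) ∧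
      (∫ u : ℝ, ‖stripConv J₁ J₂ φ₁ φ₂ (c + u)‖ * BLwt A B (c + u)) ≤ N₁ * N₂ := by
  obtain ⟨c₁, hc₁, hc₂⟩ := strip_exists hc
  have i1 : Integrable (lineF A B φ₁ c₁) := (h₁.nrm c₁ hc₁).1
  have i2 : Integrable (lineF A B φ₂ (c - c₁)) := (h₂.nrm _ hc₂).1
  have ic := i1.integrable_convolution (ContinuousLinearMap.mul ℝ ℝ) i2
  have ie := integral_convolution (ν := volume) (μ := volume) (ContinuousLinearMap.mul ℝ ℝ) i1 i2
  have hle : ∀ u : ℝ, ‖stripConv J₁ J₂ φ₁ φ₂ (c + u)‖ * BLwt A B (c + u) ≤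
      (convolution (lineF A B φ₁ c₁) (lineF A B φ₂ (c - c₁)) (ContinuousLinearMap.mul ℝ ℝ)
        volume) u := by
    intro u
    have := stripConv_le h₁ h₂ hJ₁c hJ₂c hc₁ hc₂ u
    simpa [convolution] using this
  have hint : Integrable (fun u : ℝ => ‖stripConv J₁ J₂ φ₁ φ₂ (c + u)‖ * BLwt A B (c + u)) := by
    refine ic.mono' ?_ (Filter.Eventually.of_forall fun u => ?_)
    · have h1 := strip0_line_continuous (stripConv_diff h₁ h₂ hJ₁c hJ₂c).continuousOn hc
      exact (h1.norm.mul ((BLwt_continuous A B).comp (by fun_prop))).aestronglyMeasurable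
    · rw [Real.norm_of_nonneg (mul_nonneg (norm_nonneg _) (BLwt_pos _ _ _).le)]
      exact hle u
  refine ⟨hint, (integral_mono hint ic hle).trans ?_⟩
  rw [ie, ContinuousLinearMap.mul_apply']
  exact mul_le_mul (h₁.nrm c₁ hc₁).2 (h₂.nrm _ hc₂).2
    (integral_nonneg fun u => lineF_nonneg _ _ _ _ _) (h₁.nonneg hc₁)

theorem stripConv_sup₁ (h₁ : StripHyp A B J₁ φ₁ N₁) (h₂ : StripHyp A B J₂ φ₂ N₂)
    (hJ₁c : J₁.OrdConnected) (hJ₂c : J₂.OrdConnected)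
    {P : ℝ} (hP : ∀ c : ℂ, c.im ∈ J₁ → ‖φ₁ c‖ * BLwt A B c ≤ P)
    {ξ : ℂ} (hξ : ξ.im ∈ J₁ + J₂) :
    ‖stripConv J₁ J₂ φ₁ φ₂ ξ‖ * BLwt A B ξ ≤ P * N₂ := by
  obtain ⟨c₁, hc₁, hc₂⟩ := strip_exists hξ
  have hP0 : 0 ≤ P := (mul_nonneg (norm_nonneg _) (BLwt_pos _ _ _).le).trans (hP c₁ hc₁)
  have h := stripConv_le h₁ h₂ hJ₁c hJ₂c hc₁ hc₂ 0
  simp only [Complex.ofReal_zero, add_zero, add_sub_cancel] at h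
  have i2 : Integrable (lineF A B φ₂ (ξ - c₁)) := (h₂.nrm _ hc₂).1
  refine h.trans ?_
  calc _ ≤ ∫ v : ℝ, P * lineF A B φ₂ (ξ - c₁) (0 - v) := by
        refine integral_mono (lineF_mul_integrable h₁ h₂ hc₁ hc₂ 0)
          ((i2.comp_sub_left 0).const_mul P) fun v => ?_
        exact mul_le_mul_of_nonneg_right (hP _ (by simpa using hc₁)) (lineF_nonneg _ _ _ _ _)
    _ = P * ∫ v : ℝ, lineF A B φ₂ (ξ - c₁) v := by
        rw [integral_const_mul, integral_sub_left_eq_self (lineF A B φ₂ (ξ - c₁)) volume 0]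
    _ ≤ _ := mul_le_mul_of_nonneg_left (h₂.nrm _ hc₂).2 hP0

theorem stripConv_sup₂ (h₁ : StripHyp A B J₁ φ₁ N₁) (h₂ : StripHyp A B J₂ φ₂ N₂)
    (hJ₁c : J₁.OrdConnected) (hJ₂c : J₂.OrdConnected)
    {P : ℝ} (hP : ∀ c : ℂ, c.im ∈ J₂ → ‖φ₂ c‖ * BLwt A B c ≤ P)
    {ξ : ℂ} (hξ : ξ.im ∈ J₁ + J₂) :
    ‖stripConv J₁ J₂ φ₁ φ₂ ξ‖ * BLwt A B ξ ≤ N₁ * P := by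
  obtain ⟨c₁, hc₁, hc₂⟩ := strip_exists hξ
  have hP0 : 0 ≤ P := (mul_nonneg (norm_nonneg _) (BLwt_pos _ _ _).le).trans (hP _ hc₂)
  have h := stripConv_le h₁ h₂ hJ₁c hJ₂c hc₁ hc₂ 0
  simp only [Complex.ofReal_zero, add_zero, add_sub_cancel] at h
  have i1 : Integrable (lineF A B φ₁ c₁) := (h₁.nrm _ hc₁).1
  refine h.trans ?_
  calc _ ≤ ∫ v : ℝ, lineF A B φ₁ c₁ v * P := by
        refine integral_mono (lineF_mul_integrable h₁ h₂ hc₁ hc₂ 0) (i1.mul_const P) fun v => ?_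
        exact mul_le_mul_of_nonneg_left (hP _ (by simpa using hc₂)) (lineF_nonneg _ _ _ _ _)
    _ = (∫ v : ℝ, lineF A B φ₁ c₁ v) * P := integral_mul_const _ _
    _ ≤ _ := mul_le_mul_of_nonneg_right (h₁.nrm _ hc₁).2 hP0

end core

theorem stripHyp_of_rotated (α : ℝ) (A B : ℂ) (J : Set ℝ) (hJ : IsOpen J) (φ : ℂ → ℂ)
    (hφ : DifferentiableOn ℂ φ (stripOver α J)) (N : ℝ)
    (hN : ∀ c ∈ stripOver α J,
      Integrable (fun u : ℝ =>
        ‖φ (c + Complex.exp (α * Complex.I) * u)‖ *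
          BLwt A B (c + Complex.exp (α * Complex.I) * u)) ∧
      (∫ u : ℝ, ‖φ (c + Complex.exp (α * Complex.I) * u)‖ *
          BLwt A B (c + Complex.exp (α * Complex.I) * u)) ≤ N) :
    StripHyp (Complex.exp (α * Complex.I) * A) (Complex.exp (α * Complex.I) * B) J
      (fun z => φ (Complex.exp (α * Complex.I) * z)) N := by
  have hmem : ∀ z : ℂ, z.im ∈ J → Complex.exp (α * Complex.I) * z ∈ stripOver α J := by
    intro z hz
    have h : Complex.exp (-α * Complex.I) * (Complex.exp (α * Complex.I) * z) = z := by
      rw [← mul_assoc, ← Complex.exp_add, neg_mul, neg_add_cancel, Complex.exp_zero, one_mul]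
    change (Complex.exp (-α * Complex.I) * (Complex.exp (α * Complex.I) * z)).im ∈ J
    rw [h]
    exact hz
  refine ⟨hJ, hφ.comp (by fun_prop) hmem, fun c hc => ?_⟩
  have h := hN _ (hmem c hc)
  have e : ∀ z, BLwt (Complex.exp (α * Complex.I) * A) (Complex.exp (α * Complex.I) * B) z =
      BLwt A B (Complex.exp (α * Complex.I) * z) := by
    intro z
    unfold BLwt
    congr 3 <;> ring
  simpa only [e, mul_add] using h

/-- Convolution of holomorphic functions with finite weighted `L¹`
norms on two parallel strips: it is well defined (independently of the chosen line),
holomorphic on the sum of the strips, and the norms satisfy Young's inequalities. -/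
theorem convolution_on_strips
    (α : ℝ) (A B : ℂ)
    (hAB : (Complex.exp (α * Complex.I) * A).re < (Complex.exp (α * Complex.I) * B).re)
    (J₁ J₂ : Set ℝ)
    (hJ₁ : J₁.Nonempty) (hJ₂ : J₂.Nonempty)
    (hJ₁o : IsOpen J₁) (hJ₂o : IsOpen J₂)
    (hJ₁c : J₁.OrdConnected) (hJ₂c : J₂.OrdConnected)
    (φ₁ φ₂ : ℂ → ℂ)
    (hφ₁ : DifferentiableOn ℂ φ₁ (stripOver α J₁))
    (hφ₂ : DifferentiableOn ℂ φ₂ (stripOver α J₂))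
    (N₁ N₂ : ℝ)
    (hN₁ : ∀ c ∈ stripOver α J₁,
      Integrable (fun u : ℝ =>
        ‖φ₁ (c + Complex.exp (α * Complex.I) * u)‖ *
          BLwt A B (c + Complex.exp (α * Complex.I) * u)) ∧
      (∫ u : ℝ, ‖φ₁ (c + Complex.exp (α * Complex.I) * u)‖ *
          BLwt A B (c + Complex.exp (α * Complex.I) * u)) ≤ N₁)
    (hN₂ : ∀ c ∈ stripOver α J₂,
      Integrable (fun u : ℝ =>
        ‖φ₂ (c + Complex.exp (α * Complex.I) * u)‖ *
          BLwt A B (c + Complex.exp (α * Complex.I) * u)) ∧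
      (∫ u : ℝ, ‖φ₂ (c + Complex.exp (α * Complex.I) * u)‖ *
          BLwt A B (c + Complex.exp (α * Complex.I) * u)) ≤ N₂) :
    ∃ h : ℂ → ℂ,
      -- existence, absolute convergence, independence of the choice of c₁
      (∀ ξ : ℂ, ∀ c₁ ∈ stripOver α J₁, ξ - c₁ ∈ stripOver α J₂ →
        Integrable (fun u : ℝ =>
          φ₁ (c₁ + Complex.exp (α * Complex.I) * u) *
            φ₂ (ξ - c₁ - Complex.exp (α * Complex.I) * u)) ∧
        Complex.exp (α * Complex.I) *
          (∫ u : ℝ, φ₁ (c₁ + Complex.exp (α * Complex.I) * u) *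
            φ₂ (ξ - c₁ - Complex.exp (α * Complex.I) * u)) = h ξ) ∧
      -- holomorphy on the sum strip
      DifferentiableOn ℂ h (stripOver α (J₁ + J₂)) ∧
      -- ‖φ₁*φ₂‖ ≤ ‖φ₁‖·‖φ₂‖
      (∀ c ∈ stripOver α (J₁ + J₂),
        Integrable (fun u : ℝ =>
          ‖h (c + Complex.exp (α * Complex.I) * u)‖ *
            BLwt A B (c + Complex.exp (α * Complex.I) * u)) ∧
        (∫ u : ℝ, ‖h (c + Complex.exp (α * Complex.I) * u)‖ *
            BLwt A B (c + Complex.exp (α * Complex.I) * u)) ≤ N₁ * N₂) ∧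
      -- |φ₁*φ₂| ≤ |φ₁|·‖φ₂‖
      (∀ P₁ : ℝ,
        (∀ c ∈ stripOver α J₁, ∀ u : ℝ,
          ‖φ₁ (c + Complex.exp (α * Complex.I) * u)‖ *
            BLwt A B (c + Complex.exp (α * Complex.I) * u) ≤ P₁) →
        ∀ ξ ∈ stripOver α (J₁ + J₂), ‖h ξ‖ * BLwt A B ξ ≤ P₁ * N₂) ∧
      -- |φ₁*φ₂| ≤ ‖φ₁‖·|φ₂|
      (∀ P₂ : ℝ,
        (∀ c ∈ stripOver α J₂, ∀ u : ℝ,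
          ‖φ₂ (c + Complex.exp (α * Complex.I) * u)‖ *
            BLwt A B (c + Complex.exp (α * Complex.I) * u) ≤ P₂) →
        ∀ ξ ∈ stripOver α (J₁ + J₂), ‖h ξ‖ * BLwt A B ξ ≤ N₁ * P₂) := by
  set e : ℂ := Complex.exp (α * Complex.I) with he
  set e' : ℂ := Complex.exp (-α * Complex.I) with he'
  have hee : e * e' = 1 := by
    rw [he, he', ← Complex.exp_add]
    simp
  have hne : ‖e‖ = 1 := Complex.norm_exp_ofReal_mul_I α
  have h₁ := stripHyp_of_rotated α A B J₁ hJ₁o φ₁ hφ₁ N₁ hN₁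
  have h₂ := stripHyp_of_rotated α A B J₂ hJ₂o φ₂ hφ₂ N₂ hN₂
  rw [← he] at h₁ h₂
  have hw : ∀ z, BLwt (e * A) (e * B) (e' * z) = BLwt A B z := by
    intro z
    unfold BLwt
    congr 3
    · linear_combination (-A * z) * hee
    · linear_combination (-B * z) * hee
  have hmul : ∀ z : ℂ, e * (e' * z) = z := fun z => by rw [← mul_assoc, hee, one_mul]
  have hlin : ∀ (c : ℂ) (u : ℝ), e' * (c + e * u) = e' * c + u := fun c u => by
    linear_combination (u : ℂ) * hee
  have hlin₂ : ∀ (c : ℂ) (u : ℝ), e * (e' * c + u) = c + e * u := fun c u => by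
    linear_combination c * hee
  have hlin₃ : ∀ (ξ c : ℂ) (u : ℝ), e * (e' * ξ - e' * c - u) = ξ - c - e * u := fun ξ c u => by
    linear_combination (ξ - c) * hee
  refine ⟨fun ξ => e * stripConv J₁ J₂ (fun z => φ₁ (e * z)) (fun z => φ₂ (e * z)) (e' * ξ),
    ?_, ?_, ?_, ?_, ?_⟩
  · intro ξ c₁ hc₁ hc₂
    have hc₁' : (e' * c₁).im ∈ J₁ := hc₁
    have hc₂' : (e' * ξ - e' * c₁).im ∈ J₂ := by
      rw [← mul_sub]
      exact hc₂
    have hi := stripH_integrable h₁ h₂ hc₁' hc₂'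
    simp only [hlin₂, hlin₃] at hi
    refine ⟨hi, ?_⟩
    dsimp only
    rw [stripConv_eq h₁ h₂ hJ₁c hJ₂c hc₁' hc₂']
    simp only [stripH, hlin₂, hlin₃]
  · refine DifferentiableOn.const_mul ?_ e
    exact (stripConv_diff h₁ h₂ hJ₁c hJ₂c).comp (f := fun ξ : ℂ => e' * ξ) (by fun_prop)
      (fun ξ hξ => hξ)
  · intro c hc
    have h := stripConv_L1 h₁ h₂ hJ₁c hJ₂c (c := e' * c) hc
    simp only [norm_mul, hne, one_mul]
    simp only [← hlin, hw] at h
    exact h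
  · intro P hP ξ hξ
    have h := stripConv_sup₁ h₁ h₂ hJ₁c hJ₂c (P := P) (fun c hc => ?_) (ξ := e' * ξ) hξ
    · simp only [norm_mul, hne, one_mul]
      rwa [hw] at h
    · have h := hP (e * c) (show (e' * (e * c)).im ∈ J₁ by
        rw [← mul_assoc, mul_comm e', hee, one_mul]; exact hc) 0
      simp only [Complex.ofReal_zero, mul_zero, add_zero] at h
      rwa [← hw, ← mul_assoc, mul_comm e', hee, one_mul] at h
  · intro P hP ξ hξ
    have h := stripConv_sup₂ h₁ h₂ hJ₁c hJ₂c (P := P) (fun c hc => ?_) (ξ := e' * ξ) hξ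
    · simp only [norm_mul, hne, one_mul]
      rwa [hw] at h
    · have h := hP (e * c) (show (e' * (e * c)).im ∈ J₂ by
        rw [← mul_assoc, mul_comm e', hee, one_mul]; exact hc) 0
      simp only [Complex.ofReal_zero, mul_zero, add_zero] at h
      rwa [← hw, ← mul_assoc, mul_comm e', hee, one_mul] at h
end

section
/- With the notation of the context, let Λ ≥ 0 with 2Λ < −Re(e^{iα}πi/√ε), let a, b ∈ ℝ with a + b > 0, and let g be holomorphic on the strip S_α(Λ) with |g(t)| ≤ K·|e^{−2√ε t}|^a · |1 − e^{−2√ε t}|^{−(a+b)} for all t ∈ S_α(Λ) and some K > 0 (i.e. g, viewed in the x-variable, is O(|x−√ε|^a·|x+√ε|^b)). Then for every ξ in the strip Ω_α(a,b) and every C with Λ < C < −Re(e^{iα}πi/√ε) − Λ, the unfolded Borel integral B_α⁺[g](ξ) converges absolutely and its value is independent of C; moreover, for every Λ₁ with Λ < Λ₁ and 2Λ₁ < −Re(e^{iα}πi/√ε), setting A := e^{−iα}Λ₁ and B := −πi/√ε − e^{−iα}Λ₁, the function B_α⁺[g] has finite weighted sup-norm sup_{u∈ℝ} |B_α⁺[g](c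 + e^{iα}u)|·(|e^{−A(c+e^{iα}u)}| + |e^{−B(c+e^{iα}u)}|) on every line c + e^{iα}ℝ contained in Ω_α(a,b). -/
open Complex MeasureTheory Real

/-- The width `−Re(e^{iα}πi/√ε)` of the unfolded strips in the time coordinate. -/
noncomputable def stripWidth (α : ℝ) (sqe : ℂ) : ℝ :=
  -(Complex.exp (α * Complex.I) * (Real.pi * Complex.I) / sqe).re

/-- The strip `S_α(Λ) = {t : Λ < Re(e^{iα}t) < −Re(e^{iα}πi/√ε) − Λ}` in the time
coordinate. -/
noncomputable def timeStrip (α : ℝ) (sqe : ℂ) (Λ : ℝ) : Set ℂ :=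
  {t : ℂ | Λ < (Complex.exp (α * Complex.I) * t).re ∧
    (Complex.exp (α * Complex.I) * t).re < stripWidth α sqe - Λ}

/-- The point `e^{−iα}(C + iu)` of the line `Re(e^{iα}t) = C`. -/
noncomputable def timePt (α : ℝ) (C : ℝ) (u : ℝ) : ℂ :=
  Complex.exp (-α * Complex.I) * (C + Complex.I * u)

/-- The unfolded Borel transform `B_α⁺[g](ξ)` along the line `Re(e^{iα}t) = C`. -/
noncomputable def unfoldedBorel (α : ℝ) (g : ℂ → ℂ) (C : ℝ) (ξ : ℂ) : ℂ :=
  (1 / (2 * Real.pi * Complex.I)) * (Complex.I * Complex.exp (-α * Complex.I)) *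
    ∫ u : ℝ, g (timePt α C u) * Complex.exp (timePt α C u * ξ)

/-- The strip `Ω_α(a,b)` of direction `α` between the points `2a√ε` and `−2b√ε` in the
Borel plane. -/
noncomputable def borelStrip (α : ℝ) (sqe : ℂ) (a b : ℝ) : Set ℂ :=
  {ξ : ℂ | (Complex.exp (-α * Complex.I) * ((2 * a : ℝ) * sqe)).im <
      (Complex.exp (-α * Complex.I) * ξ).im ∧
    (Complex.exp (-α * Complex.I) * ξ).im <
      -(Complex.exp (-α * Complex.I) * ((2 * b : ℝ) * sqe)).im}

lemma ub_lower (σ : ℂ) (hσ : σ.im < 0) (w : ℝ) (hw : w = -(Real.pi * Complex.I / σ).re)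
    (hw0 : 0 < w) (C1 C2 : ℝ) (h1 : 0 < C1) (h2 : C2 < w) :
    ∃ d : ℝ, 0 < d ∧ ∀ C : ℝ, C1 ≤ C → C ≤ C2 → ∀ u : ℝ,
      d * max 1 ‖Complex.exp (-2 * (σ * (C + Complex.I * u)))‖ ≤
        ‖1 - Complex.exp (-2 * (σ * (C + Complex.I * u)))‖ := by
  have hσ0 : σ ≠ 0 := by rintro rfl; simp at hσ
  have hne : ∀ C : ℝ, C1 ≤ C → C ≤ C2 → ∀ u : ℝ,
      0 < ‖1 - Complex.exp (-2 * (σ * (C + Complex.I * u)))‖ := by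
    intro C hC hC' u
    rw [norm_pos_iff, sub_ne_zero]
    intro h
    obtain ⟨n, hn⟩ := Complex.exp_eq_one_iff.1 h.symm
    have e : (C : ℂ) + Complex.I * u = -(n : ℂ) * (Real.pi * Complex.I / σ) := by
      field_simp
      linear_combination (-1/2 : ℂ) * hn
    have e2 := congrArg Complex.re e
    rw [show -(n : ℂ) * (Real.pi * Complex.I / σ)
      = ((-(n : ℝ) : ℝ) : ℂ) * (Real.pi * Complex.I / σ) by push_cast; ring,
      Complex.re_ofReal_mul] at e2
    simp at e2
    have e3 : C = n * w := by rw [hw]; rw [e2]; simp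
    have a1 : (0 : ℝ) < n := by
      by_contra hh
      push Not at hh
      nlinarith
    have a2 : (n : ℝ) < 1 := by
      by_contra hh
      push Not at hh
      nlinarith
    have a1' : 0 < n := by exact_mod_cast a1
    have a2' : n < 1 := by exact_mod_cast a2
    omega
  set R : ℝ := (1 + 2 * |σ.re| * |C2|) / (2 * (-σ.im)) with hR
  have hR' : R * (2 * (-σ.im)) = 1 + 2 * |σ.re| * |C2| := by
    
    rw [hR]; exact div_mul_cancel₀ _ (by linarith)
  let f : ℝ × ℝ → ℝ := fun x =>
    ‖1 - Complex.exp (-2 * (σ * (x.1 + Complex.I * x.2)))‖ /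
      max 1 ‖Complex.exp (-2 * (σ * (x.1 + Complex.I * x.2)))‖
  have hf : Continuous f := by
    apply Continuous.div
    · fun_prop
    · fun_prop
    · intro x
      have : (1 : ℝ) ≤ max 1 ‖Complex.exp (-2 * (σ * (x.1 + Complex.I * x.2)))‖ := le_max_left _ _
      linarith
  have hcomp : ∃ d0 : ℝ, 0 < d0 ∧ ∀ x ∈ Set.Icc C1 C2 ×ˢ Set.Icc (-R) R, d0 ≤ f x := by
    rcases (Set.Icc C1 C2 ×ˢ Set.Icc (-R) R).eq_empty_or_nonempty with he | he
    · exact ⟨1, one_pos, by rw [he]; simp⟩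
    · obtain ⟨x, hx, hmin⟩ := (isCompact_Icc.prod isCompact_Icc).exists_isMinOn he hf.continuousOn
      refine ⟨f x, div_pos (hne _ hx.1.1 hx.1.2 _) (by positivity), fun y hy => hmin hy⟩
  obtain ⟨d0, hd0, hd⟩ := hcomp
  refine ⟨min d0 (1/2), by positivity, ?_⟩
  intro C hC hC' u
  set E := Complex.exp (-2 * (σ * (C + Complex.I * u))) with hE
  have hM : 0 < max 1 ‖E‖ := by positivity
  by_cases hu : |u| ≤ R
  · have := hd (C, u) ⟨⟨hC, hC'⟩, abs_le.1 hu⟩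
    have h3 : d0 * max 1 ‖E‖ ≤ ‖1 - E‖ := (le_div_iff₀ hM).1 this
    refine le_trans ?_ h3
    gcongr
    exact min_le_left _ _
  · push Not at hu
    have hnE : ‖E‖ = Real.exp (-2 * σ.re * C + 2 * σ.im * u) := by
      rw [hE, Complex.norm_exp]
      congr 1
      simp
      ring
    have hpc : |σ.re * C| ≤ |σ.re| * |C2| := by
      rw [abs_mul]
      gcongr
      linarith
    have hpc' := abs_le.1 hpc
    have h4 : ‖E‖ ≤ Real.exp (-1) ∨ Real.exp 1 ≤ ‖E‖ := by
      rw [hnE, Real.exp_le_exp, Real.exp_le_exp]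
      rcases le_total 0 u with h0 | h0
      · rw [abs_of_nonneg h0] at hu
        left
        nlinarith
      · rw [abs_of_nonpos h0] at hu
        right
        nlinarith
    have e2 : (2 : ℝ) ≤ Real.exp 1 := by linarith [Real.add_one_le_exp (1 : ℝ)]
    have h5 : 1 / 2 * max 1 ‖E‖ ≤ ‖1 - E‖ := by
      rcases h4 with h4 | h4
      · have : Real.exp (-1) ≤ 1/2 := by
          rw [Real.exp_neg, ← one_div]
          exact one_div_le_one_div_of_le (by norm_num) e2
        have h6 := norm_sub_norm_le (1 : ℂ) E
        rw [norm_one] at h6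
        rw [max_eq_left (by linarith)]
        linarith
      · have h6 := norm_sub_norm_le E 1
        rw [norm_one, norm_sub_rev] at h6
        rw [max_eq_right (by linarith)]
        linarith
    refine le_trans ?_ h5
    gcongr
    exact min_le_right _ _

lemma ub_pow (e f d a b : ℝ) (hab : 0 < a + b) (he : 0 < e) (hd : 0 < d)
    (h : d * max 1 e ≤ f) :
    e ^ a * f ^ (-(a + b)) ≤ d ^ (-(a+b)) * e ^ a ∧
    e ^ a * f ^ (-(a + b)) ≤ d ^ (-(a+b)) * e ^ (-b) := by
  have h1 : d ≤ f := le_trans (by nlinarith [le_max_left 1 e]) h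
  have h2 : d * e ≤ f := le_trans (by nlinarith [le_max_right 1 e]) h
  constructor
  · rw [mul_comm]
    exact mul_le_mul_of_nonneg_right
      (Real.rpow_le_rpow_of_nonpos hd h1 (by linarith)) (by positivity)
  · calc e ^ a * f ^ (-(a + b)) ≤ e ^ a * (d * e) ^ (-(a + b)) := by
          gcongr ?_ * ?_
          exact Real.rpow_le_rpow_of_nonpos (by positivity) h2 (by linarith)
      _ = d ^ (-(a+b)) * (e ^ a * e ^ (-(a+b))) := by
          rw [Real.mul_rpow hd.le he.le]; ring
      _ = _ := by rw [← Real.rpow_add he]; congr 2; ring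

lemma ub_exp_int (δ : ℝ) (hδ : 0 < δ) : Integrable fun u : ℝ => Real.exp (-δ * |u|) := by
  rw [← integrableOn_univ, ← Set.Iic_union_Ioi (a := (0 : ℝ)), integrableOn_union]
  constructor
  · refine (integrableOn_exp_mul_Iic hδ 0).congr_fun ?_ measurableSet_Iic
    intro x hx
    simp only [abs_of_nonpos (Set.mem_Iic.1 hx)]
    ring_nf
  · refine (integrableOn_exp_mul_Ioi (neg_lt_zero.2 hδ) 0).congr_fun ?_ measurableSet_Ioi
    intro x hx
    simp only [abs_of_pos (Set.mem_Ioi.1 hx)]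

lemma ub_shift (h : ℂ → ℂ) (C1 C2 : ℝ) (hC : C1 ≤ C2)
    (hh : DifferentiableOn ℂ h {z | C1 ≤ z.re ∧ z.re ≤ C2}) (M δ : ℝ) (hδ : 0 < δ)
    (hb : ∀ C : ℝ, C1 ≤ C → C ≤ C2 → ∀ u : ℝ, ‖h (C + Complex.I * u)‖ ≤ M * Real.exp (-δ * |u|))
    (i1 : Integrable fun u : ℝ => h (C1 + Complex.I * u))
    (i2 : Integrable fun u : ℝ => h (C2 + Complex.I * u)) :
    ∫ u : ℝ, h (C1 + Complex.I * u) = ∫ u : ℝ, h (C2 + Complex.I * u) := by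
  have l1 := intervalIntegral_tendsto_integral i1 Filter.tendsto_neg_atTop_atBot Filter.tendsto_id
  have l2 := intervalIntegral_tendsto_integral i2 Filter.tendsto_neg_atTop_atBot Filter.tendsto_id
  have l3 := l2.sub l1
  have l4 : Filter.Tendsto (fun R : ℝ => (∫ u in (-R)..(id R), h (C2 + Complex.I * u)) -
      ∫ u in (-R)..(id R), h (C1 + Complex.I * u)) Filter.atTop (nhds 0) := by
    have lb : Filter.Tendsto (fun R : ℝ => 2 * (M * Real.exp (-δ * |R|) * |C2 - C1|))
        Filter.atTop (nhds 0) := by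
      have : Filter.Tendsto (fun R : ℝ => Real.exp (-δ * |R|)) Filter.atTop (nhds 0) := by
        apply Real.tendsto_exp_atBot.comp
        apply Filter.Tendsto.const_mul_atTop_of_neg (by linarith)
        exact Filter.tendsto_abs_atTop_atTop
      simpa using ((this.const_mul M).mul_const (|C2 - C1|)).const_mul 2
    refine squeeze_zero_norm ?_ lb
    intro R
    have key := Complex.integral_boundary_rect_eq_zero_of_differentiableOn h
      ⟨C1, -R⟩ ⟨C2, R⟩ (hh.mono (by
        intro z hz
        rw [Complex.mem_reProdIm] at hz
        have := hz.1
        simp only [Set.uIcc_of_le hC] at this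
        exact this))
    simp only [smul_eq_mul] at key
    have hI : ∀ R : ℝ, ‖∫ x in C1..C2, h (x + R * Complex.I)‖ ≤
        M * Real.exp (-δ * |R|) * |C2 - C1| := by
      intro R
      apply intervalIntegral.norm_integral_le_of_norm_le_const
      intro x hx
      rw [Set.uIoc_of_le hC] at hx
      have := hb x hx.1.le hx.2 R
      rwa [mul_comm Complex.I] at this
    have k1 := hI R
    have k2 := hI (-R)
    rw [abs_neg] at k2
    have e : ((∫ u in (-R)..(id R), h (C2 + Complex.I * u)) -
      ∫ u in (-R)..(id R), h (C1 + Complex.I * u)) =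
      Complex.I * ((∫ x in C1..C2, h (x + (-R : ℝ) * Complex.I)) -
        ∫ x in C1..C2, h (x + R * Complex.I)) := by
      simp only [mul_comm Complex.I, id]
      have hI2 := Complex.I_mul_I
      linear_combination (-Complex.I) * key + ((∫ u in (-R)..R, h (C2 + u * Complex.I)) -
        ∫ u in (-R)..R, h (C1 + u * Complex.I)) * hI2
    rw [e, norm_mul, Complex.norm_I, one_mul]
    refine (norm_sub_le _ _).trans ?_
    linarith
  have := tendsto_nhds_unique l3 l4
  exact (sub_eq_zero.1 this).symm

lemma ub_main (sqe : ℂ) (hsqe : sqe ≠ 0)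
    (α : ℝ) (hα : α - Complex.arg sqe ∈ Set.Ioo 0 Real.pi) :
    (Complex.exp (-α * Complex.I) * sqe).im < 0 := by
  have h : Complex.exp (-α * Complex.I) * sqe =
      ((‖sqe‖ : ℝ) : ℂ) * Complex.exp (((-(α - Complex.arg sqe) : ℝ) : ℂ) * Complex.I) := by
    conv_lhs => rw [← Complex.norm_mul_exp_arg_mul_I sqe]
    rw [mul_left_comm, ← Complex.exp_add]
    congr 2
    push_cast
    ring
  rw [h, Complex.im_ofReal_mul, Complex.exp_ofReal_mul_I_im, Real.sin_neg]
  have := Real.sin_pos_of_mem_Ioo hα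
  have := norm_pos_iff.2 hsqe
  nlinarith

lemma ub_bound (sqe : ℂ) (hsqe : sqe ≠ 0)
    (α : ℝ) (hα : α - Complex.arg sqe ∈ Set.Ioo 0 Real.pi)
    (hw : 0 < stripWidth α sqe)
    (Λ : ℝ) (hΛ : 0 ≤ Λ)
    (a b : ℝ) (hab : 0 < a + b)
    (g : ℂ → ℂ)
    (K : ℝ) (hK : 0 < K)
    (hbound : ∀ t ∈ timeStrip α sqe Λ,
      ‖g t‖ ≤ K * ‖Complex.exp (-(2 * sqe) * t)‖ ^ a *
        ‖1 - Complex.exp (-(2 * sqe) * t)‖ ^ (-(a + b)))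
    (ξ : ℂ) (hξ : ξ ∈ borelStrip α sqe a b)
    (C1 C2 : ℝ) (h1 : Λ < C1) (h2 : C2 < stripWidth α sqe - Λ) :
    ∃ M δ : ℝ, 0 < δ ∧ 0 ≤ M ∧ ∀ C : ℝ, C1 ≤ C → C ≤ C2 → ∀ η : ℂ,
      (Complex.exp (-α * Complex.I) * η).im = (Complex.exp (-α * Complex.I) * ξ).im →
      ∀ u : ℝ, ‖g (timePt α C u) * Complex.exp (timePt α C u * η)‖ ≤
        M * Real.exp (C * (Complex.exp (-α * Complex.I) * η).re) * Real.exp (-δ * |u|) := by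
  have hq := ub_main sqe hsqe α hα
  have hee : Complex.exp (α * Complex.I) * Complex.exp (-α * Complex.I) = 1 := by
    rw [← Complex.exp_add]; simp
  have hwe : stripWidth α sqe = -(Real.pi * Complex.I / (Complex.exp (-α * Complex.I) * sqe)).re := by
    unfold stripWidth
    congr 2
    have : Complex.exp (-α * Complex.I) ≠ 0 := Complex.exp_ne_zero _
    rw [div_eq_div_iff hsqe (mul_ne_zero this hsqe)]
    linear_combination Real.pi * Complex.I * sqe * hee
  obtain ⟨hξ1, hξ2⟩ := hξ
  rw [mul_left_comm, Complex.im_ofReal_mul] at hξ1 hξ2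
  set σ := Complex.exp (-α * Complex.I) * sqe with hσ
  set m := (Complex.exp (-α * Complex.I) * ξ).im with hm
  obtain ⟨d, hd, hdb⟩ := ub_lower σ hq _ hwe hw C1 C2 (by linarith) (by linarith)
  refine ⟨K * d ^ (-(a+b)) * Real.exp (2 * (|a| + |b|) * |σ.re| * |C2|),
    min (m - 2 * a * σ.im) (-(2 * b * σ.im) - m), lt_min (by linarith) (by linarith),
    by positivity, ?_⟩
  intro C hC hC' η hη u
  set δ := min (m - 2 * a * σ.im) (-(2 * b * σ.im) - m)
  have d1 : δ ≤ m - 2 * a * σ.im := min_le_left _ _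
  have d2 : δ ≤ -(2 * b * σ.im) - m := min_le_right _ _
  have ht : timePt α C u ∈ timeStrip α sqe Λ := by
    have : Complex.exp (α * Complex.I) * timePt α C u = C + Complex.I * u := by
      unfold timePt
      rw [← mul_assoc, hee, one_mul]
    unfold timeStrip
    simp only [Set.mem_ofPred_eq, this]
    simp
    constructor <;> linarith
  have hgt := hbound _ ht
  have hE : -(2 * sqe) * timePt α C u = -2 * (σ * (C + Complex.I * u)) := by
    unfold timePt
    rw [hσ]; ring
  rw [hE] at hgt
  have hn1 : ‖Complex.exp (-2 * (σ * (C + Complex.I * u)))‖ =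
      Real.exp (-2 * σ.re * C + 2 * σ.im * u) := by
    rw [Complex.norm_exp]
    congr 1
    simp
    ring
  have hn2 : ‖Complex.exp (timePt α C u * η)‖ =
      Real.exp (C * (Complex.exp (-α * Complex.I) * η).re - u * m) := by
    rw [Complex.norm_exp, ← hη]
    congr 1
    rw [show timePt α C u * η = (C + Complex.I * u) * (Complex.exp (-α * Complex.I) * η) by
      unfold timePt; ring]
    rw [Complex.mul_re]
    simp
  obtain ⟨p1, p2⟩ := ub_pow _ _ d a b hab (by rw [hn1]; positivity) hd (hdb C hC hC' u)
  rw [norm_mul, hn2]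
  rw [hn1] at hgt p1 p2
  rw [← Real.exp_mul] at hgt p1 p2
  rw [← Real.exp_mul] at p2
  have hpc : |σ.re * C| ≤ |σ.re| * |C2| := by
    rw [abs_mul]
    gcongr
    linarith
  have hapc : |a * (σ.re * C)| ≤ |a| * (|σ.re| * |C2|) := by
    rw [abs_mul]; gcongr
  have hbpc : |b * (σ.re * C)| ≤ |b| * (|σ.re| * |C2|) := by
    rw [abs_mul]; gcongr
  have hapc' := abs_le.1 hapc
  have hbpc' := abs_le.1 hbpc
  have n1 : 0 ≤ |a| * (|σ.re| * |C2|) := by positivity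
  have n2 : 0 ≤ |b| * (|σ.re| * |C2|) := by positivity
  have fin : ∀ x : ℝ, ‖g (timePt α C u)‖ ≤ K * (d ^ (-(a+b)) * Real.exp x) →
      x - u * m ≤ 2 * (|a| + |b|) * |σ.re| * |C2| - δ * |u| →
      ‖g (timePt α C u)‖ * Real.exp (C * (Complex.exp (-α * Complex.I) * η).re - u * m) ≤
      K * d ^ (-(a+b)) * Real.exp (2 * (|a| + |b|) * |σ.re| * |C2|) *
        Real.exp (C * (Complex.exp (-α * Complex.I) * η).re) * Real.exp (-δ * |u|) := by
    intro x hx hxx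
    calc _ ≤ (K * (d ^ (-(a+b)) * Real.exp x)) *
            Real.exp (C * (Complex.exp (-α * Complex.I) * η).re - u * m) := by gcongr
      _ = K * d ^ (-(a+b)) * Real.exp (x - u * m + C * (Complex.exp (-α * Complex.I) * η).re) := by
          rw [show x - u * m + C * (Complex.exp (-α * Complex.I) * η).re =
            x + (C * (Complex.exp (-α * Complex.I) * η).re - u * m) by ring, Real.exp_add x]
          ring
      _ ≤ K * d ^ (-(a+b)) * Real.exp ((2 * (|a| + |b|) * |σ.re| * |C2| - δ * |u|)
            + C * (Complex.exp (-α * Complex.I) * η).re) := by gcongr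
      _ = _ := by
          rw [show 2 * (|a| + |b|) * |σ.re| * |C2| - δ * |u| +
            C * (Complex.exp (-α * Complex.I) * η).re = 2 * (|a| + |b|) * |σ.re| * |C2| +
            C * (Complex.exp (-α * Complex.I) * η).re + (-δ * |u|) by ring,
            Real.exp_add, Real.exp_add]
          ring
  rcases le_total 0 u with h0 | h0
  · apply fin ((-2 * σ.re * C + 2 * σ.im * u) * a)
    · refine hgt.trans ?_
      rw [mul_assoc]
      gcongr
    · rw [abs_of_nonneg h0]
      nlinarith
  · apply fin ((-2 * σ.re * C + 2 * σ.im * u) * (-b))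
    · refine hgt.trans ?_
      rw [mul_assoc]
      gcongr
    · rw [abs_of_nonpos h0]
      nlinarith

/-- Proposition 3.3, part 1, of the paper. The unfolded Borel
transform of a function that is `O(|x−√ε|^a |x+√ε|^b)`, `a + b > 0`, converges
absolutely on the strip `Ω_α(a,b)` of the Borel plane, is independent of the chosen
integration line, and has finite weighted sup-norm on every line of the strip. -/
theorem unfolded_borel_convergence
    (ε sqe : ℂ) (hsq : sqe ^ 2 = ε) (hsqe : sqe ≠ 0)
    (α : ℝ) (hα : α - Complex.arg sqe ∈ Set.Ioo 0 Real.pi)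
    (hw : 0 < stripWidth α sqe)
    (Λ : ℝ) (hΛ : 0 ≤ Λ) (hΛw : 2 * Λ < stripWidth α sqe)
    (a b : ℝ) (hab : 0 < a + b)
    (g : ℂ → ℂ) (hg : DifferentiableOn ℂ g (timeStrip α sqe Λ))
    (K : ℝ) (hK : 0 < K)
    (hbound : ∀ t ∈ timeStrip α sqe Λ,
      ‖g t‖ ≤ K * ‖Complex.exp (-(2 * sqe) * t)‖ ^ a *
        ‖1 - Complex.exp (-(2 * sqe) * t)‖ ^ (-(a + b))) :
    ∀ ξ ∈ borelStrip α sqe a b,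
      -- absolute convergence for every admissible line
      (∀ C : ℝ, Λ < C → C < stripWidth α sqe - Λ →
        Integrable fun u : ℝ => g (timePt α C u) * Complex.exp (timePt α C u * ξ)) ∧
      -- independence of the choice of the line
      (∀ C C' : ℝ, Λ < C → C < stripWidth α sqe - Λ →
        Λ < C' → C' < stripWidth α sqe - Λ →
        unfoldedBorel α g C ξ = unfoldedBorel α g C' ξ) ∧
      -- finite weighted sup-norm on every line of the strip Ω_α(a,b)
      (∀ Λ₁ : ℝ, Λ < Λ₁ → 2 * Λ₁ < stripWidth α sqe →
        ∀ C : ℝ, Λ < C → C < stripWidth α sqe - Λ →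
        ∀ c : ℂ, (∀ u : ℝ, c + Complex.exp (α * Complex.I) * u ∈ borelStrip α sqe a b) →
        ∃ M : ℝ, ∀ u : ℝ,
          ‖unfoldedBorel α g C (c + Complex.exp (α * Complex.I) * u)‖ *
            (‖Complex.exp (-(Complex.exp (-α * Complex.I) * Λ₁) *
                (c + Complex.exp (α * Complex.I) * u))‖ +
              ‖Complex.exp (-(-(Real.pi * Complex.I) / sqe -
                  Complex.exp (-α * Complex.I) * Λ₁) *
                (c + Complex.exp (α * Complex.I) * u))‖) ≤ M) := by
  have hee : Complex.exp (α * Complex.I) * Complex.exp (-α * Complex.I) = 1 := by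
    rw [← Complex.exp_add]; simp
  have hB := ub_bound sqe hsqe α hα hw Λ hΛ a b hab g K hK hbound
  have hmem : ∀ z : ℂ, Λ < z.re → z.re < stripWidth α sqe - Λ →
      Complex.exp (-α * Complex.I) * z ∈ timeStrip α sqe Λ := by
    intro z hz hz'
    unfold timeStrip
    rw [Set.mem_ofPred_eq, ← mul_assoc, hee, one_mul]
    exact ⟨hz, hz'⟩
  have hdiff : ∀ ξ : ℂ, DifferentiableOn ℂ (fun z : ℂ => g (Complex.exp (-α * Complex.I) * z) *
      Complex.exp (Complex.exp (-α * Complex.I) * z * ξ))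
      {z | Λ < z.re ∧ z.re < stripWidth α sqe - Λ} := by
    intro ξ
    apply DifferentiableOn.mul
    · exact hg.comp (by fun_prop) (fun z hz => hmem z hz.1 hz.2)
    · fun_prop
  have hint : ∀ ξ ∈ borelStrip α sqe a b, ∀ C : ℝ, Λ < C → C < stripWidth α sqe - Λ →
        Integrable fun u : ℝ => g (timePt α C u) * Complex.exp (timePt α C u * ξ) := by
    intro ξ hξ C h1 h2
    obtain ⟨M, δ, hδ, hM, hb⟩ := hB ξ hξ C C h1 h2
    have hcont : Continuous fun u : ℝ => g (timePt α C u) * Complex.exp (timePt α C u * ξ) := by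
      have := (hdiff ξ).continuousOn.comp_continuous
        (f := fun u : ℝ => (C : ℂ) + Complex.I * u) (by fun_prop) (by
          intro u
          simp
          exact ⟨h1, h2⟩)
      exact this
    refine Integrable.mono' ((ub_exp_int δ hδ).const_mul
      (M * Real.exp (C * (Complex.exp (-α * Complex.I) * ξ).re))) hcont.aestronglyMeasurable ?_
    exact Filter.Eventually.of_forall (hb C le_rfl le_rfl ξ rfl)
  have hind : ∀ ξ ∈ borelStrip α sqe a b, ∀ C C' : ℝ, Λ < C → C < stripWidth α sqe - Λ →
        Λ < C' → C' < stripWidth α sqe - Λ →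
        unfoldedBorel α g C ξ = unfoldedBorel α g C' ξ := by
    intro ξ hξ
    have main : ∀ C C' : ℝ, C ≤ C' → Λ < C → C < stripWidth α sqe - Λ →
        Λ < C' → C' < stripWidth α sqe - Λ →
        unfoldedBorel α g C ξ = unfoldedBorel α g C' ξ := by
      intro C C' hCC h1 h2 h3 h4
      obtain ⟨M, δ, hδ, hM, hb⟩ := hB ξ hξ C C' h1 h4
      unfold unfoldedBorel
      congr 1
      set X := (Complex.exp (-α * Complex.I) * ξ).re with hX
      refine ub_shift (fun z : ℂ => g (Complex.exp (-α * Complex.I) * z) *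
        Complex.exp (Complex.exp (-α * Complex.I) * z * ξ)) C C' hCC
        ((hdiff ξ).mono fun z hz => ⟨lt_of_lt_of_le h1 hz.1, lt_of_le_of_lt hz.2 h4⟩)
        (M * Real.exp (|C'| * |X|)) δ hδ ?_ (hint ξ hξ C h1 h2) (hint ξ hξ C' h3 h4)
      intro D hD hD' u
      refine (hb D hD hD' ξ rfl u).trans ?_
      have hD0 : 0 ≤ D := by linarith
      have hD1 : D ≤ |C'| := hD'.trans (le_abs_self _)
      have hDX : D * X ≤ |C'| * |X| :=
        (mul_le_mul_of_nonneg_left (le_abs_self X) hD0).trans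
          (mul_le_mul_of_nonneg_right hD1 (abs_nonneg X))
      exact mul_le_mul_of_nonneg_right
        (mul_le_mul_of_nonneg_left (Real.exp_le_exp.2 hDX) hM) (Real.exp_pos _).le
    intro C C' h1 h2 h3 h4
    rcases le_total C C' with h | h
    · exact main C C' h h1 h2 h3 h4
    · exact (main C' C h h3 h4 h1 h2).symm
  -- estimate of the transform through the line `D`
  have hest : ∀ c ∈ borelStrip α sqe a b, ∀ D : ℝ, Λ < D → D < stripWidth α sqe - Λ →
      ∃ N : ℝ, 0 ≤ N ∧ ∀ η : ℂ,
      (Complex.exp (-α * Complex.I) * η).im = (Complex.exp (-α * Complex.I) * c).im →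
      ‖unfoldedBorel α g D η‖ ≤ N * Real.exp (D * (Complex.exp (-α * Complex.I) * η).re) := by
    intro c hc D h1 h2
    obtain ⟨M, δ, hδ, hM, hb⟩ := hB c hc D D h1 h2
    refine ⟨‖(1 / (2 * Real.pi * Complex.I)) * (Complex.I * Complex.exp (-α * Complex.I))‖ *
      (M * ∫ u : ℝ, Real.exp (-δ * |u|)), ?_, ?_⟩
    · have : 0 ≤ ∫ u : ℝ, Real.exp (-δ * |u|) := integral_nonneg fun u => (Real.exp_pos _).le
      positivity
    · intro η hη
      unfold unfoldedBorel
      rw [norm_mul, mul_assoc ‖_‖]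
      refine mul_le_mul_of_nonneg_left ?_ (norm_nonneg _)
      refine (norm_integral_le_of_norm_le ((ub_exp_int δ hδ).const_mul
        (M * Real.exp (D * (Complex.exp (-α * Complex.I) * η).re)))
        (Filter.Eventually.of_forall (hb D le_rfl le_rfl η hη))).trans ?_
      rw [integral_const_mul]
      apply le_of_eq
      ring
  intro ξ hξ
  refine ⟨hint ξ hξ, hind ξ hξ, ?_⟩
  intro Λ₁ hΛ₁ hΛ₁w C hC1 hC2 c hc
  have hc0 : c ∈ borelStrip α sqe a b := by simpa using hc 0
  obtain ⟨N1, hN1, hb1⟩ := hest c hc0 Λ₁ hΛ₁ (by linarith)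
  obtain ⟨N2, hN2, hb2⟩ := hest c hc0 (stripWidth α sqe - Λ₁) (by linarith) (by linarith)
  set v : ℝ := (-(Complex.exp (α * Complex.I) * (Real.pi * Complex.I) / sqe)).im with hv
  set m : ℝ := (Complex.exp (-α * Complex.I) * c).im with hm
  refine ⟨N1 + N2 * Real.exp (v * m), ?_⟩
  intro u
  set η := c + Complex.exp (α * Complex.I) * u with hη
  have him : (Complex.exp (-α * Complex.I) * η).im = m := by
    have : Complex.exp (-α * Complex.I) * η = Complex.exp (-α * Complex.I) * c + (u : ℂ) := by
      rw [hη]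
      linear_combination (u : ℂ) * hee
    rw [this]
    simp [hm]
  have e1 : ‖Complex.exp (-(Complex.exp (-α * Complex.I) * Λ₁) * η)‖ =
      Real.exp (-(Λ₁ * (Complex.exp (-α * Complex.I) * η).re)) := by
    rw [Complex.norm_exp, ← Complex.re_ofReal_mul, ← Complex.neg_re]
    congr 2
    ring
  have e2 : ‖Complex.exp (-(-(Real.pi * Complex.I) / sqe -
      Complex.exp (-α * Complex.I) * Λ₁) * η)‖ =
      Real.exp (v * m) *
        Real.exp (-((stripWidth α sqe - Λ₁) * (Complex.exp (-α * Complex.I) * η).re)) := by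
    rw [Complex.norm_exp, ← Real.exp_add]
    congr 1
    have : -(-(Real.pi * Complex.I) / sqe - Complex.exp (-α * Complex.I) * Λ₁) * η =
        -((-(Complex.exp (α * Complex.I) * (Real.pi * Complex.I) / sqe) - Λ₁) *
          (Complex.exp (-α * Complex.I) * η)) := by
      linear_combination (-(Real.pi * Complex.I / sqe * η)) * hee
    rw [this, Complex.neg_re, Complex.mul_re, him, Complex.sub_re, Complex.sub_im, ← hv,
      Complex.neg_re]
    unfold stripWidth
    simp only [Complex.ofReal_re, Complex.ofReal_im]
    ring
  have c1 := hb1 η him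
  have c2 := hb2 η him
  rw [← hind η (hc u) C Λ₁ hC1 hC2 hΛ₁ (by linarith)] at c1
  rw [← hind η (hc u) C _ hC1 hC2 (by linarith) (by linarith)] at c2
  rw [e1, e2, mul_add]
  set X := (Complex.exp (-α * Complex.I) * η).re
  set W := stripWidth α sqe - Λ₁
  set V := ‖unfoldedBorel α g C η‖
  have f1 : V * Real.exp (-(Λ₁ * X)) ≤ N1 := by
    rw [Real.exp_neg, ← div_eq_mul_inv, div_le_iff₀ (Real.exp_pos _)]
    exact c1
  have f2 : V * Real.exp (-(W * X)) ≤ N2 := by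
    rw [Real.exp_neg, ← div_eq_mul_inv, div_le_iff₀ (Real.exp_pos _)]
    exact c2
  have f3 : V * Real.exp (-(W * X)) * Real.exp (v * m) ≤ N2 * Real.exp (v * m) := by gcongr
  linarith
end

section
/- With the notation of the context, let n ≥ 1 be an integer and 0 < C < −Re(e^{iα}πi/√ε). Then for every ξ ∈ Ω_α(n,0) with ξ ∉ 2√ε·ℤ, the unfolded Borel transform of (x−√ε)ⁿ satisfies (1/2πi)·i e^{−iα} ∫_ℝ (2√ε)ⁿ · e^{−2n√ε·t(u)} · (1 − e^{−2√ε·t(u)})^{−n} · e^{t(u)·ξ} du = (1 − e^{ξπi/√ε})^{−1} · ∏_{k=1}^{n−1} (ξ/k − 2√ε), where t(u) := e^{−iα}(C + iu) and the product is empty (equal to 1) for n = 1; the integral converges absolutely and is independent of C. -/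
open Complex MeasureTheory Real

/-- The lift of `(x − √ε)ⁿ` to the time coordinate:
`(2√ε)ⁿ e^{−2n√ε t} (1 − e^{−2√ε t})^{−n}`. -/
noncomputable def xMinusSqrtPow (sqe : ℂ) (n : ℕ) (t : ℂ) : ℂ :=
  (2 * sqe) ^ n * Complex.exp (-(2 * (n : ℂ) * sqe) * t) *
    (1 - Complex.exp (-(2 * sqe) * t)) ^ (-(n : ℤ))

noncomputable def ubF (p r : ℂ) (n : ℕ) (z : ℂ) : ℂ :=
  Complex.exp (r * z) / (1 - Complex.exp (-p * z)) ^ n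

lemma ub_norm_exp (r : ℂ) (x u : ℝ) :
    ‖Complex.exp (r * ((x : ℂ) + u * I))‖ = Real.exp (r.re * x - r.im * u) := by
  rw [Complex.norm_exp]; simp

lemma ub_zero {p z : ℂ} {W : ℝ} (hp : p.im < 0) (hW : W * (p.re ^ 2 + p.im ^ 2) = -(2 * π * p.im))
    (hz : |z.re| < W) (h : 1 - Complex.exp (-p * z) = 0) : z = 0 := by
  have h1 : Complex.exp (-p * z) = 1 := (sub_eq_zero.mp h).symm
  obtain ⟨k, hk⟩ := Complex.exp_eq_one_iff.mp h1
  have hre := congrArg Complex.re hk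
  have him := congrArg Complex.im hk
  simp at hre him
  have hpos : 0 < p.re ^ 2 + p.im ^ 2 := by nlinarith [sq_nonneg p.re]
  have key : (z.re - k * W) * (p.re ^ 2 + p.im ^ 2) = 0 := by
    have : k * W * (p.re ^ 2 + p.im ^ 2) = -(k * (2 * π) * p.im) := by
      rw [mul_assoc, hW]; ring
    rw [sub_mul, this]
    linear_combination (-p.re) * hre - p.im * him
  have hzk : z.re = k * W := by
    rcases mul_eq_zero.mp key with h | h
    · linarith
    · exact absurd h hpos.ne'
  have hWpos : 0 < W := lt_of_le_of_lt (abs_nonneg _) hz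
  have hk0 : k = 0 := by
    rw [hzk, abs_mul, abs_of_pos hWpos] at hz
    have : |(k : ℝ)| < 1 := by
      by_contra hcon
      push Not at hcon
      nlinarith
    have : |k| < 1 := by exact_mod_cast this
    exact Int.abs_lt_one_iff.mp this
  subst hk0
  have hpne : p ≠ 0 := by rintro rfl; simp at hp
  simpa [hpne] using hk

lemma ubF_bound_top {p : ℂ} (hp : p.im < 0) (r : ℂ) (n : ℕ) (M : ℝ) :
    ∃ T0 K : ℝ, ∀ x : ℝ, |x| ≤ M → ∀ u : ℝ, T0 ≤ u →
      ‖ubF p r n ((x : ℂ) + u * I)‖ ≤ K * Real.exp (-r.im * u) := by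
  refine ⟨(|p.re| * M + 1) / (-p.im), 2 ^ n * Real.exp (|r.re| * M), fun x hx u hu => ?_⟩
  have hu' : |p.re| * M + 1 ≤ u * (-p.im) := (div_le_iff₀ (by linarith)).mp hu
  have hw : ‖Complex.exp (-p * ((x : ℂ) + u * I))‖ ≤ 1 / 2 := by
    rw [ub_norm_exp]
    have h1 : (-p).re * x ≤ |p.re| * M := by
      calc (-p).re * x ≤ |(-p).re * x| := le_abs_self _
        _ = |p.re| * |x| := by rw [abs_mul]; simp
        _ ≤ _ := by gcongr
    have h2 : (-p).re * x - (-p).im * u ≤ -1 := by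
      simp only [neg_im] at *; linarith
    calc _ ≤ Real.exp (-1) := Real.exp_le_exp.mpr h2
      _ = (Real.exp 1)⁻¹ := Real.exp_neg 1
      _ ≤ 1 / 2 := by
        rw [← one_div]
        exact one_div_le_one_div_of_le (by norm_num) (by linarith [Real.add_one_le_exp (1:ℝ)])
  have hd : 1 / 2 ≤ ‖1 - Complex.exp (-p * ((x : ℂ) + u * I))‖ := by
    have := norm_sub_norm_le (1 : ℂ) (Complex.exp (-p * ((x : ℂ) + u * I)))
    rw [norm_one] at this
    linarith
  unfold ubF
  rw [norm_div, norm_pow, ub_norm_exp]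
  have h3 : r.re * x ≤ |r.re| * M := by
    calc r.re * x ≤ |r.re * x| := le_abs_self _
        _ = |r.re| * |x| := by rw [abs_mul]
        _ ≤ _ := by gcongr
  calc _ ≤ Real.exp (|r.re| * M + -r.im * u) / (1 / 2) ^ n := by
        gcongr; linarith
    _ = _ := by rw [Real.exp_add, one_div, inv_pow, div_inv_eq_mul]; ring

lemma ubF_reflect (p r : ℂ) (n : ℕ) (z : ℂ) :
    ‖ubF p r n z‖ = ‖ubF p (-(r + n * p)) n (-z)‖ := by
  have h : 1 - Complex.exp (-p * z) =
      -Complex.exp (-p * z) * (1 - Complex.exp (-p * -z)) := by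
    have : Complex.exp (-p * z) * Complex.exp (-p * -z) = 1 := by
      rw [← Complex.exp_add]; simp
    linear_combination -this
  have h2 : Complex.exp (-(r + n * p) * -z) = Complex.exp (r * z) * Complex.exp (p * z) ^ n := by
    rw [← Complex.exp_nat_mul, ← Complex.exp_add]; congr 1; ring
  unfold ubF
  rw [h, h2, norm_div, norm_div, mul_pow, norm_mul, norm_mul, norm_pow, norm_neg, norm_pow (Complex.exp (p * z)),
    show Complex.exp (-p * z) = (Complex.exp (p * z))⁻¹ by rw [← Complex.exp_neg]; congr 1; ring,
    norm_inv, inv_pow]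
  have : ‖Complex.exp (p * z)‖ ^ n ≠ 0 := by simp
  field_simp

lemma ubF_bound_bot {p : ℂ} (hp : p.im < 0) (r : ℂ) (n : ℕ) (M : ℝ) :
    ∃ T0 K : ℝ, ∀ x : ℝ, |x| ≤ M → ∀ u : ℝ, u ≤ T0 →
      ‖ubF p r n ((x : ℂ) + u * I)‖ ≤ K * Real.exp (-(r.im + n * p.im) * u) := by
  obtain ⟨T0, K, h⟩ := ubF_bound_top hp (-(r + n * p)) n M
  refine ⟨-T0, K, fun x hx u hu => ?_⟩
  have := h (-x) (by simpa using hx) (-u) (by linarith)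
  rw [ubF_reflect]
  convert this using 2
  · congr 1; push_cast; ring
  · simp; ring

lemma ub_den_ne {p : ℂ} {W C : ℝ} (hp : p.im < 0)
    (hW : W * (p.re ^ 2 + p.im ^ 2) = -(2 * π * p.im)) (hC0 : 0 < C) (hCW : C < W) (u : ℝ) :
    1 - Complex.exp (-p * ((C : ℂ) + u * I)) ≠ 0 := by
  intro h
  have := ub_zero hp hW (by simpa [abs_of_pos hC0] using hCW) h
  have := congrArg Complex.re this
  simp at this
  linarith

lemma ubF_cont {p : ℂ} {W C : ℝ} (hp : p.im < 0)
    (hW : W * (p.re ^ 2 + p.im ^ 2) = -(2 * π * p.im)) (hC0 : 0 < C) (hCW : C < W)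
    (r : ℂ) (n : ℕ) : Continuous (fun u : ℝ => ubF p r n ((C : ℂ) + u * I)) := by
  unfold ubF
  refine Continuous.div (by fun_prop) (by fun_prop) (fun u => pow_ne_zero _ (ub_den_ne hp hW hC0 hCW u))

lemma ubF_isBigO_top {p : ℂ} (hp : p.im < 0) (r : ℂ) (n : ℕ) (C : ℝ) :
    (fun u : ℝ => ubF p r n ((C : ℂ) + u * I)) =O[Filter.atTop] (fun u => Real.exp (-r.im * u)) := by
  obtain ⟨T0, K, h⟩ := ubF_bound_top hp r n |C|
  refine Asymptotics.IsBigO.of_bound K ?_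
  filter_upwards [Filter.eventually_ge_atTop T0] with u hu
  rw [Real.norm_of_nonneg (Real.exp_nonneg _)]
  exact h C le_rfl u hu

lemma ubF_isBigO_bot {p : ℂ} (hp : p.im < 0) (r : ℂ) (n : ℕ) (C : ℝ) :
    (fun u : ℝ => ubF p r n ((C : ℂ) + u * I)) =O[Filter.atBot]
      (fun u => Real.exp (-(r.im + n * p.im) * u)) := by
  obtain ⟨T0, K, h⟩ := ubF_bound_bot hp r n |C|
  refine Asymptotics.IsBigO.of_bound K ?_
  filter_upwards [Filter.eventually_le_atBot T0] with u hu
  rw [Real.norm_of_nonneg (Real.exp_nonneg _)]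
  exact h C le_rfl u hu

lemma ub_exp_top {a : ℝ} (ha : 0 < a) :
    Filter.Tendsto (fun u : ℝ => Real.exp (-a * u)) Filter.atTop (nhds 0) :=
  Real.tendsto_exp_atBot.comp (Filter.tendsto_id.const_mul_atTop_of_neg (by linarith))

lemma ub_exp_bot {a : ℝ} (ha : 0 < a) :
    Filter.Tendsto (fun u : ℝ => Real.exp (a * u)) Filter.atBot (nhds 0) :=
  Real.tendsto_exp_atBot.comp (Filter.tendsto_id.const_mul_atBot ha)

lemma ubF_integrable {p : ℂ} {W C : ℝ} (hp : p.im < 0)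
    (hW : W * (p.re ^ 2 + p.im ^ 2) = -(2 * π * p.im)) (hC0 : 0 < C) (hCW : C < W)
    (r : ℂ) (n : ℕ) (h0 : 0 < r.im) (h1 : r.im + n * p.im < 0) :
    Integrable (fun u : ℝ => ubF p r n ((C : ℂ) + u * I)) := by
  refine (ubF_cont hp hW hC0 hCW r n).locallyIntegrable.integrable_of_isBigO_atBot_atTop
    (ubF_isBigO_bot hp r n C) ?_ (ubF_isBigO_top hp r n C) ?_
  · exact ⟨Set.Iic 0, Filter.Iic_mem_atBot 0, integrableOn_exp_mul_Iic (by linarith) 0⟩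
  · exact ⟨Set.Ioi 0, Filter.Ioi_mem_atTop 0, integrableOn_exp_mul_Ioi (by linarith) 0⟩

/-- integration by parts -/
lemma ubF_parts {p : ℂ} {W C : ℝ} (hp : p.im < 0)
    (hW : W * (p.re ^ 2 + p.im ^ 2) = -(2 * π * p.im)) (hC0 : 0 < C) (hCW : C < W)
    (r : ℂ) (n : ℕ) (h0 : 0 < r.im) (h1 : r.im + n * p.im < 0) :
    r * (∫ u : ℝ, ubF p r n ((C : ℂ) + u * I)) =
      n * p * (∫ u : ℝ, ubF p (r - p) (n + 1) ((C : ℂ) + u * I)) := by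
  have i1 := ubF_integrable hp hW hC0 hCW r n h0 h1
  have i2 := ubF_integrable hp hW hC0 hCW (r - p) (n + 1) (by simp; linarith)
    (by simp; linarith)
  have hder : ∀ u : ℝ, HasDerivAt (fun u : ℝ => ubF p r n ((C : ℂ) + u * I))
      (I * (r * ubF p r n ((C : ℂ) + u * I) - n * p * ubF p (r - p) (n + 1) ((C : ℂ) + u * I))) u := by
    intro u
    have hz : HasDerivAt (fun u : ℝ => (C : ℂ) + u * I) I u := by
      simpa using ((Complex.ofRealCLM.hasDerivAt (x := u)).mul_const I).const_add (C : ℂ)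
    have hne := ub_den_ne hp hW hC0 hCW u
    have e1 : HasDerivAt (fun u : ℝ => Complex.exp (r * ((C : ℂ) + u * I)))
      (Complex.exp (r * ((C : ℂ) + u * I)) * (r * I)) u := (hz.const_mul r).cexp
    have e2 : HasDerivAt (fun u : ℝ => (1 - Complex.exp (-p * ((C : ℂ) + u * I))) ^ n)
      (n * (1 - Complex.exp (-p * ((C : ℂ) + u * I))) ^ (n - 1) *
        -(Complex.exp (-p * ((C : ℂ) + u * I)) * (-p * I))) u :=
        (((hz.const_mul (-p)).cexp).const_sub 1).pow n
    have := e1.fun_div e2 (pow_ne_zero n hne)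
    unfold ubF
    refine this.congr_deriv ?_
    have h3 : Complex.exp ((r - p) * ((C : ℂ) + u * I)) =
      Complex.exp (r * ((C : ℂ) + u * I)) * Complex.exp (-p * ((C : ℂ) + u * I)) := by
      rw [← Complex.exp_add]; congr 1; ring
    rw [h3]
    clear this e1 e2 h3
    generalize Complex.exp (-p * ((C : ℂ) + u * I)) = w at *
    rcases n with _ | m
    · simp; ring
    · simp only [Nat.add_sub_cancel]
      field_simp
      ring
  have key := integral_of_hasDerivAt_of_tendsto hder
    (((i1.const_mul r).sub (i2.const_mul (n * p))).const_mul I)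
    ((ubF_isBigO_bot hp r n C).trans_tendsto (ub_exp_bot (by linarith)))
    ((ubF_isBigO_top hp r n C).trans_tendsto (ub_exp_top h0))
  rw [integral_const_mul, integral_sub (i1.const_mul r) (i2.const_mul (n * p)),
    integral_const_mul, integral_const_mul, sub_zero] at key
  have := (mul_eq_zero.mp key).resolve_left I_ne_zero
  linear_combination this

lemma ubF_split {p : ℂ} {W C : ℝ} (hp : p.im < 0)
    (hW : W * (p.re ^ 2 + p.im ^ 2) = -(2 * π * p.im)) (hC0 : 0 < C) (hCW : C < W)
    (r : ℂ) (n : ℕ) (h0 : 0 < r.im) (h1 : r.im + n * p.im < 0) :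
    (∫ u : ℝ, ubF p r n ((C : ℂ) + u * I)) =
      (∫ u : ℝ, ubF p r (n + 1) ((C : ℂ) + u * I)) -
      (∫ u : ℝ, ubF p (r - p) (n + 1) ((C : ℂ) + u * I)) := by
  have i1 := ubF_integrable hp hW hC0 hCW r (n + 1) h0 (by push_cast; linarith)
  have i2 := ubF_integrable hp hW hC0 hCW (r - p) (n + 1) (by simp; linarith)
    (by simp; linarith)
  rw [← integral_sub i1 i2]
  congr 1
  ext u
  have hne := ub_den_ne hp hW hC0 hCW u
  unfold ubF
  have h3 : Complex.exp ((r - p) * ((C : ℂ) + u * I)) =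
      Complex.exp (r * ((C : ℂ) + u * I)) * Complex.exp (-p * ((C : ℂ) + u * I)) := by
      rw [← Complex.exp_add]; congr 1; ring
  rw [h3]
  clear h3
  generalize Complex.exp (-p * ((C : ℂ) + u * I)) = w at *
  field_simp
  ring

/-- continuity in the Borel variable -/
lemma ubF_limit {p : ℂ} {W C : ℝ} (hp : p.im < 0)
    (hW : W * (p.re ^ 2 + p.im ^ 2) = -(2 * π * p.im)) (hC0 : 0 < C) (hCW : C < W)
    (r : ℂ) (n : ℕ) (h0 : 0 < r.im) (h1 : r.im + n * p.im < 0) :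
    Filter.Tendsto (fun t : ℝ => ∫ u : ℝ, ubF p (r + t * I) n ((C : ℂ) + u * I))
      (nhdsWithin 0 (Set.Ioi 0)) (nhds (∫ u : ℝ, ubF p r n ((C : ℂ) + u * I))) := by
  set t0 : ℝ := -(r.im + n * p.im) / 2 with ht0
  have ht0' : 0 < t0 := by rw [ht0]; linarith
  have i1 := ubF_integrable hp hW hC0 hCW r n h0 h1
  have i2 := ubF_integrable hp hW hC0 hCW (r + t0 * I) n (by simp; linarith) (by simp; linarith)
  have hnorm : ∀ t u : ℝ, ‖ubF p (r + t * I) n ((C : ℂ) + u * I)‖ =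
      ‖ubF p r n ((C : ℂ) + u * I)‖ * Real.exp (-(t * u)) := by
    intro t u
    unfold ubF
    rw [norm_div, norm_div, ub_norm_exp, ub_norm_exp, div_mul_eq_mul_div, ← Real.exp_add]
    congr 2
    simp; ring
  refine tendsto_integral_filter_of_dominated_convergence
    (fun u => ‖ubF p r n ((C : ℂ) + u * I)‖ + ‖ubF p (r + t0 * I) n ((C : ℂ) + u * I)‖) ?_ ?_ ?_ ?_
  · exact Filter.Eventually.of_forall fun t =>
      (ubF_cont hp hW hC0 hCW (r + t * I) n).aestronglyMeasurable
  · filter_upwards [Ioo_mem_nhdsGT ht0'] with t ht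
    refine Filter.Eventually.of_forall fun u => ?_
    rw [hnorm, hnorm, ← mul_one_add]
    gcongr
    rcases le_total 0 u with hu | hu
    · have : Real.exp (-(t * u)) ≤ 1 := Real.exp_le_one_iff.mpr (by nlinarith [ht.1])
      linarith [Real.exp_nonneg (-(t0 * u))]
    · have : Real.exp (-(t * u)) ≤ Real.exp (-(t0 * u)) :=
        Real.exp_le_exp.mpr (by nlinarith [ht.2])
      linarith
  · exact i1.norm.add i2.norm
  · refine Filter.Eventually.of_forall fun u => ?_
    have hc : Continuous (fun t : ℝ => ubF p (r + t * I) n ((C : ℂ) + u * I)) := by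
      unfold ubF; fun_prop
    have := (hc.tendsto 0).mono_left (nhdsWithin_le_nhds (s := Set.Ioi 0))
    simpa using this

lemma ub_line_ne {a : ℝ} (ha : a ≠ 0) (u : ℝ) : (a : ℂ) + u * I ≠ 0 := by
  intro h
  have := congrArg Complex.re h
  simp at this
  exact ha this

lemma ub_int_inv {a : ℝ} (ha : a ≠ 0) (T : ℝ) :
    ∫ u in (-T)..T, ((a : ℂ) + u * I)⁻¹ = ((2 * Real.arctan (T / a) : ℝ) : ℂ) := by
  have hne : ∀ u : ℝ, a ^ 2 + u ^ 2 ≠ 0 := fun u => by positivity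
  have hder : ∀ u ∈ Set.uIcc (-T) T, HasDerivAt (fun u : ℝ => ((Real.arctan (u / a) : ℝ) : ℂ) -
      ((Real.log (a ^ 2 + u ^ 2) / 2 : ℝ) : ℂ) * I) (((a : ℂ) + u * I)⁻¹) u := by
    intro u _
    have h1 : HasDerivAt (fun u : ℝ => Real.arctan (u / a)) (1 / (1 + (u / a) ^ 2) * (1 / a)) u :=
      ((hasDerivAt_id u).div_const a).arctan
    have h2 : HasDerivAt (fun u : ℝ => Real.log (a ^ 2 + u ^ 2) / 2)
        ((2 * u) / (a ^ 2 + u ^ 2) / 2) u := by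
      have : HasDerivAt (fun u : ℝ => a ^ 2 + u ^ 2) (2 * u) u := by
        simpa using (hasDerivAt_pow 2 u).const_add (a ^ 2)
      exact (this.log (hne u)).div_const 2
    refine (h1.ofReal_comp.sub (h2.ofReal_comp.mul_const I)).congr_deriv ?_
    have h3 : ((a : ℂ) + u * I) ≠ 0 := ub_line_ne ha u
    have h4 : ((a : ℂ) ^ 2 + u ^ 2) ≠ 0 := by exact_mod_cast hne u
    have h5 : (a : ℂ) ≠ 0 := by exact_mod_cast ha
    apply eq_inv_of_mul_eq_one_right
    have h6 : (1 : ℂ) / (1 + ((u : ℂ) / a) ^ 2) * (1 / a) = a / (a ^ 2 + u ^ 2) := by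
      have : (1 + ((u : ℂ) / a) ^ 2) = (a ^ 2 + u ^ 2) / a ^ 2 := by field_simp
      rw [this]; field_simp
    push_cast
    rw [h6]
    field_simp
    ring_nf
    simp
  rw [intervalIntegral.integral_eq_sub_of_hasDerivAt hder]
  · rw [neg_div, Real.arctan_neg]; push_cast; simp; ring
  · apply Continuous.intervalIntegrable
    exact Continuous.inv₀ (by fun_prop) (ub_line_ne ha)

lemma ub_contour {p : ℂ} {W a b : ℝ} (hp : p.im < 0)
    (hW : W * (p.re ^ 2 + p.im ^ 2) = -(2 * π * p.im)) (ha : 0 < a) (haW : a < W)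
    (hb : 0 < b) (hbW : b < W) (r : ℂ) (h0 : 0 < r.im) (h1 : r.im + p.im < 0)
    (ia : Integrable (fun u : ℝ => ubF p r 1 ((a : ℂ) + u * I)))
    (ib : Integrable (fun u : ℝ => ubF p r 1 (((-b : ℝ) : ℂ) + u * I))) :
    (∫ u : ℝ, ubF p r 1 ((a : ℂ) + u * I)) - (∫ u : ℝ, ubF p r 1 (((-b : ℝ) : ℂ) + u * I)) =
      2 * π / p := by
  have hpne : p ≠ 0 := by rintro rfl; simp at hp
  set S : Set ℂ := {z | |z.re| < W} with hS
  have hSo : IsOpen S := isOpen_lt (by fun_prop) continuous_const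
  have hS0 : S ∈ nhds (0 : ℂ) := hSo.mem_nhds (by simp [hS]; linarith)
  set g : ℂ → ℂ := fun z => 1 - Complex.exp (-p * z) with hg
  have hg' : HasDerivAt g p 0 := by
    have : HasDerivAt (fun z : ℂ => -p * z) (-p) 0 := by
      simpa using (hasDerivAt_id (0 : ℂ)).const_mul (-p)
    have h2 := this.cexp.const_sub 1
    rw [mul_zero, Complex.exp_zero, one_mul, neg_neg] at h2
    exact h2
  set D : ℂ → ℂ := dslope g 0 with hD
  have hD0 : D 0 = p := by rw [hD, dslope_same, hg'.deriv]
  have hDz : ∀ z, z ≠ 0 → D z = g z / z := fun z hz => by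
    rw [hD, dslope_of_ne _ hz, slope_def_field]; simp [hg]
  have hDd : DifferentiableOn ℂ D S :=
    (Complex.differentiableOn_dslope hS0).mpr (by fun_prop)
  have hDne : ∀ z ∈ S, D z ≠ 0 := by
    intro z hz
    by_cases h : z = 0
    · rw [h, hD0]; exact hpne
    · rw [hDz z h]
      exact div_ne_zero (fun h' => h (ub_zero hp hW hz h')) h
  set N : ℂ → ℂ := fun z => Complex.exp (r * z) / D z with hN
  have hNd : DifferentiableOn ℂ N S := DifferentiableOn.div (by fun_prop) hDd hDne
  set k : ℂ → ℂ := dslope N 0 with hk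
  have hkd : DifferentiableOn ℂ k S := (Complex.differentiableOn_dslope hS0).mpr hNd
  have hkz : ∀ z, z ≠ 0 → k z = ubF p r 1 z - p⁻¹ * z⁻¹ := by
    intro z hz
    rw [hk, dslope_of_ne _ hz, slope_def_field]
    simp only [hN, hD0, hDz z hz, ubF, hg, pow_one, mul_zero, Complex.exp_zero, sub_zero]
    by_cases h : 1 - Complex.exp (-p * z) = 0
    · rw [h]; simp [div_eq_mul_inv]
    · field_simp
  have hrect : ∀ T : ℝ, (((∫ x : ℝ in (-b)..a, k (x + ((-T : ℝ) : ℂ) * I)) -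
      ∫ x : ℝ in (-b)..a, k (x + (T : ℂ) * I)) +
      I • ∫ y : ℝ in (-T)..T, k ((a : ℂ) + y * I)) -
      I • ∫ y : ℝ in (-T)..T, k (((-b : ℝ) : ℂ) + y * I) = 0 := by
    intro T
    have := Complex.integral_boundary_rect_eq_zero_of_differentiableOn k
      (((-b : ℝ) : ℂ) + ((-T : ℝ) : ℂ) * I) ((a : ℂ) + (T : ℂ) * I) (hkd.mono ?_)
    · simpa using this
    · intro z hz
      have hz1 := hz.1
      simp [Set.uIcc_of_le (show -b ≤ a by linarith)] at hz1
      change |z.re| < W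
      exact abs_lt.mpr ⟨by linarith [hz1.1], by linarith [hz1.2]⟩
  have hvert : ∀ c : ℝ, c ≠ 0 → Integrable (fun u : ℝ => ubF p r 1 ((c : ℂ) + u * I)) → ∀ T : ℝ,
      ∫ y : ℝ in (-T)..T, k ((c : ℂ) + y * I) =
      (∫ y : ℝ in (-T)..T, ubF p r 1 ((c : ℂ) + y * I)) -
        p⁻¹ * ((2 * Real.arctan (T / c) : ℝ) : ℂ) := by
    intro c hc hi T
    rw [← ub_int_inv hc, ← intervalIntegral.integral_const_mul, ← intervalIntegral.integral_sub]
    · refine intervalIntegral.integral_congr fun y _ => ?_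
      exact hkz _ (ub_line_ne hc y)
    · exact hi.intervalIntegrable
    · apply Continuous.intervalIntegrable
      exact Continuous.mul continuous_const (Continuous.inv₀ (by fun_prop) (ub_line_ne hc))
  have hkb : ∀ x T : ℝ, T ≠ 0 → ‖k (x + (T : ℂ) * I)‖ ≤
      ‖ubF p r 1 (x + (T : ℂ) * I)‖ + ‖p⁻¹‖ * |T|⁻¹ := by
    intro x T hT
    have hne : (x : ℂ) + T * I ≠ 0 := by
      intro h; have := congrArg Complex.im h; simp at this; exact hT this
    rw [hkz _ hne]
    refine (norm_sub_le _ _).trans ?_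
    rw [norm_mul, norm_inv ((x : ℂ) + T * I)]
    gcongr
    simpa using Complex.abs_im_le_norm ((x : ℂ) + T * I)
  have hinv : Filter.Tendsto (fun T : ℝ => ‖p⁻¹‖ * |T|⁻¹) Filter.atTop (nhds 0) := by
    simpa using (tendsto_inv_atTop_zero.comp Filter.tendsto_abs_atTop_atTop).const_mul ‖p⁻¹‖
  have hx : ∀ x ∈ Set.uIoc (-b) a, |x| ≤ W := by
    intro x hx
    rw [Set.uIoc_of_le (by linarith)] at hx
    exact abs_le.mpr ⟨by linarith [hx.1], by linarith [hx.2]⟩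
  have htop : Filter.Tendsto (fun T : ℝ => ∫ x : ℝ in (-b)..a, k (x + (T : ℂ) * I))
      Filter.atTop (nhds 0) := by
    obtain ⟨T0, K, h⟩ := ubF_bound_top hp r 1 W
    have hl : Filter.Tendsto (fun T : ℝ => (K * Real.exp (-r.im * T) + ‖p⁻¹‖ * |T|⁻¹) * |a - -b|)
        Filter.atTop (nhds 0) := by
      simpa using (((ub_exp_top h0).const_mul K).add hinv).mul_const |a - -b|
    refine squeeze_zero_norm' ?_ hl
    filter_upwards [Filter.eventually_ge_atTop T0, Filter.eventually_gt_atTop 0] with T hT hT0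
    refine intervalIntegral.norm_integral_le_of_norm_le_const fun x hxx => ?_
    exact (hkb x T hT0.ne').trans (by gcongr; exact h x (hx x hxx) T hT)
  have hbot : Filter.Tendsto (fun T : ℝ => ∫ x : ℝ in (-b)..a, k (x + ((-T : ℝ) : ℂ) * I))
      Filter.atTop (nhds 0) := by
    obtain ⟨T0, K, h⟩ := ubF_bound_bot hp r 1 W
    have hl : Filter.Tendsto (fun T : ℝ => (K * Real.exp (-(r.im + (1 : ℕ) * p.im) * (-T)) +
        ‖p⁻¹‖ * |T|⁻¹) * |a - -b|) Filter.atTop (nhds 0) := by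
      have := (ub_exp_bot (a := -(r.im + (1 : ℕ) * p.im)) (by push_cast; linarith)).comp
        Filter.tendsto_neg_atTop_atBot
      simpa using (((this).const_mul K).add hinv).mul_const |a - -b|
    refine squeeze_zero_norm' ?_ hl
    filter_upwards [Filter.eventually_ge_atTop (-T0), Filter.eventually_gt_atTop 0] with T hT hT0
    refine intervalIntegral.norm_integral_le_of_norm_le_const fun x hxx => ?_
    refine (hkb x (-T) (by linarith)).trans ?_
    rw [abs_neg]
    gcongr
    exact h x (hx x hxx) (-T) (by linarith)
  have hA : Filter.Tendsto (fun T : ℝ => ((2 * Real.arctan (T / a) : ℝ) : ℂ)) Filter.atTop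
      (nhds (π : ℂ)) := by
    refine (Complex.continuous_ofReal.tendsto _).comp ?_
    have h2 : Filter.Tendsto (fun T : ℝ => T / a) Filter.atTop Filter.atTop :=
      Filter.tendsto_id.atTop_div_const ha
    have := ((Real.tendsto_arctan_atTop.mono_right nhdsWithin_le_nhds).comp h2).const_mul 2
    rwa [show 2 * (π / 2) = π by ring] at this
  have hB : Filter.Tendsto (fun T : ℝ => ((2 * Real.arctan (T / -b) : ℝ) : ℂ)) Filter.atTop
      (nhds (-π : ℂ)) := by
    rw [← Complex.ofReal_neg]
    refine (Complex.continuous_ofReal.tendsto _).comp ?_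
    have h2 : Filter.Tendsto (fun T : ℝ => T / -b) Filter.atTop Filter.atBot := by
      simp only [div_neg]
      exact Filter.tendsto_neg_atTop_atBot.comp (Filter.tendsto_id.atTop_div_const hb)
    have := ((Real.tendsto_arctan_atBot.mono_right nhdsWithin_le_nhds).comp h2).const_mul 2
    rwa [show 2 * -(π / 2) = -π by ring] at this
  have hlim := ((hbot.sub htop).add
    (((intervalIntegral_tendsto_integral ia Filter.tendsto_neg_atTop_atBot
      Filter.tendsto_id).sub (hA.const_mul p⁻¹)).const_smul I)).sub
    (((intervalIntegral_tendsto_integral ib Filter.tendsto_neg_atTop_atBot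
      Filter.tendsto_id).sub (hB.const_mul p⁻¹)).const_smul I)
  have hfun : (fun T : ℝ => (0 : ℂ)) = _ := funext fun T => (hrect T).symm
  have h0' : Filter.Tendsto (fun T : ℝ => (0 : ℂ)) Filter.atTop (nhds 0) := tendsto_const_nhds
  rw [hfun] at h0'
  simp only [hvert a ha.ne' ia, hvert (-b) (by linarith) ib] at h0'
  have := tendsto_nhds_unique hlim h0'
  simp only [smul_eq_mul, sub_zero, zero_add, ← mul_sub] at this
  have := (mul_eq_zero.mp this).resolve_left I_ne_zero
  rw [div_eq_mul_inv]
  linear_combination this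

lemma ub_base {p : ℂ} {W C : ℝ} (hp : p.im < 0)
    (hW : W * (p.re ^ 2 + p.im ^ 2) = -(2 * π * p.im)) (hC0 : 0 < C) (hCW : C < W)
    (r : ℂ) (h0 : 0 < r.im) (h1 : r.im + p.im < 0) (hE : Complex.exp (2 * π * I * r / p) ≠ 1) :
    (∫ u : ℝ, ubF p r 1 ((C : ℂ) + u * I)) =
      2 * π / p * (1 - Complex.exp (2 * π * I * r / p))⁻¹ := by
  have hpne : p ≠ 0 := by rintro rfl; simp at hp
  have hpos : 0 < p.re ^ 2 + p.im ^ 2 := by nlinarith [sq_nonneg p.re]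
  set P : ℂ := -(2 * π * I / p) with hP
  have hPre : P.re = W := by
    rw [hP]
    simp [Complex.div_re, Complex.normSq_apply]
    rw [← neg_div, div_eq_iff (by nlinarith)]
    linarith
  have hper : ∀ u : ℝ, ubF p r 1 (((-(W - C) : ℝ) : ℂ) + u * I) =
      Complex.exp (2 * π * I * r / p) * ubF p r 1 ((C : ℂ) + ((u + P.im : ℝ) : ℂ) * I) := by
    intro u
    have hz : ((-(W - C) : ℝ) : ℂ) + u * I = ((C : ℂ) + ((u + P.im : ℝ) : ℂ) * I) - P := by
      apply Complex.ext <;> simp [hPre] <;> ring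
    rw [hz]
    unfold ubF
    have e1 : ∀ z : ℂ, Complex.exp (-p * (z - P)) = Complex.exp (-p * z) := by
      intro z
      have : -p * (z - P) = -p * z - 2 * π * I := by rw [hP]; field_simp; ring
      rw [this, Complex.exp_sub, Complex.exp_two_pi_mul_I, div_one]
    have e2 : ∀ z : ℂ, Complex.exp (r * (z - P)) =
        Complex.exp (2 * π * I * r / p) * Complex.exp (r * z) := by
      intro z
      rw [← Complex.exp_add]; congr 1; rw [hP]; ring
    rw [e1, e2, mul_div_assoc]
  have ia := ubF_integrable hp hW hC0 hCW r 1 h0 (by simpa using h1)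
  have ib : Integrable (fun u : ℝ => ubF p r 1 (((-(W - C) : ℝ) : ℂ) + u * I)) := by
    simp only [hper]
    exact (ia.comp_add_right P.im).const_mul _
  have key := ub_contour hp hW hC0 hCW (b := W - C) (by linarith) (by linarith) r h0 h1 ia ib
  simp only [hper] at key
  rw [integral_const_mul,
    integral_add_right_eq_self (fun u : ℝ => ubF p r 1 ((C : ℂ) + u * I)) P.im] at key
  have : 1 - Complex.exp (2 * π * I * r / p) ≠ 0 := sub_ne_zero.mpr hE.symm
  rw [← div_eq_mul_inv, eq_div_iff this]
  linear_combination key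

lemma ub_prod (y : ℂ) (m : ℕ) :
    ∏ k ∈ Finset.range (m + 1), ((y + 1) / ((k : ℂ) + 1) - 1) =
      y / ((m : ℂ) + 1) * ∏ k ∈ Finset.range m, (y / ((k : ℂ) + 1) - 1) := by
  induction m with
  | zero => simp
  | succ m ih =>
    rw [Finset.prod_range_succ, ih, Finset.prod_range_succ]
    have h1 : (m : ℂ) + 1 ≠ 0 := by exact_mod_cast Nat.succ_ne_zero m
    have h2 : (m : ℂ) + 1 + 1 ≠ 0 := by exact_mod_cast Nat.succ_ne_zero (m + 1)
    push_cast
    field_simp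
    ring

lemma ub_value {p : ℂ} {W C : ℝ} (hp : p.im < 0)
    (hW : W * (p.re ^ 2 + p.im ^ 2) = -(2 * π * p.im)) (hC0 : 0 < C) (hCW : C < W)
    (m : ℕ) : ∀ (r : ℂ), 0 < r.im → r.im + (m + 1) * p.im < 0 →
      Complex.exp (2 * π * I * r / p) ≠ 1 →
    (∫ u : ℝ, ubF p r (m + 1) ((C : ℂ) + u * I)) =
      2 * π / p * (1 - Complex.exp (2 * π * I * r / p))⁻¹ *
        ∏ k ∈ Finset.range m, ((r / p + (m + 1)) / ((k : ℂ) + 1) - 1) := by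
  have hpne : p ≠ 0 := by rintro rfl; simp at hp
  induction m with
  | zero =>
    intro r h0 h1 hE
    simpa using ub_base hp hW hC0 hCW r h0 (by simpa using h1) hE
  | succ m ih =>
    have hm : (m : ℂ) + 1 ≠ 0 := by exact_mod_cast Nat.succ_ne_zero m
    have hexp : ∀ r : ℂ, Complex.exp (2 * π * I * (r + p) / p) =
        Complex.exp (2 * π * I * r / p) := by
      intro r
      have : 2 * π * I * (r + p) / p = 2 * π * I * r / p + 2 * π * I := by field_simp
      rw [this, Complex.exp_add, Complex.exp_two_pi_mul_I, mul_one]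
    -- the upper part of the strip
    have hup : ∀ r : ℂ, 0 < r.im + p.im → r.im + (m + 1 + 1) * p.im < 0 →
      Complex.exp (2 * π * I * r / p) ≠ 1 →
      (∫ u : ℝ, ubF p r (m + 1 + 1) ((C : ℂ) + u * I)) =
      2 * π / p * (1 - Complex.exp (2 * π * I * r / p))⁻¹ *
        ∏ k ∈ Finset.range (m + 1), ((r / p + (m + 1 + 1)) / ((k : ℂ) + 1) - 1) := by
      intro r h0 h1 hE
      have hv := ih (r + p) (by simpa using h0) (by simp; linarith) (by rwa [hexp])
      have hpt := ubF_parts hp hW hC0 hCW (r + p) (m + 1) (by simpa using h0)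
        (by simp; linarith)
      rw [hv, hexp, add_sub_cancel_right] at hpt
      have e : (r + p) / p + ((m : ℂ) + 1) = r / p + (m + 1 + 1) := by field_simp; ring
      rw [e] at hpt
      rw [Finset.prod_range_succ]
      have e2 : (r / p + ((m : ℂ) + 1 + 1)) / (m + 1) - 1 = (r + p) / ((m + 1) * p) := by
        field_simp; ring
      rw [e2]
      push_cast at hpt
      have hmp : ((m : ℂ) + 1) * p ≠ 0 := mul_ne_zero hm hpne
      apply mul_left_cancel₀ hmp
      rw [← hpt]
      field_simp
    intro r h0 h1 hE
    push_cast at h1 ⊢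
    rcases lt_trichotomy (r.im + p.im) 0 with hlt | heq | hgt
    · by_cases h2 : r.im + (m + 1) * p.im < 0
      · have hv := ih r h0 h2 hE
        have hpt := ubF_parts hp hW hC0 hCW r (m + 1) h0 (by simpa using h2)
        have hs := ubF_split hp hW hC0 hCW r (m + 1) h0 (by simpa using h2)
        have e : r / p + ((m : ℂ) + 1 + 1) = (r / p + (m + 1)) + 1 := by ring
        rw [e, ub_prod]
        have hmp : ((m : ℂ) + 1) * p ≠ 0 := mul_ne_zero hm hpne
        push_cast at hpt
        have : (∫ u : ℝ, ubF p r (m + 1 + 1) ((C : ℂ) + u * I)) =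
            (r / p + (m + 1)) / (m + 1) * ∫ u : ℝ, ubF p r (m + 1) ((C : ℂ) + u * I) := by
          rw [sub_eq_iff_eq_add.mp hs.symm]
          apply mul_left_cancel₀ hmp
          rw [mul_add, ← hpt]
          generalize (∫ u : ℝ, ubF p r (m + 1) ((C : ℂ) + u * I)) = J
          field_simp
          ring
        rw [this, hv]
        ring
      · exfalso
        have : (0 : ℝ) ≤ m := Nat.cast_nonneg m
        nlinarith
    · have hl := ubF_limit hp hW hC0 hCW r (m + 1 + 1) h0 (by push_cast; linarith)
      have hr : Filter.Tendsto (fun t : ℝ =>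
          2 * π / p * (1 - Complex.exp (2 * π * I * (r + t * I) / p))⁻¹ *
          ∏ k ∈ Finset.range (m + 1), (((r + t * I) / p + (m + 1 + 1)) / ((k : ℂ) + 1) - 1))
          (nhdsWithin 0 (Set.Ioi 0)) (nhds (2 * π / p * (1 - Complex.exp (2 * π * I * r / p))⁻¹ *
        ∏ k ∈ Finset.range (m + 1), ((r / p + (m + 1 + 1)) / ((k : ℂ) + 1) - 1))) := by
        refine Filter.Tendsto.mono_left ?_ nhdsWithin_le_nhds
        have hc : ContinuousAt (fun t : ℝ =>
          2 * π / p * (1 - Complex.exp (2 * π * I * (r + t * I) / p))⁻¹ *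
          ∏ k ∈ Finset.range (m + 1), (((r + t * I) / p + (m + 1 + 1)) / ((k : ℂ) + 1) - 1)) 0 := by
          refine ContinuousAt.mul (ContinuousAt.mul continuousAt_const
            (ContinuousAt.inv₀ (Continuous.continuousAt (by fun_prop)) ?_))
            (Continuous.continuousAt (by fun_prop))
          simpa using sub_ne_zero.mpr hE.symm
        simpa [ContinuousAt] using hc
      refine tendsto_nhds_unique (hl.congr' ?_) hr
      have hEv : ∀ᶠ t : ℝ in nhdsWithin 0 (Set.Ioi 0),
          Complex.exp (2 * π * I * (r + t * I) / p) ≠ 1 := by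
        refine Filter.Eventually.filter_mono nhdsWithin_le_nhds ?_
        have hc : Continuous (fun t : ℝ => Complex.exp (2 * π * I * (r + t * I) / p)) := by
          fun_prop
        exact hc.continuousAt.eventually_ne (by simpa using hE)
      have hpos : 0 < -(r.im + (m + 1 + 1) * p.im) := by linarith
      filter_upwards [hEv, Ioo_mem_nhdsGT hpos] with t ht ht2
      have ht21 := ht2.1
      have ht22 := ht2.2
      exact hup (r + t * I) (by simp; linarith) (by simp; linarith) ht
    · exact hup r hgt h1 hE

/-- Proposition 3.3, part 3, of the paper. The unfolded Borel
transform of `(x − √ε)ⁿ` equals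
`(1 − e^{ξπi/√ε})⁻¹ · ∏_{k=1}^{n−1} (ξ/k − 2√ε)` on the strip `Ω_α(n,0)`, away from
`2√ε·ℤ`; the defining integral converges absolutely and does not depend on the chosen
integration line. -/
theorem unfolded_borel_of_xMinusSqrt_pow
    (ε sqe : ℂ) (hsq : sqe ^ 2 = ε) (hsqe : sqe ≠ 0)
    (α : ℝ) (hα : α - Complex.arg sqe ∈ Set.Ioo 0 Real.pi)
    (hw : 0 < stripWidth α sqe)
    (n : ℕ) (hn : 1 ≤ n)
    (C : ℝ) (hC0 : 0 < C) (hCw : C < stripWidth α sqe) :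
    ∀ ξ ∈ borelStrip α sqe (n : ℝ) 0, (∀ m : ℤ, ξ ≠ 2 * sqe * m) →
      -- absolute convergence
      (Integrable fun u : ℝ =>
        xMinusSqrtPow sqe n (timePt α C u) * Complex.exp (timePt α C u * ξ)) ∧
      -- the value of the unfolded Borel transform
      (1 / (2 * Real.pi * Complex.I)) * (Complex.I * Complex.exp (-α * Complex.I)) *
          (∫ u : ℝ, xMinusSqrtPow sqe n (timePt α C u) *
            Complex.exp (timePt α C u * ξ)) =
        (1 - Complex.exp (ξ * (Real.pi * Complex.I) / sqe))⁻¹ *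
          ∏ k ∈ Finset.Icc 1 (n - 1), (ξ / (k : ℂ) - 2 * sqe) ∧
      -- independence of the integration line
      (∀ C' : ℝ, 0 < C' → C' < stripWidth α sqe →
        (1 / (2 * Real.pi * Complex.I)) * (Complex.I * Complex.exp (-α * Complex.I)) *
            (∫ u : ℝ, xMinusSqrtPow sqe n (timePt α C' u) *
              Complex.exp (timePt α C' u * ξ)) =
          (1 / (2 * Real.pi * Complex.I)) * (Complex.I * Complex.exp (-α * Complex.I)) *
            (∫ u : ℝ, xMinusSqrtPow sqe n (timePt α C u) *
              Complex.exp (timePt α C u * ξ))) := by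
  intro ξ hξ hξn
  obtain ⟨m, rfl⟩ : ∃ m, n = m + 1 := ⟨n - 1, by omega⟩
  have hβ : Complex.exp (-α * Complex.I) ≠ 0 := Complex.exp_ne_zero _
  have hβ' : Complex.exp (α * Complex.I) = (Complex.exp (-α * Complex.I))⁻¹ := by
    rw [← Complex.exp_neg]; congr 1; ring
  unfold borelStrip at hξ
  unfold timePt
  have hWd : stripWidth α sqe =
      -((2 * π * I) / (Complex.exp (-α * Complex.I) * (2 * sqe))).re := by
    unfold stripWidth
    rw [hβ']
    congr 2
    field_simp
  generalize Complex.exp (-α * Complex.I) = β at *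
  obtain ⟨hξ1, hξ2⟩ := hξ
  set p : ℂ := β * (2 * sqe) with hpd
  have hpne : p ≠ 0 := by simp [hpd, hβ, hsqe]
  have hpsq : 0 < p.re ^ 2 + p.im ^ 2 := by
    have := Complex.normSq_pos.mpr hpne
    rw [Complex.normSq_apply] at this
    nlinarith
  have hW : stripWidth α sqe * (p.re ^ 2 + p.im ^ 2) = -(2 * π * p.im) := by
    rw [hWd]
    simp [Complex.div_re, Complex.normSq_apply]
    rw [div_mul_eq_mul_div, div_eq_iff (by nlinarith)]
    ring
  have hp : p.im < 0 := by
    have h1 := mul_pos hw hpsq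
    rw [hW] at h1
    have := Real.pi_pos
    by_contra hcon
    push Not at hcon
    nlinarith
  set r : ℂ := β * ξ - (m + 1) * p with hrd
  have hr0 : 0 < r.im := by
    have e : β * (((2 * ((m + 1 : ℕ) : ℝ) : ℝ) : ℂ) * sqe) = (m + 1) * p := by
      rw [hpd]; push_cast; ring
    rw [e] at hξ1
    rw [hrd, Complex.sub_im]
    linarith
  have hr1 : r.im + (m + 1) * p.im < 0 := by
    have e : ((m + 1) * p).im = (m + 1) * p.im := by simp
    rw [hrd, Complex.sub_im, e]
    simp at hξ2
    simp
    linarith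
  have hexp : Complex.exp (2 * π * I * r / p) = Complex.exp (ξ * (π * I) / sqe) := by
    have : 2 * π * I * r / p = ξ * (π * I) / sqe - ((m + 1 : ℕ) : ℂ) * (2 * π * I) := by
      rw [hrd, hpd]; push_cast; field_simp
    rw [this, Complex.exp_sub, Complex.exp_nat_mul_two_pi_mul_I, div_one]
  have hE : Complex.exp (2 * π * I * r / p) ≠ 1 := by
    rw [hexp]
    intro h
    obtain ⟨k, hk⟩ := Complex.exp_eq_one_iff.mp h
    apply hξn k
    have hpi : (π : ℂ) ≠ 0 := by exact_mod_cast Real.pi_ne_zero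
    rw [div_eq_iff hsqe] at hk
    have h2 : (ξ - 2 * sqe * k) * (π * I) = 0 := by linear_combination hk
    rcases mul_eq_zero.mp h2 with h3 | h3
    · exact sub_eq_zero.mp h3
    · exact absurd h3 (mul_ne_zero hpi I_ne_zero)
  have hfun : ∀ c u : ℝ, xMinusSqrtPow sqe (m + 1) (β * (c + I * u)) *
      Complex.exp (β * (c + I * u) * ξ) = (2 * sqe) ^ (m + 1) * ubF p r (m + 1) (c + u * I) := by
    intro c u
    unfold xMinusSqrtPow ubF
    have e1 : Complex.exp (r * (c + u * I)) =
        Complex.exp (-(2 * ((m + 1 : ℕ) : ℂ) * sqe) * (β * (c + I * u))) *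
        Complex.exp (β * (c + I * u) * ξ) := by
      rw [← Complex.exp_add]; congr 1; rw [hrd, hpd]; push_cast; ring
    have e2 : -p * (c + u * I) = -(2 * sqe) * (β * (c + I * u)) := by rw [hpd]; ring
    rw [e1, e2, zpow_neg, zpow_natCast, div_eq_mul_inv]
    ring
  have hval : ∀ c : ℝ, 0 < c → c < stripWidth α sqe →
      (1 / (2 * Real.pi * Complex.I)) * (Complex.I * β) *
          (∫ u : ℝ, xMinusSqrtPow sqe (m + 1) (β * (c + I * u)) *
            Complex.exp (β * (c + I * u) * ξ)) =
        (1 - Complex.exp (ξ * (Real.pi * Complex.I) / sqe))⁻¹ *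
          ∏ k ∈ Finset.Icc 1 (m + 1 - 1), (ξ / (k : ℂ) - 2 * sqe) := by
    intro c hc0 hcW
    simp only [hfun]
    rw [integral_const_mul, ub_value hp hW hc0 hcW m r hr0 hr1 hE, hexp]
    have hprod : ∏ k ∈ Finset.Icc 1 (m + 1 - 1), (ξ / (k : ℂ) - 2 * sqe) =
        (2 * sqe) ^ m * ∏ k ∈ Finset.range m, ((r / p + (m + 1)) / ((k : ℂ) + 1) - 1) := by
      have hry : r / p + ((m : ℂ) + 1) = ξ / (2 * sqe) := by
        rw [hrd, hpd]; field_simp; ring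
      rw [hry, Nat.add_sub_cancel]
      clear hξ1 hξ2 hr0 hr1 hrd hry hCw hcW hfun hn
      clear r hexp hE
      induction m with
      | zero => simp
      | succ j ihj =>
        rw [Finset.prod_Icc_succ_top (by omega), ihj, Finset.prod_range_succ]
        have : (j : ℂ) + 1 ≠ 0 := by exact_mod_cast Nat.succ_ne_zero j
        push_cast
        field_simp
        ring
    rw [hprod]
    have hpi : (π : ℂ) ≠ 0 := by exact_mod_cast Real.pi_ne_zero
    generalize ∏ k ∈ Finset.range m, ((r / p + (m + 1)) / ((k : ℂ) + 1) - 1) = Q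
    generalize (1 - Complex.exp (ξ * (Real.pi * Complex.I) / sqe))⁻¹ = E
    rw [hpd]
    field_simp
    ring
  refine ⟨?_, hval C hC0 hCw, fun C' h0 h1 => ?_⟩
  · simp only [hfun]
    exact (ubF_integrable hp hW hC0 hCw r (m + 1) hr0 (by push_cast; exact hr1)).const_mul _
  · rw [hval C' h0 h1, hval C hC0 hCw]
end
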